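/- arXiv:2511.02001 — 2 statements merged into one kernel-verified Lean document; each statement's English description precedes it below -/
import Mathlib

section
/- Let Φ and Ψ be linear flows on X = ℝ^d. Assume there exist an open set U ⊂ X with 0 ∈ U and a continuous one-to-one function f : U → X with T_x^Φ = T_{f(x)}^Ψ for every x ∈ U. Then σ(Φ) ∩ iℝ = σ(Ψ) ∩ iℝ, i.e. the generators A^Φ and A^Ψ have the same purely imaginary (complex) eigenvalues. -/
noncomputable section
namespace LF

open Filter Topology

/-- `ℝ^d` with the Euclidean norm. -/
abbrev Euc (d : ℕ) := EuclideanSpace ℝ (Fin d)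

variable {d : ℕ}

/-- The time-`t` map of the linear flow on `ℝ^d` generated by the matrix `A`,
i.e. `x ↦ exp (t A) x`. -/
def linFlow (A : Matrix (Fin d) (Fin d) ℝ) (t : ℝ) (x : Euc d) : Euc d :=
  Matrix.toEuclideanLin (NormedSpace.exp (t • A)) x

/-- The orbit `{Φ_t x : t ∈ ℝ}` of `x` under the linear flow generated by `A`. -/
def flowOrbit (A : Matrix (Fin d) (Fin d) ℝ) (x : Euc d) : Set (Euc d) :=
  Set.range fun t : ℝ => linFlow A t x

/-- `Φ` is `h`-related to `Ψ`: the homeomorphism `h` maps every orbit of the flow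
generated by `A` onto an orbit of the flow generated by `B`. -/
def IsOrbitEquiv (A B : Matrix (Fin d) (Fin d) ℝ) (h : Euc d ≃ₜ Euc d) : Prop :=
  ∀ x : Euc d, h '' flowOrbit A x = flowOrbit B (h x)

/-- `f` satisfies a `β`-Hölder condition on some ball centred at `0`. -/
def HolderNearZero (β : ℝ) (f : Euc d → Euc d) : Prop :=
  ∃ r > (0 : ℝ), ∃ K : ℝ, ∀ x ∈ Metric.ball (0 : Euc d) r, ∀ y ∈ Metric.ball (0 : Euc d) r,
    dist (f x) (f y) ≤ K * dist x y ^ β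

/-- `h ∈ 𝓗_β`: `h 0 = 0` and `h`, `h⁻¹` both satisfy a `β`-Hölder condition near `0`. -/
def MemHolderClass (β : ℝ) (h : Euc d ≃ₜ Euc d) : Prop :=
  h 0 = 0 ∧ HolderNearZero β ⇑h ∧ HolderNearZero β ⇑h.symm

/-- `h ∈ 𝓗_0`: homeomorphisms fixing `0`. -/
def MemH0 (h : Euc d ≃ₜ Euc d) : Prop := h 0 = 0

/-- `h ∈ 𝓗_{0⁺} = ⋃_{γ>0} 𝓗_γ`. -/
def MemH0plus (h : Euc d ≃ₜ Euc d) : Prop := ∃ γ : ℝ, 0 < γ ∧ MemHolderClass γ h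

/-- `h ∈ 𝓗_{1⁻} = ⋂_{0<γ<1} 𝓗_γ`. -/
def MemH1minus (h : Euc d ≃ₜ Euc d) : Prop := ∀ γ : ℝ, 0 < γ → γ < 1 → MemHolderClass γ h

/-- `h ∈ 𝓗_{β⁻} = ⋂_{0<γ<β} 𝓗_γ`. -/
def MemHBelow (β : ℝ) (h : Euc d ≃ₜ Euc d) : Prop :=
  ∀ γ : ℝ, 0 < γ → γ < β → MemHolderClass γ h

/-- `h ∈ 𝓗_{β⁺} = ⋃_{γ>β} 𝓗_γ`. -/
def MemHAbove (β : ℝ) (h : Euc d ≃ₜ Euc d) : Prop :=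
  ∃ γ : ℝ, β < γ ∧ MemHolderClass γ h

/-- `φ ~^⋆ ψ`: `φ` is `h`-related to `ψ` for some `h` in the class `P`. -/
def RelEquivWith (P : (Euc d ≃ₜ Euc d) → Prop) (A B : Matrix (Fin d) (Fin d) ℝ) : Prop :=
  ∃ h : Euc d ≃ₜ Euc d, P h ∧ IsOrbitEquiv A B h

/-- `φ ≃^⋆ ψ`: there are `h` in the class `P` and `α ≠ 0` with
`h (φ t x) = ψ (α t) (h x)` for all `t`, `x`. -/
def SimEquivWith (P : (Euc d ≃ₜ Euc d) → Prop) (A B : Matrix (Fin d) (Fin d) ℝ) : Prop :=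
  ∃ (h : Euc d ≃ₜ Euc d) (α : ℝ), α ≠ 0 ∧ P h ∧
    ∀ (t : ℝ) (x : Euc d), h (linFlow A t x) = linFlow B (α * t) (h x)

/-- The stable set `X_S^Φ = {x : Φ_t x → 0 as t → ∞}`. -/
def stableSet (A : Matrix (Fin d) (Fin d) ℝ) : Set (Euc d) :=
  {x | Tendsto (fun t : ℝ => linFlow A t x) atTop (𝓝 0)}

/-- The unstable set `X_U^Φ = {x : Φ_t x → 0 as t → -∞}`. -/
def unstableSet (A : Matrix (Fin d) (Fin d) ℝ) : Set (Euc d) :=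
  {x | Tendsto (fun t : ℝ => linFlow A t x) atBot (𝓝 0)}

/-- The central set `X_C^Φ = {x : e^{-ε|t|} Φ_t x → 0 as |t| → ∞, for every ε > 0}`. -/
def centralSet (A : Matrix (Fin d) (Fin d) ℝ) : Set (Euc d) :=
  {x | ∀ ε > (0 : ℝ),
    Tendsto (fun t : ℝ => Real.exp (-(ε * |t|)) • linFlow A t x) (atBot ⊔ atTop) (𝓝 0)}

/-- The stable subspace of the flow generated by `A` (the stable set is a subspace,
so taking its span is innocuous). -/
def XS (A : Matrix (Fin d) (Fin d) ℝ) : Submodule ℝ (Euc d) := Submodule.span ℝ (stableSet A)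

/-- The unstable subspace. -/
def XU (A : Matrix (Fin d) (Fin d) ℝ) : Submodule ℝ (Euc d) := Submodule.span ℝ (unstableSet A)

/-- The central subspace. -/
def XC (A : Matrix (Fin d) (Fin d) ℝ) : Submodule ℝ (Euc d) := Submodule.span ℝ (centralSet A)

/-- The hyperbolic subspace `X_H^Φ = X_S^Φ ⊕ X_U^Φ`. -/
def XH (A : Matrix (Fin d) (Fin d) ℝ) : Submodule ℝ (Euc d) := XS A ⊔ XU A

def dimS (A : Matrix (Fin d) (Fin d) ℝ) : ℕ := Module.finrank ℝ (XS A)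
def dimU (A : Matrix (Fin d) (Fin d) ℝ) : ℕ := Module.finrank ℝ (XU A)
def dimHyp (A : Matrix (Fin d) (Fin d) ℝ) : ℕ := Module.finrank ℝ (XH A)

/-- The central-part generators `A^{Φ_C}` and `α A^{Ψ_C}` are similar, i.e.
`Q A_C = (α B_C) Q` for some linear isomorphism `Q : X_C^Φ → X_C^Ψ`. -/
def IsCentralSimilar (A B : Matrix (Fin d) (Fin d) ℝ) (α : ℝ) : Prop :=
  ∃ (hA : ∀ x ∈ XC A, Matrix.toEuclideanLin A x ∈ XC A)
    (hB : ∀ x ∈ XC B, Matrix.toEuclideanLin B x ∈ XC B)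
    (Q : XC A ≃ₗ[ℝ] XC B),
    ∀ x : XC A, Q ((Matrix.toEuclideanLin A).restrict hA x)
      = α • (Matrix.toEuclideanLin B).restrict hB (Q x)

/-- The forward Lyapunov exponent `λ_+^Φ(x) = lim_{t→∞} log ‖Φ_t x‖ / t`
(the limit exists for `x ≠ 0`, so it equals the `limsup` used here). -/
def lyap (A : Matrix (Fin d) (Fin d) ℝ) (x : Euc d) : ℝ :=
  Filter.limsup (fun t : ℝ => Real.log ‖linFlow A t x‖ / t) atTop

/-- The Lyapunov space `L^Φ(s) = {x : λ_+^Φ(x) ≤ s}` (with `λ_+^Φ(0) = -∞`), as a set. -/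
def lyapSet (A : Matrix (Fin d) (Fin d) ℝ) (s : ℝ) : Set (Euc d) :=
  {x | x = 0 ∨ lyap A x ≤ s}

/-- `ℓ^Φ(s) = dim L^Φ(s)` (the Lyapunov set is a subspace, so taking its span is innocuous). -/
def ell (A : Matrix (Fin d) (Fin d) ℝ) (s : ℝ) : ℕ :=
  Module.finrank ℝ (Submodule.span ℝ (lyapSet A s))

/-- The `(j+1)`-st smallest Lyapunov exponent `λ_{j+1}^Φ`, counted with multiplicity. -/
def lyapExp (A : Matrix (Fin d) (Fin d) ℝ) (j : ℕ) : ℝ :=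
  sInf {s : ℝ | j + 1 ≤ ell A s}

/-- The Lyapunov space at `s` of the restriction of the flow to the invariant set `V`. -/
def lyapSetIn (A : Matrix (Fin d) (Fin d) ℝ) (V : Set (Euc d)) (s : ℝ) : Set (Euc d) :=
  {x | x ∈ V ∧ (x = 0 ∨ lyap A x ≤ s)}

def ellIn (A : Matrix (Fin d) (Fin d) ℝ) (V : Set (Euc d)) (s : ℝ) : ℕ :=
  Module.finrank ℝ (Submodule.span ℝ (lyapSetIn A V s))

/-- The `(j+1)`-st smallest Lyapunov exponent of the flow restricted to `V`. -/
def lyapExpIn (A : Matrix (Fin d) (Fin d) ℝ) (V : Set (Euc d)) (j : ℕ) : ℝ :=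
  sInf {s : ℝ | j + 1 ≤ ellIn A V s}

/-- `λ_{j+1}^{Φ_H}`: the `(j+1)`-st smallest Lyapunov exponent of the restriction
of the flow to the hyperbolic subspace. -/
def lyapExpH (A : Matrix (Fin d) (Fin d) ℝ) (j : ℕ) : ℝ :=
  lyapExpIn A (XH A) j

/-- The flow generated by `A` is stable: every orbit tends to `0` as `t → ∞`. -/
def IsStable (A : Matrix (Fin d) (Fin d) ℝ) : Prop := ∀ x : Euc d, x ∈ stableSet A

/-- The flow generated by `A` is unstable: every orbit tends to `0` as `t → -∞`. -/
def IsUnstable (A : Matrix (Fin d) (Fin d) ℝ) : Prop := ∀ x : Euc d, x ∈ unstableSet A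

/-- The flow generated by `A` is hyperbolic: `X = X_S ⊕ X_U`. -/
def IsHyperbolic (A : Matrix (Fin d) (Fin d) ℝ) : Prop := IsCompl (XS A) (XU A)

/-- `ρ_+(Φ,Ψ) = (min_j λ_j^Φ/λ_j^Ψ) / |max_j λ_j^Φ/λ_j^Ψ|`. -/
def rhoPlus (A B : Matrix (Fin d) (Fin d) ℝ) : ℝ :=
  (⨅ j : Fin d, lyapExp A j / lyapExp B j) / |⨆ j : Fin d, lyapExp A j / lyapExp B j|

/-- The Lyapunov cross ratio `ρ(Φ,Ψ) = max {ρ_+(Φ,Ψ), ρ_+(Φ*,Ψ)}`, where `Φ*` is the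
time-reversal of `Φ`, generated by `-A`. -/
def rho (A B : Matrix (Fin d) (Fin d) ℝ) : ℝ := max (rhoPlus A B) (rhoPlus (-A) B)

/-- The minimal period `T_x^Φ = inf {t > 0 : Φ_t x = x} ∈ [0,∞]` (with `inf ∅ = ∞`). -/
def minPeriod (A : Matrix (Fin d) (Fin d) ℝ) (x : Euc d) : EReal :=
  sInf {T : EReal | ∃ t : ℝ, 0 < t ∧ linFlow A t x = x ∧ T = (t : EReal)}

/-- The set of complex eigenvalues of the real matrix `A`. -/
def cSpec {n : ℕ} (A : Matrix (Fin n) (Fin n) ℝ) : Set ℂ :=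
  spectrum ℂ (A.map Complex.ofReal)

/-- `x` is a fixed point of the flow generated by `A`. -/
def IsFixedPt (A : Matrix (Fin d) (Fin d) ℝ) (x : Euc d) : Prop :=
  ∀ t : ℝ, linFlow A t x = x

/-- The nilpotent `m × m` Jordan block `J_m` (ones on the superdiagonal). -/
def jordanNil (m : ℕ) : Matrix (Fin m) (Fin m) ℝ :=
  Matrix.of fun i j => if (i : ℕ) + 1 = (j : ℕ) then 1 else 0

section InvDomain
open MeasureTheory Metric

lemma exists_poly_det {n : ℕ} (M : Euc n →ₗ[ℝ] Euc n) :
    ∃ p : Polynomial ℝ, p.natDegree ≤ n ∧ ∀ t : ℝ, p.eval t = LinearMap.det (1 + t • M) := by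
  classical
  let b := (EuclideanSpace.basisFun (Fin n) ℝ).toBasis
  let m := LinearMap.toMatrix b b M
  refine ⟨Matrix.det ((Polynomial.X : Polynomial ℝ) • m.map Polynomial.C
    + (1 : Matrix (Fin n) (Fin n) ℝ).map Polynomial.C), ?_, ?_⟩
  · simpa using Polynomial.natDegree_det_X_add_C_le m 1
  · intro t
    rw [← LinearMap.det_toMatrix b, ← Polynomial.coe_evalRingHom, RingHom.map_det]
    congr 1
    ext i j
    simp [m, Matrix.one_apply, add_comm, LinearMap.toMatrix_one]
    split_ifs <;> simp [mul_comm]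

/-- extension by zero of a function vanishing on the unit sphere is Lipschitz -/
lemma lipschitz_ext {n : ℕ} (v : Euc n → Euc n) (K : NNReal)
    (hK : LipschitzOnWith K v (closedBall 0 1)) (hv : ∀ x, ‖x‖ = 1 → v x = 0) :
    LipschitzWith K (fun x => if ‖x‖ ≤ 1 then v x else 0) := by
  have key : ∀ x y : Euc n, ‖x‖ ≤ 1 → 1 < ‖y‖ → dist (v x) 0 ≤ K * dist x y := by
    intro x y hx hy
    have hc : Continuous (fun s : ℝ => ‖AffineMap.lineMap x y s‖) :=
      (AffineMap.lineMap_continuous).norm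
    obtain ⟨s, hs, hs1⟩ : (1 : ℝ) ∈ (fun s : ℝ => ‖AffineMap.lineMap x y s‖) '' Set.Icc 0 1 := by
      apply intermediate_value_Icc zero_le_one hc.continuousOn
      simp [hx, hy.le]
    have h1 := hK.dist_le_mul x (by simpa using hx) (AffineMap.lineMap x y s)
      (by simp only [mem_closedBall, dist_zero_right]; exact hs1.le)
    rw [hv _ hs1] at h1
    refine h1.trans ?_
    rw [dist_left_lineMap]
    gcongr
    rw [Real.norm_of_nonneg hs.1]
    exact mul_le_of_le_one_left dist_nonneg hs.2
  refine LipschitzWith.of_dist_le_mul fun x y => ?_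
  by_cases hx : ‖x‖ ≤ 1 <;> by_cases hy : ‖y‖ ≤ 1
  · simp only [hx, hy, if_true]
    exact hK.dist_le_mul x (by simpa using hx) y (by simpa using hy)
  · simp only [hx, hy, if_true, if_false]
    exact key x y hx (not_le.1 hy)
  · simp only [hx, hy, if_true, if_false]
    rw [dist_comm, dist_comm x]
    exact key y x hy (not_le.1 hx)
  · simp [hx, hy]; positivity

lemma bij_perturb {n : ℕ} (u : Euc n → Euc n) (K : NNReal) (hu : LipschitzWith K u)
    (t : ℝ) (ht : 0 ≤ t) (htK : t * K < 1) : Function.Bijective (fun x => x + t • u x) := by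
  have happ : ApproximatesLinearOn (fun x => x + t • u x)
      ((ContinuousLinearEquiv.refl ℝ (Euc n) : Euc n ≃L[ℝ] Euc n) : Euc n →L[ℝ] Euc n)
      Set.univ (t.toNNReal * K) := by
    intro x _ y _
    have := hu.dist_le_mul x y
    rw [dist_eq_norm, dist_eq_norm] at this
    have h2 : x + t • u x - (y + t • u y) - ((ContinuousLinearEquiv.refl ℝ (Euc n) :
      Euc n ≃L[ℝ] Euc n) : Euc n →L[ℝ] Euc n) (x - y) = t • (u x - u y) := by
      simp [smul_sub]; abel
    rw [h2, norm_smul, Real.norm_of_nonneg ht]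
    push_cast
    rw [Real.coe_toNNReal _ ht, mul_assoc]
    gcongr
  have hc : Subsingleton (Euc n) ∨ t.toNNReal * K <
      ‖((ContinuousLinearEquiv.refl ℝ (Euc n)).symm : Euc n →L[ℝ] Euc n)‖₊⁻¹ := by
    rcases subsingleton_or_nontrivial (Euc n) with h | h
    · exact Or.inl h
    · right
      have : ‖((ContinuousLinearEquiv.refl ℝ (Euc n)).symm : Euc n →L[ℝ] Euc n)‖₊ = 1 := by
        rw [← NNReal.coe_inj]
        simp
      rw [this, ← NNReal.coe_lt_coe]
      push_cast
      rw [Real.coe_toNNReal _ ht]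
      simpa using htK
  exact ⟨Set.injOn_univ.1 (happ.injOn hc), happ.surjective hc⟩

lemma no_retract {n : ℕ} (r : Euc n → Euc n) (hr : ContDiff ℝ 1 r)
    (hr1 : ∀ x, ‖r x‖ = 1) (hrs : ∀ x, ‖x‖ = 1 → r x = x) : False := by
  set v : Euc n → Euc n := fun x => r x - x with hvdef
  have hv : ContDiff ℝ 1 v := hr.sub contDiff_id
  have hdv : Continuous (fderiv ℝ v) := hv.continuous_fderiv one_ne_zero
  have hvd : Differentiable ℝ v := hv.differentiable one_ne_zero
  have hcomp : IsCompact (closedBall (0 : Euc n) 1) := isCompact_closedBall _ _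
  obtain ⟨C, hC⟩ := hcomp.exists_bound_of_continuousOn hdv.continuousOn
  have hK : LipschitzOnWith C.toNNReal v (closedBall 0 1) := by
    refine Convex.lipschitzOnWith_of_nnnorm_fderiv_le (𝕜 := ℝ) (fun x _ => hvd x) (fun x hx => ?_)
      (convex_closedBall _ _)
    exact NNReal.le_toNNReal_of_coe_le (hC x hx)
  have hv0 : ∀ x, ‖x‖ = 1 → v x = 0 := fun x hx => by simp [v, hrs x hx]
  have hu := lipschitz_ext v _ hK hv0
  set K := C.toNNReal
  -- determinant
  let D : ℝ → Euc n → ℝ := fun t x =>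
    (ContinuousLinearMap.id ℝ (Euc n) + t • fderiv ℝ v x).det
  have hDc : Continuous (fun p : ℝ × Euc n => D p.1 p.2) := by
    apply ContinuousLinearMap.continuous_det.comp
    fun_prop
  have hev : ∀ᶠ t in 𝓝 (0:ℝ), ∀ x ∈ closedBall (0 : Euc n) 1, 0 < D t x := by
    apply hcomp.eventually_forall_of_forall_eventually
    intro x _
    apply hDc.continuousAt.eventually (lt_mem_nhds _)
    change 0 < (ContinuousLinearMap.id ℝ (Euc n) + (0:ℝ) • fderiv ℝ v x).det
    have : ContinuousLinearMap.id ℝ (Euc n) + (0:ℝ) • fderiv ℝ v x =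
        ContinuousLinearMap.id ℝ (Euc n) := by
      ext y; simp
    rw [this]
    simp [ContinuousLinearMap.det]
  obtain ⟨ε, hε, hεD⟩ := Metric.eventually_nhds_iff.1 hev
  -- integral for small t
  have hvol : ∀ t : ℝ, 0 ≤ t → t < ε → t * K < 1 → t < 1 →
      ∫ x in ball (0 : Euc n) 1, D t x = (volume (ball (0 : Euc n) 1)).toReal := by
    intro t ht0 htε htK ht1
    have hbij := bij_perturb _ _ hu t ht0 htK
    set F : Euc n → Euc n := fun x => x + t • v x with hF
    have hbF : ∀ x, ‖x‖ ≤ 1 → (fun x => x + t • (if ‖x‖ ≤ 1 then v x else 0)) x = F x := by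
      intro x hx; simp [hx, hF]
    have himg : F '' ball 0 1 = ball 0 1 := by
      apply Set.Subset.antisymm
      · rintro _ ⟨x, hx, rfl⟩
        rw [mem_ball_zero_iff] at hx ⊢
        have : F x = (1 - t) • x + t • r x := by simp [hF, v, smul_sub, sub_smul]; abel
        rw [this]
        calc _ ≤ ‖(1 - t) • x‖ + ‖t • r x‖ := norm_add_le _ _
          _ = (1 - t) * ‖x‖ + t := by
            rw [norm_smul, norm_smul, hr1, Real.norm_of_nonneg ht0,
              Real.norm_of_nonneg (by linarith)]; ring
          _ < 1 := by nlinarith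
      · intro y hy
        obtain ⟨x, hx⟩ := hbij.2 y
        by_cases hx1 : ‖x‖ < 1
        · exact ⟨x, by simpa using hx1, by rw [← hbF x hx1.le]; exact hx⟩
        · exfalso
          have : (if ‖x‖ ≤ 1 then v x else 0) = 0 := by
            split_ifs with h
            · exact hv0 x (le_antisymm h (not_lt.1 hx1))
            · rfl
          simp only [this, smul_zero, add_zero] at hx
          subst hx
          exact hx1 (by simpa using hy)
    have hinj : Set.InjOn F (ball 0 1) := by
      intro x hx y hy hxy
      apply hbij.1
      rw [mem_ball_zero_iff] at hx hy
      rw [hbF x hx.le, hbF y hy.le, hxy]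
    have hder : ∀ x ∈ ball (0 : Euc n) 1, HasFDerivWithinAt F
        (ContinuousLinearMap.id ℝ (Euc n) + t • fderiv ℝ v x) (ball 0 1) x := by
      intro x _
      exact ((hasFDerivAt_id x).add ((hvd x).hasFDerivAt.const_smul t)).hasFDerivWithinAt
    have hl := lintegral_abs_det_fderiv_eq_addHaar_image volume measurableSet_ball hder hinj
    rw [himg] at hl
    have hpos : ∀ x ∈ ball (0 : Euc n) 1, 0 < D t x := fun x hx =>
      hεD (by simpa [abs_of_nonneg ht0] using htε) x (ball_subset_closedBall hx)
    rw [integral_eq_lintegral_of_nonneg_ae, ← hl]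
    · congr 1
      refine setLIntegral_congr_fun measurableSet_ball fun x hx => ?_
      simp only [D] at hpos ⊢
      rw [abs_of_pos (hpos x hx)]
    · filter_upwards [ae_restrict_mem measurableSet_ball] with x hx using (hpos x hx).le
    · exact (hDc.comp (Continuous.prodMk_right t)).aestronglyMeasurable
  -- nodes
  obtain ⟨δ, hδ, hδ'⟩ : ∃ δ : ℝ, 0 < δ ∧ ∀ t, 0 ≤ t → t ≤ δ → t < ε ∧ t * K < 1 ∧ t < 1 := by
    refine ⟨min (ε/2) (min (1/2) (1/(2*(K+1)))), by positivity, fun t ht0 ht => ?_⟩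
    simp only [le_min_iff] at ht
    obtain ⟨h1, h2, h3⟩ := ht
    refine ⟨by linarith, ?_, by linarith⟩
    rw [le_div_iff₀ (by positivity)] at h3
    nlinarith
  let τ : ℕ → ℝ := fun i => δ / (i + 1)
  have hτ0 : ∀ i, 0 ≤ τ i := fun i => by positivity
  have hτδ : ∀ i, τ i ≤ δ := fun i => div_le_self hδ.le (by linarith [(Nat.cast_nonneg i : (0:ℝ) ≤ i)])
  have hτinj : Set.InjOn τ (Finset.range (n+1) : Set ℕ) := by
    intro i _ j _ hij
    simp only [τ] at hij
    rw [div_eq_div_iff (by positivity) (by positivity)] at hij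
    have := mul_left_cancel₀ hδ.ne' hij
    exact_mod_cast (by linarith : (i:ℝ) = j)
  have hlag : ∀ t x, D t x = ∑ i ∈ Finset.range (n+1),
      D (τ i) x * (Lagrange.basis (Finset.range (n+1)) τ i).eval t := by
    intro t x
    obtain ⟨p, hp, hpe⟩ := exists_poly_det (fderiv ℝ v x : Euc n →ₗ[ℝ] Euc n)
    have hDp : ∀ t, D t x = p.eval t := fun t => by rw [hpe]; rfl
    have hdeg : p.degree < (Finset.range (n+1)).card := by
      refine lt_of_le_of_lt Polynomial.degree_le_natDegree ?_
      simp only [Finset.card_range]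
      exact_mod_cast Nat.lt_succ_of_le hp
    have := Lagrange.eq_interpolate hτinj hdeg
    rw [hDp, this, Lagrange.interpolate_apply, Polynomial.eval_finsetSum]
    refine Finset.sum_congr rfl fun i _ => ?_
    rw [Polynomial.eval_mul, Polynomial.eval_C, hDp]
  have hD1 : ∀ x, D 1 x = 0 := by
    intro x
    have hrd : HasFDerivAt r (fderiv ℝ r x) x := (hr.differentiable one_ne_zero x).hasFDerivAt
    have h1 : fderiv ℝ v x = fderiv ℝ r x - ContinuousLinearMap.id ℝ _ :=
      (hrd.sub (hasFDerivAt_id x)).fderiv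
    have h2 : ∀ w, inner ℝ (r x) (fderiv ℝ r x w) = 0 := by
      intro w
      have h3 := hrd.inner ℝ hrd
      have h4 : (fun y => inner ℝ (r y) (r y)) = fun _ => (1:ℝ) := by
        ext y; rw [real_inner_self_eq_norm_sq, hr1]; norm_num
      rw [h4] at h3
      have h5 := congrArg (fun L => L w) (h3.unique (hasFDerivAt_const _ _))
      simp [fderivInnerCLM_apply, real_inner_comm] at h5
      exact h5
    simp only [D, h1, one_smul, add_sub_cancel]
    by_contra hne
    have hu : IsUnit (LinearMap.det (fderiv ℝ r x : Euc n →ₗ[ℝ] Euc n)) := isUnit_iff_ne_zero.2 hne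
    have hu2 := (LinearMap.isUnit_iff_isUnit_det _).2 hu
    obtain ⟨w, hw⟩ := ((Module.End.isUnit_iff _).1 hu2).2 (r x)
    have h3 := h2 w
    rw [show fderiv ℝ r x w = r x from hw, real_inner_self_eq_norm_sq, hr1] at h3
    norm_num at h3
  have h1 : ∫ x in ball (0 : Euc n) 1, D 1 x = (volume (ball (0 : Euc n) 1)).toReal := by
    simp_rw [hlag 1]
    rw [integral_finsetSum]
    · simp_rw [integral_mul_const]
      have : ∀ i ∈ Finset.range (n+1), (∫ x in ball (0 : Euc n) 1, D (τ i) x) *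
          (Lagrange.basis (Finset.range (n+1)) τ i).eval 1 = (volume (ball (0 : Euc n) 1)).toReal *
          (Lagrange.basis (Finset.range (n+1)) τ i).eval 1 := fun i _ => by
        obtain ⟨a, b, c⟩ := hδ' _ (hτ0 i) (hτδ i)
        rw [hvol _ (hτ0 i) a b c]
      rw [Finset.sum_congr rfl this, ← Finset.mul_sum, ← Polynomial.eval_finsetSum,
        Lagrange.sum_basis hτinj (by simp)]
      simp
    · intro i _
      apply Integrable.mul_const
      exact ((hDc.comp (Continuous.prodMk_right (τ i))).continuousOn.integrableOn_compact
        hcomp).mono_set ball_subset_closedBall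
  simp only [hD1, integral_zero] at h1
  have := ENNReal.toReal_pos (measure_ball_pos volume (0 : Euc n) one_pos).ne' measure_ball_lt_top.ne
  linarith
end InvDomain

section InvDomain2
open MeasureTheory Metric

lemma exists_norm_lower_bound {n : ℕ} {s : Set (Euc n)} (hs : IsCompact s) {g : Euc n → Euc n}
    (hg : ContinuousOn g s) (h0 : ∀ x ∈ s, g x ≠ 0) : ∃ δ > 0, ∀ x ∈ s, δ ≤ ‖g x‖ := by
  rcases s.eq_empty_or_nonempty with rfl | hne
  · exact ⟨1, one_pos, by simp⟩
  · obtain ⟨x, hx, hmin⟩ := hs.exists_isMinOn hne hg.norm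
    exact ⟨‖g x‖, norm_pos_iff.2 (h0 x hx), fun y hy => hmin hy⟩

lemma exists_zero_of_near_id {n : ℕ} (H : Euc n → Euc n) (hH : ContinuousOn H (closedBall 0 1))
    (h : ∀ x ∈ closedBall (0 : Euc n) 1, ‖H x - x‖ ≤ 3/10) :
    ∃ x ∈ closedBall (0 : Euc n) 1, H x = 0 := by
  by_contra! hno
  obtain ⟨μ, hμ, hμH⟩ := exists_norm_lower_bound (isCompact_closedBall 0 1) hH hno
  let P : Euc n → Euc n := fun x => (max 1 ‖x‖)⁻¹ • x
  have hmax : ∀ x : Euc n, 0 < max 1 ‖x‖ := fun x => lt_max_of_lt_left one_pos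
  have hPc : Continuous P := by
    refine Continuous.smul (f := fun x : Euc n => (max 1 ‖x‖)⁻¹) ?_ continuous_id
    exact Continuous.inv₀ (by fun_prop) (fun x => (hmax x).ne')
  have hPB : ∀ x, P x ∈ closedBall (0 : Euc n) 1 := by
    intro x
    rw [mem_closedBall_zero_iff, norm_smul, norm_inv, Real.norm_of_nonneg (hmax x).le,
      inv_mul_le_iff₀ (hmax x), mul_one]
    exact le_max_right _ _
  have hPid : ∀ x ∈ closedBall (0 : Euc n) 1, P x = x := by
    intro x hx
    rw [mem_closedBall_zero_iff] at hx
    simp [P, max_eq_left hx]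
  have hHc : Continuous (H ∘ P) := hH.comp_continuous hPc hPB
  obtain ⟨S, hS, hSd, -⟩ := hHc.exists_contDiff_approx 1 (ε := fun _ => min μ (1/10))
    continuous_const (fun _ => by positivity)
  have hS0 : ∀ x ∈ closedBall (0 : Euc n) 1, S x ≠ 0 := by
    intro x hx h0
    have h1 := hSd x
    rw [h0, dist_zero_left, Function.comp_apply, hPid x hx] at h1
    exact absurd (hμH x hx) (not_le.2 (h1.trans_le (min_le_left _ _)))
  have hSi : ∀ x ∈ closedBall (0 : Euc n) 1, ‖S x - x‖ ≤ 4/10 := by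
    intro x hx
    have h1 := (hSd x).trans_le (min_le_right _ _)
    rw [Function.comp_apply, hPid x hx, dist_eq_norm] at h1
    have h2 := h x hx
    have h3 := norm_add_le (S x - H x) (H x - x)
    rw [sub_add_sub_cancel] at h3
    linarith
  let χ : ContDiffBump (0 : Euc n) := ⟨1/2, 1, by norm_num, by norm_num⟩
  let K : Euc n → Euc n := fun x => x + χ x • (S x - x)
  have hχc : ContDiff ℝ 1 χ := χ.contDiff
  have hK : ContDiff ℝ 1 K := contDiff_id.add (hχc.smul (hS.sub contDiff_id))
  have hKout : ∀ x : Euc n, 1 ≤ ‖x‖ → K x = x := by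
    intro x hx
    have : χ x = 0 := χ.zero_of_le_dist (by simpa using hx)
    simp [K, this]
  have hK0 : ∀ x, K x ≠ 0 := by
    intro x hx0
    rcases le_or_gt 1 ‖x‖ with h1 | h1
    · rw [hKout x h1] at hx0
      rw [hx0, norm_zero] at h1; norm_num at h1
    have hxB : x ∈ closedBall (0 : Euc n) 1 := by simpa using h1.le
    rcases le_or_gt ‖x‖ (1/2) with h2 | h2
    · have : χ x = 1 := χ.one_of_mem_closedBall (by simp only [mem_closedBall, dist_zero_right]; exact h2)
      simp only [K, this, one_smul, add_sub_cancel] at hx0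
      exact hS0 x hxB hx0
    · have h3 : ‖χ x • (S x - x)‖ ≤ 4/10 := by
        rw [norm_smul, Real.norm_of_nonneg χ.nonneg]
        have := hSi x hxB
        nlinarith [χ.le_one (x := x), χ.nonneg (x := x), norm_nonneg (S x - x)]
      have h4 : x = - (χ x • (S x - x)) := eq_neg_of_add_eq_zero_left hx0
      rw [h4, norm_neg] at h2
      linarith
  refine no_retract (fun x => ‖K x‖⁻¹ • K x) ?_ ?_ ?_
  · exact ((hK.norm ℝ hK0).inv (fun x => norm_ne_zero_iff.2 (hK0 x))).smul hK
  · intro x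
    rw [norm_smul, norm_inv, norm_norm, inv_mul_cancel₀ (norm_ne_zero_iff.2 (hK0 x))]
  · intro x hx
    simp [hKout x hx.ge, hx]

instance tietzeEuc (n : ℕ) : TietzeExtension (Euc n) :=
  TietzeExtension.of_homeo (EuclideanSpace.equiv (Fin n) ℝ).toHomeomorph

lemma invdom_ball {n : ℕ} (f : Euc n → Euc n) (hf : ContinuousOn f (closedBall 0 1))
    (hinj : Set.InjOn f (closedBall 0 1)) : f '' closedBall 0 1 ∈ 𝓝 (f 0) := by
  by_contra hn
  set B := closedBall (0 : Euc n) 1 with hB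
  have h0B : (0 : Euc n) ∈ B := by simp [hB]
  have hBc : IsCompact B := isCompact_closedBall _ _
  have : CompactSpace B := isCompact_iff_compactSpace.1 hBc
  have hcB : Continuous (fun x : B => f x) := continuousOn_iff_continuous_domRestrict.1 hf
  have hemb : IsClosedEmbedding (fun x : B => f x) :=
    hcB.isClosedEmbedding (fun x y hxy => Subtype.ext (hinj x.2 y.2 hxy))
  obtain ⟨G, hG⟩ := ContinuousMap.exists_extension hemb
    (⟨Subtype.val, continuous_subtype_val⟩ : C(B, Euc n))
  have hGf : ∀ x ∈ B, G (f x) = x := fun x hx => by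
    have := congrArg (fun φ : C(B, Euc n) => φ ⟨x, hx⟩) hG
    simpa using this
  have hGc : Continuous G := G.continuous
  obtain ⟨ρ, hρ, hρG⟩ := Metric.continuousAt_iff.1 (hGc.continuousAt (x := f 0)) (1/10 : ℝ)
    (by norm_num)
  rw [hGf 0 h0B] at hρG
  set ε := ρ / 2 with hε
  have hε0 : 0 < ε := by positivity
  obtain ⟨c, hc, hcf⟩ : ∃ c, dist c (f 0) < ε ∧ c ∉ f '' B := by
    by_contra! hcon
    exact hn (mem_of_superset (ball_mem_nhds _ hε0) fun c hc => hcon c hc)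
  have hGsmall : ∀ y, ‖y - c‖ ≤ ε → ‖G y‖ ≤ 1/10 := by
    intro y hy
    have : dist y (f 0) < ρ := by
      have := dist_triangle y c (f 0)
      rw [dist_eq_norm y c] at this
      linarith
    have := hρG this
    rw [dist_zero_right] at this
    exact this.le
  set Sg : Set (Euc n) := (f '' B) ∩ {y | ε ≤ ‖y - c‖} with hSg
  have hSgc : IsCompact Sg :=
    (hBc.image_of_continuousOn hf).inter_right (isClosed_le continuous_const (by fun_prop))
  obtain ⟨δ0, hδ0, hδG⟩ := exists_norm_lower_bound hSgc hGc.continuousOn (by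
    rintro _ ⟨⟨x, hx, rfl⟩, hy⟩ h0
    rw [hGf x hx] at h0
    subst h0
    rw [dist_comm, dist_eq_norm] at hc
    exact absurd hy (not_le.2 hc))
  set δ := min δ0 (1/10) with hδ
  have hδp : 0 < δ := by positivity
  obtain ⟨P, hP, hPd, -⟩ := hGc.exists_contDiff_approx 1 (ε := fun _ => δ/2)
    continuous_const (fun _ => by positivity)
  have hnull : volume (P '' sphere c ε) = 0 := by
    apply addHaar_image_eq_zero_of_differentiableOn_of_addHaar_eq_zero
    · exact (hP.differentiable one_ne_zero).differentiableOn
    · exact Measure.addHaar_sphere_of_ne_zero _ _ hε0.ne'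
  obtain ⟨a, ha, haP⟩ : ∃ a : Euc n, ‖a‖ < δ/2 ∧ a ∉ P '' sphere c ε := by
    by_contra! hcon
    have hsub : ball (0 : Euc n) (δ/2) ⊆ P '' sphere c ε := fun a ha =>
      hcon a (by simpa using ha)
    exact (measure_ball_pos volume (0 : Euc n) (half_pos hδp)).ne'
      (measure_mono_null hsub hnull)
  have hQG : ∀ y, ‖P y - a - G y‖ < δ := by
    intro y
    have h1 := hPd y
    rw [dist_eq_norm] at h1
    have h2 := norm_sub_le (P y - G y) a
    rw [show P y - a - G y = P y - G y - a by abel]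
    linarith
  let Φ : Euc n → Euc n := fun y => c + (max (ε / ‖y - c‖) 1) • (y - c)
  have hΦ1 : ∀ y, y ≠ c → ε ≤ ‖y - c‖ → Φ y = y := by
    intro y hyc hy
    have : ε / ‖y - c‖ ≤ 1 := by rw [div_le_one (by linarith)]; exact hy
    simp [Φ, max_eq_right this]
  have hΦ2 : ∀ y, y ≠ c → ‖y - c‖ < ε → ‖Φ y - c‖ = ε := by
    intro y hyc hy
    have hpos : 0 < ‖y - c‖ := norm_pos_iff.2 (sub_ne_zero.2 hyc)
    have : 1 ≤ ε / ‖y - c‖ := by rw [one_le_div hpos]; exact hy.le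
    simp only [Φ, max_eq_left this, add_sub_cancel_left]
    rw [norm_smul, Real.norm_of_nonneg (by positivity), div_mul_cancel₀ _ hpos.ne']
  have hne : ∀ x ∈ B, f x ≠ c := fun x hx h => hcf ⟨x, hx, h⟩
  obtain ⟨x, hx, hx0⟩ := exists_zero_of_near_id (fun x => P (Φ (f x)) - a) (by
    have hΦc : ContinuousOn Φ {c}ᶜ := by
      apply continuousOn_const.add
      refine ContinuousOn.smul (f := fun y : Euc n => max (ε / ‖y - c‖) 1)
        (g := fun y : Euc n => y - c) ?_ (by fun_prop)
      refine ContinuousOn.sup ?_ continuousOn_const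
      refine continuousOn_const.div (by fun_prop) ?_
      intro y hy
      exact norm_ne_zero_iff.2 (sub_ne_zero.2 hy)
    have := hP.continuous.comp_continuousOn (hΦc.comp hf (fun x hx => hne x hx))
    exact this.sub continuousOn_const) (by
    intro x hx
    rcases le_or_gt ε ‖f x - c‖ with h1 | h1
    · have h2 := hQG (f x)
      rw [hGf x hx] at h2
      simp only [hΦ1 _ (hne x hx) h1]
      have := min_le_right δ0 (1/10)
      linarith
    · have h2 := hQG (Φ (f x))
      have h3 := hGsmall _ (hΦ2 _ (hne x hx) h1).le
      have h4 := hGsmall _ h1.le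
      rw [hGf x hx] at h4
      have h5 := norm_sub_le (P (Φ (f x)) - a) x
      have h6 := norm_add_le (P (Φ (f x)) - a - G (Φ (f x))) (G (Φ (f x)))
      rw [sub_add_cancel] at h6
      have := min_le_right δ0 (1/10)
      linarith)
  rcases le_or_gt ε ‖f x - c‖ with h1 | h1
  · simp only [hΦ1 _ (hne x hx) h1] at hx0
    have h2 := hQG (f x)
    rw [hx0, zero_sub, norm_neg] at h2
    have h3 := hδG (f x) ⟨⟨x, hx, rfl⟩, h1⟩
    have := min_le_left δ0 (1/10)
    linarith
  · apply haP
    refine ⟨Φ (f x), ?_, sub_eq_zero.1 hx0⟩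
    rw [mem_sphere, dist_eq_norm]
    exact hΦ2 _ (hne x hx) h1

theorem invariance_of_domain {n : ℕ} {U : Set (Euc n)} (hU : IsOpen U) {f : Euc n → Euc n}
    (hf : ContinuousOn f U) (hinj : Set.InjOn f U) : IsOpen (f '' U) := by
  rw [isOpen_iff_mem_nhds]
  rintro _ ⟨x, hx, rfl⟩
  obtain ⟨ρ, hρ, hρU⟩ := Metric.nhds_basis_closedBall.mem_iff.1 (hU.mem_nhds hx)
  have hmaps : ∀ z ∈ closedBall (0 : Euc n) 1, x + ρ • z ∈ U := by
    intro z hz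
    apply hρU
    rw [mem_closedBall_zero_iff] at hz
    rw [mem_closedBall, dist_eq_norm, add_sub_cancel_left, norm_smul, Real.norm_of_nonneg hρ.le]
    nlinarith
  have := invdom_ball (fun z => f (x + ρ • z)) (hf.comp (by fun_prop) hmaps) (by
    intro z hz w hw hzw
    have := hinj (hmaps z hz) (hmaps w hw) hzw
    exact smul_right_injective _ hρ.ne' (add_left_cancel this))
  simp only [smul_zero, add_zero] at this
  refine mem_of_superset this ?_
  rintro _ ⟨z, hz, rfl⟩
  exact ⟨_, hmaps z hz, rfl⟩

theorem inverse_continuousOn {n : ℕ} {U : Set (Euc n)} (hU : IsOpen U) {f : Euc n → Euc n}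
    (hf : ContinuousOn f U) (hinj : Set.InjOn f U) :
    ContinuousOn (Function.invFunOn f U) (f '' U) := by
  have hleft : ∀ x ∈ U, Function.invFunOn f U (f x) = x := fun x hx => hinj.leftInvOn_invFunOn hx
  rw [_root_.continuousOn_iff']
  intro t ht
  refine ⟨f '' (U ∩ t), invariance_of_domain (hU.inter ht) (hf.mono Set.inter_subset_left)
    (hinj.mono Set.inter_subset_left), ?_⟩
  ext y
  constructor
  · rintro ⟨h1, x, hx, rfl⟩
    refine ⟨⟨x, ⟨hx, ?_⟩, rfl⟩, x, hx, rfl⟩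
    simpa [hleft x hx] using h1
  · rintro ⟨⟨x, ⟨hx, hxt⟩, rfl⟩, -⟩
    exact ⟨by simpa [hleft x hx] using hxt, x, hx, rfl⟩

/-- dimension comparison -/
theorem finrank_le_of_inj {n : ℕ} {O : Set (Euc n)} (hO : IsOpen O) {g : Euc n → Euc n}
    (hg : ContinuousOn g O) (hinj : Set.InjOn g O) (V W : Submodule ℝ (Euc n)) (y : Euc n)
    (hy : y ∈ O) (hyV : y ∈ V) (hmaps : ∀ x ∈ O, x ∈ V → g x ∈ W) :
    Module.finrank ℝ V ≤ Module.finrank ℝ W := by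
  by_contra! hlt
  set m := Module.finrank ℝ V with hm
  let eV : Euc m ≃L[ℝ] V := ContinuousLinearEquiv.ofFinrankEq (by simp [hm])
  obtain ⟨L, hL⟩ : ∃ L : W →ₗ[ℝ] Euc m, Function.Injective L := by
    obtain ⟨L, hL⟩ := Module.Free.exists_linearMap_injective_of_rank_lt (R := ℝ) (M := W) (N := Euc m) (by
      rw [← Module.finrank_eq_rank, ← Module.finrank_eq_rank, finrank_euclideanSpace_fin]
      exact_mod_cast hlt)
    exact ⟨L, hL⟩
  let O' : Set (Euc m) := {z | y + (eV z : Euc n) ∈ O}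
  have hcont : Continuous (fun z : Euc m => y + (eV z : Euc n)) := by fun_prop
  have hO' : IsOpen O' := hO.preimage hcont
  classical
  let π : Euc n → W := fun x => W.orthogonalProjectionOnto x
  have hπ : ∀ x ∈ W, ((π x : W) : Euc n) = x := fun x hx => by
    simpa [π] using Submodule.starProjection_eq_self_iff.2 hx
  let h : Euc m → Euc m := fun z => L (π (g (y + (eV z : Euc n))))
  have hmem : ∀ z ∈ O', g (y + (eV z : Euc n)) ∈ W := fun z hz =>
    hmaps _ hz (V.add_mem hyV (eV z).2)
  have hh : ContinuousOn h O' := by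
    have hLc : Continuous L := L.continuous_of_finiteDimensional
    have hπc : Continuous π := by fun_prop
    exact (hLc.comp hπc).comp_continuousOn (hg.comp hcont.continuousOn (fun z hz => hz))
  have hhinj : Set.InjOn h O' := by
    intro z hz w hw hzw
    have h1 := congrArg (Subtype.val) (hL hzw)
    rw [hπ _ (hmem z hz), hπ _ (hmem w hw)] at h1
    have h2 := add_left_cancel (hinj hz hw h1)
    exact eV.injective (Subtype.ext h2)
  have hopen := invariance_of_domain hO' hh hhinj
  have hsub : h '' O' ⊆ (LinearMap.range L : Set (Euc m)) := by
    rintro _ ⟨z, _, rfl⟩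
    exact ⟨_, rfl⟩
  have h0 : (0 : Euc m) ∈ O' := by simpa [O'] using hy
  have htop : LinearMap.range L = ⊤ := by
    apply Submodule.eq_top_of_nonempty_interior'
    exact ⟨h 0, mem_interior.2 ⟨_, hsub, hopen, ⟨0, h0, rfl⟩⟩⟩
  have := LinearMap.finrank_range_le L
  rw [htop, finrank_top] at this
  simp at this
  omega
end InvDomain2


theorem linFlow_zero (A : Matrix (Fin d) (Fin d) ℝ) (x : Euc d) : linFlow A 0 x = x := by
  simp [linFlow]

theorem linFlow_add (A : Matrix (Fin d) (Fin d) ℝ) (s t : ℝ) (x : Euc d) :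
    linFlow A (s + t) x = linFlow A s (linFlow A t x) := by
  unfold linFlow
  rw [add_smul, Matrix.exp_add_of_commute _ _
    (((Commute.refl A).smul_left s).smul_right t)]
  rw [Matrix.toLpLin_apply, Matrix.toLpLin_apply, Matrix.toLpLin_apply]
  simp [Matrix.mulVec_mulVec]

open scoped Matrix.Norms.Operator in
theorem exp_smul_continuous (A : Matrix (Fin d) (Fin d) ℝ) :
    Continuous fun t : ℝ => NormedSpace.exp (t • A) :=
  NormedSpace.exp_continuous.comp (continuous_id.smul continuous_const)

theorem linFlow_continuous (A : Matrix (Fin d) (Fin d) ℝ) (x : Euc d) :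
    Continuous fun t : ℝ => linFlow A t x := by
  have h := exp_smul_continuous A
  unfold linFlow
  simp only [Matrix.toLpLin_apply]
  refine (PiLp.continuous_toLp 2 _).comp ?_
  exact h.matrix_mulVec continuous_const

/-- The group of periods of a point. -/
def perGroup (A : Matrix (Fin d) (Fin d) ℝ) (x : Euc d) : AddSubgroup ℝ where
  carrier := {t | linFlow A t x = x}
  zero_mem' := linFlow_zero A x
  add_mem' := by
    intro a b ha hb
    simp only [Set.mem_ofPred_eq] at *
    rw [linFlow_add, hb, ha]
  neg_mem' := by
    intro a ha
    simp only [Set.mem_ofPred_eq] at *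
    conv_lhs => rw [← ha]
    rw [← linFlow_add]
    simp [linFlow_zero]

theorem mem_perGroup {A : Matrix (Fin d) (Fin d) ℝ} {x : Euc d} {t : ℝ} :
    t ∈ perGroup A x ↔ linFlow A t x = x := Iff.rfl

theorem period_iff (A : Matrix (Fin d) (Fin d) ℝ) (x : Euc d) (T : ℝ) (hT : 0 < T) :
    linFlow A T x = x ↔ (minPeriod A x = 0 ∨
      ∃ τ : ℝ, 0 < τ ∧ minPeriod A x = (τ : EReal) ∧ ∃ k : ℤ, T = k * τ) := by
  have hcl : IsClosed (perGroup A x : Set ℝ) :=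
    isClosed_eq (linFlow_continuous A x) continuous_const
  rcases AddSubgroup.dense_or_cyclic (perGroup A x) with hd | ⟨a, ha⟩
  · have hall : ∀ t, linFlow A t x = x := fun t => by
      have : t ∈ (perGroup A x : Set ℝ) := by
        rw [← hcl.closure_eq]; exact hd t
      exact this
    refine iff_of_true (hall T) (Or.inl ?_)
    apply le_antisymm
    · refine le_of_forall_gt_imp_ge_of_dense fun c hc => ?_
      obtain ⟨q, hq0, hqc⟩ := EReal.lt_iff_exists_real_btwn.1 hc
      have hq : 0 < q := by exact_mod_cast hq0
      have h1 : minPeriod A x ≤ (q : EReal) := sInf_le ⟨q, hq, hall q, rfl⟩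
      exact h1.trans hqc.le
    · refine le_sInf ?_
      rintro _ ⟨t, ht, -, rfl⟩
      exact_mod_cast ht.le
  · by_cases ha0 : a = 0
    · have hmem : ∀ t, linFlow A t x = x → t = 0 := fun t ht => by
        have : t ∈ perGroup A x := ht
        rw [ha, ha0, AddSubgroup.mem_closure_singleton] at this
        obtain ⟨k, hk⟩ := this
        simpa using hk.symm
      have hm : minPeriod A x = ⊤ := by
        unfold minPeriod
        rw [sInf_eq_top]
        rintro _ ⟨t, ht, h, -⟩
        exact absurd (hmem t h) ht.ne'
      refine iff_of_false (fun h => hT.ne' (hmem T h)) ?_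
      rw [hm]
      rintro (h | ⟨τ, -, h, -⟩)
      · exact absurd h (by simp)
      · exact absurd h (by simp)
    · have hpos : 0 < |a| := abs_pos.2 ha0
      have hmem : ∀ t, linFlow A t x = x ↔ ∃ k : ℤ, t = k * |a| := fun t => by
        rw [← mem_perGroup, ha, AddSubgroup.mem_closure_singleton]
        simp only [zsmul_eq_mul]
        rcases abs_choice a with h | h <;> rw [h]
        · exact ⟨fun ⟨k, hk⟩ => ⟨k, hk.symm⟩, fun ⟨k, hk⟩ => ⟨k, hk.symm⟩⟩
        · exact ⟨fun ⟨k, hk⟩ => ⟨-k, by push_cast; linarith⟩,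
            fun ⟨k, hk⟩ => ⟨-k, by push_cast; linarith⟩⟩
      have hm : minPeriod A x = (|a| : ℝ) := by
        apply le_antisymm
        · exact sInf_le ⟨|a|, hpos, (hmem _).2 ⟨1, by simp⟩, rfl⟩
        · refine le_sInf ?_
          rintro _ ⟨t, ht, h, rfl⟩
          obtain ⟨k, rfl⟩ := (hmem t).1 h
          have hk : 0 < (k : ℝ) := by
            by_contra hk
            push Not at hk
            nlinarith
          have hk1 : (1 : ℤ) ≤ k := by exact_mod_cast hk
          have hk2 : (1 : ℝ) ≤ k := by exact_mod_cast hk1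
          have : |a| ≤ k * |a| := by nlinarith
          exact_mod_cast this
      rw [hmem, hm]
      constructor
      · intro h
        exact Or.inr ⟨|a|, hpos, rfl, h⟩
      · rintro (h | ⟨τ, -, h, hk⟩)
        · have : |a| = 0 := by exact_mod_cast h
          exact absurd this hpos.ne'
        · have : |a| = τ := by exact_mod_cast h
          rwa [this]

theorem period_transfer (A B : Matrix (Fin d) (Fin d) ℝ) (x y : Euc d)
    (h : minPeriod A x = minPeriod B y) (T : ℝ) (hT : 0 < T) :
    linFlow A T x = x ↔ linFlow B T y = y := by
  rw [period_iff A x T hT, period_iff B y T hT, h]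

/-- The subspace of points of (not necessarily minimal) period `T`. -/
def perSpace (A : Matrix (Fin d) (Fin d) ℝ) (T : ℝ) : Submodule ℝ (Euc d) :=
  LinearMap.ker (Matrix.toEuclideanLin (NormedSpace.exp (T • A)) - LinearMap.id)

theorem mem_perSpace {A : Matrix (Fin d) (Fin d) ℝ} {T : ℝ} {x : Euc d} :
    x ∈ perSpace A T ↔ linFlow A T x = x := by
  simp [perSpace, linFlow, sub_eq_zero]


/-- Real kernel dimension equals complex kernel dimension. -/
theorem finrank_ker_complexify (M : Matrix (Fin d) (Fin d) ℝ) :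
    Module.finrank ℂ (LinearMap.ker (Matrix.toLin' (M.map Complex.ofReal))) =
      Module.finrank ℝ (LinearMap.ker (Matrix.toLin' M)) := by
  set K := LinearMap.ker (Matrix.toLin' (M.map Complex.ofReal)) with hK
  set L := LinearMap.ker (Matrix.toLin' M) with hL
  have hmem : ∀ v : Fin d → ℂ, v ∈ K ↔ (fun i => (v i).re) ∈ L ∧ (fun i => (v i).im) ∈ L := by
    intro v
    simp only [hK, hL, LinearMap.mem_ker, Matrix.toLin'_apply, funext_iff, Matrix.mulVec,
      dotProduct, Matrix.map_apply, Pi.zero_apply, ← forall_and]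
    refine forall_congr' fun i => ?_
    rw [Complex.ext_iff]
    simp [Complex.re_sum, Complex.im_sum]
  let e : K ≃ₗ[ℝ] L × L :=
    { toFun := fun v => (⟨fun i => (v.1 i).re, ((hmem v.1).1 v.2).1⟩,
        ⟨fun i => (v.1 i).im, ((hmem v.1).1 v.2).2⟩)
      map_add' := by intro v w; ext i <;> simp
      map_smul' := by intro c v; ext i <;> simp
      invFun := fun p => ⟨fun i => ⟨p.1.1 i, p.2.1 i⟩, (hmem _).2 ⟨p.1.2, p.2.2⟩⟩
      left_inv := by intro v; rfl
      right_inv := by intro p; rfl }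
  have h1 := e.finrank_eq
  rw [Module.finrank_prod, finrank_real_of_complex] at h1
  omega

open scoped Matrix.Norms.Operator in
theorem exp_map_ofReal (A : Matrix (Fin d) (Fin d) ℝ) :
    (NormedSpace.exp A).map Complex.ofReal = NormedSpace.exp (A.map Complex.ofReal) := by
  have := NormedSpace.map_exp (Complex.ofRealHom.mapMatrix : Matrix (Fin d) (Fin d) ℝ →+* _)
    (by exact Continuous.matrix_map continuous_id Complex.continuous_ofReal) A
  exact this

open scoped Matrix.Norms.Operator in
theorem exp_mulVec_nil (N : Matrix (Fin d) (Fin d) ℂ) (w : Fin d → ℂ)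
    (h : N.mulVec (N.mulVec w) = 0) :
    (NormedSpace.exp N).mulVec w = w + N.mulVec w := by
  have hs := NormedSpace.exp_series_hasSum_exp' (𝕂 := ℂ) N
  let L : Matrix (Fin d) (Fin d) ℂ →ₗ[ℂ] (Fin d → ℂ) :=
    { toFun := fun M => M.mulVec w
      map_add' := fun M M' => Matrix.add_mulVec M M' w
      map_smul' := fun c M => Matrix.smul_mulVec c M w }
  have hL : Continuous L := by
    exact Continuous.matrix_mulVec continuous_id continuous_const
  have h2 := hs.map L hL
  have h3 : HasSum (⇑L ∘ fun n : ℕ => ((n.factorial : ℂ)⁻¹) • N ^ n)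
      (∑ n ∈ Finset.range 2, L (((n.factorial : ℂ)⁻¹) • N ^ n)) := by
    apply hasSum_sum_of_ne_finset_zero
    intro n hn
    obtain ⟨k, rfl⟩ : ∃ k, n = k + 2 := ⟨n - 2, by simp at hn; omega⟩
    have : (N ^ (k + 2)).mulVec w = 0 := by
      rw [pow_add, pow_two, ← Matrix.mulVec_mulVec, ← Matrix.mulVec_mulVec, h, Matrix.mulVec_zero]
    simp [L, Matrix.smul_mulVec, this]
  have h4 := h2.unique h3
  simp only [L, Finset.sum_range_succ] at h4
  simp at h4
  exact h4

theorem exp_smul_one (c : ℂ) :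
    NormedSpace.exp (c • (1 : Matrix (Fin d) (Fin d) ℂ)) = Complex.exp c • 1 := by
  rw [Matrix.smul_one_eq_diagonal, Matrix.exp_diagonal, Matrix.smul_one_eq_diagonal]
  congr 1
  ext i
  rw [Pi.coe_exp, Complex.exp_eq_exp_ℂ]

/-- If `N² w = 0`, the exponential of `tA`, `A = μ + N`, acts on `w` in an explicit way. -/
theorem exp_mulVec (A : Matrix (Fin d) (Fin d) ℂ) (μ t : ℂ) (w : Fin d → ℂ)
    (h : (A - μ • 1).mulVec ((A - μ • 1).mulVec w) = 0) :
    (NormedSpace.exp (t • A)).mulVec w =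
      Complex.exp (t * μ) • (w + t • (A - μ • 1).mulVec w) := by
  have hA : t • A = (t * μ) • (1 : Matrix (Fin d) (Fin d) ℂ) + t • (A - μ • 1) := by
    rw [smul_sub, smul_smul]; abel
  rw [hA, Matrix.exp_add_of_commute _ _ ((Commute.one_left _).smul_left _), exp_smul_one,
    ← Matrix.mulVec_mulVec, exp_mulVec_nil, Matrix.smul_mulVec, Matrix.one_mulVec,
    Matrix.smul_mulVec]
  rw [Matrix.smul_mulVec, Matrix.smul_mulVec, Matrix.mulVec_smul, h]
  simp

/-- Complex period space. -/
def cPer (A : Matrix (Fin d) (Fin d) ℂ) (T : ℂ) : Submodule ℂ (Fin d → ℂ) :=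
  LinearMap.ker (Matrix.toLin' (NormedSpace.exp (T • A) - 1))

theorem mem_cPer {A : Matrix (Fin d) (Fin d) ℂ} {T : ℂ} {w : Fin d → ℂ} :
    w ∈ cPer A T ↔ (NormedSpace.exp (T • A)).mulVec w = w := by
  simp [cPer, sub_eq_zero]

theorem cPer_invariant (A : Matrix (Fin d) (Fin d) ℂ) (T : ℂ) (w : Fin d → ℂ)
    (hw : w ∈ cPer A T) : A.mulVec w ∈ cPer A T := by
  rw [mem_cPer] at *
  have hc : Commute (NormedSpace.exp (T • A)) A :=
    Commute.exp_left (((Commute.refl A).smul_left T))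
  rw [Matrix.mulVec_mulVec, hc.eq, ← Matrix.mulVec_mulVec, hw]

theorem cPer_invariant_sub (A : Matrix (Fin d) (Fin d) ℂ) (T μ : ℂ) (w : Fin d → ℂ)
    (hw : w ∈ cPer A T) : (A - μ • 1).mulVec w ∈ cPer A T := by
  rw [Matrix.sub_mulVec, Matrix.smul_mulVec, Matrix.one_mulVec]
  exact Submodule.sub_mem _ (cPer_invariant A T w hw) (Submodule.smul_mem _ _ hw)

theorem cPer_step (A : Matrix (Fin d) (Fin d) ℂ) (T μ : ℂ) (hT : T ≠ 0) (w : Fin d → ℂ)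
    (hw : w ∈ cPer A T) (h : (A - μ • 1).mulVec ((A - μ • 1).mulVec w) = 0) :
    (A - μ • 1).mulVec w = 0 := by
  by_contra hne
  have h1 := mem_cPer.1 hw
  rw [exp_mulVec A μ T w h] at h1
  have h2 := mem_cPer.1 (cPer_invariant_sub A T μ w hw)
  rw [exp_mulVec A μ T _ (by rw [h, Matrix.mulVec_zero]), h, smul_zero, add_zero] at h2
  have h3 : Complex.exp (T * μ) = 1 := by
    by_contra hne1
    have : (Complex.exp (T * μ) - 1) • (A - μ • 1).mulVec w = 0 := by
      rw [sub_smul, one_smul, h2, sub_self]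
    rcases smul_eq_zero.1 this with h | h
    · exact hne1 (sub_eq_zero.1 h)
    · exact hne h
  rw [h3, one_smul, add_eq_left] at h1
  rcases smul_eq_zero.1 h1 with h | h
  · exact hT h
  · exact hne h

theorem cPer_gen (A : Matrix (Fin d) (Fin d) ℂ) (T μ : ℂ) (hT : T ≠ 0) (k : ℕ) :
    ∀ w : Fin d → ℂ, w ∈ cPer A T → ((A - μ • 1) ^ (k + 1)).mulVec w = 0 →
    (A - μ • 1).mulVec w = 0 := by
  induction k with
  | zero => intro w _ h; simpa using h
  | succ k ih =>
    intro w hw h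
    apply cPer_step A T μ hT w hw
    apply ih _ (cPer_invariant_sub A T μ w hw)
    rw [Matrix.mulVec_mulVec, ← pow_succ, h]

theorem toLin_sub_pow (A : Matrix (Fin d) (Fin d) ℂ) (μ : ℂ) (k : ℕ) (w : Fin d → ℂ) :
    ((Matrix.toLin' A - algebraMap ℂ (Module.End ℂ (Fin d → ℂ)) μ) ^ k) w =
      ((A - μ • 1) ^ k).mulVec w := by
  have : Matrix.toLin' A - algebraMap ℂ (Module.End ℂ (Fin d → ℂ)) μ =
      Matrix.toLin' (A - μ • 1) := by
    ext v i
    simp [Algebra.algebraMap_eq_smul_one]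
  rw [this, ← Matrix.toLin'_pow, Matrix.toLin'_apply]

theorem mem_eig {A : Matrix (Fin d) (Fin d) ℂ} {μ : ℂ} {w : Fin d → ℂ} :
    w ∈ Module.End.eigenspace (Matrix.toLin' A) μ ↔ (A - μ • 1).mulVec w = 0 := by
  rw [Module.End.mem_eigenspace_iff, Matrix.toLin'_apply, Matrix.sub_mulVec, Matrix.smul_mulVec,
    Matrix.one_mulVec, sub_eq_zero]

theorem eig_le_cPer (A : Matrix (Fin d) (Fin d) ℂ) (T μ : ℂ) (h : Complex.exp (T * μ) = 1) :
    Module.End.eigenspace (Matrix.toLin' A) μ ≤ cPer A T := by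
  intro w hw
  rw [mem_eig] at hw
  rw [mem_cPer, exp_mulVec A μ T w (by rw [hw, Matrix.mulVec_zero]), hw, h]
  simp

theorem cPer_inf_le (A : Matrix (Fin d) (Fin d) ℂ) (T μ : ℂ) (hT : T ≠ 0) :
    cPer A T ⊓ Module.End.maxGenEigenspace (Matrix.toLin' A) μ ≤
      ⨆ (_ : Complex.exp (T * μ) = 1), Module.End.eigenspace (Matrix.toLin' A) μ := by
  rintro w ⟨hw, hw2⟩
  rw [SetLike.mem_coe, Module.End.mem_maxGenEigenspace] at hw2
  obtain ⟨k, hk⟩ := hw2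
  have hk' : ((A - μ • 1) ^ k).mulVec w = 0 := by
    rw [← toLin_sub_pow]
    exact hk
  have h1 : (A - μ • 1).mulVec w = 0 := by
    apply cPer_gen A T μ hT k w hw
    rw [pow_succ', ← Matrix.mulVec_mulVec, hk', Matrix.mulVec_zero]
  by_cases hw0 : w = 0
  · rw [hw0]; exact Submodule.zero_mem _
  have h3 : Complex.exp (T * μ) = 1 := by
    have h2 := mem_cPer.1 hw
    rw [exp_mulVec A μ T _ (by rw [h1, Matrix.mulVec_zero]), h1, smul_zero, add_zero] at h2
    by_contra hne1
    have : (Complex.exp (T * μ) - 1) • w = 0 := by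
      rw [sub_smul, one_smul, h2, sub_self]
    rcases smul_eq_zero.1 this with h | h
    · exact hne1 (sub_eq_zero.1 h)
    · exact hw0 h
  rw [iSup_pos h3]
  exact mem_eig.2 h1

theorem cPer_eq (A : Matrix (Fin d) (Fin d) ℂ) (T : ℂ) (hT : T ≠ 0) :
    cPer A T = ⨆ μ, ⨆ (_ : Complex.exp (T * μ) = 1), Module.End.eigenspace (Matrix.toLin' A) μ := by
  apply le_antisymm
  · have h := Submodule.inf_iSup_genEigenspace (f := Matrix.toLin' A) (p := cPer A T)
      (fun x hx => by rw [Matrix.toLin'_apply]; exact cPer_invariant A T x hx) ⊤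
    have h2 := Module.End.iSup_maxGenEigenspace_eq_top (Matrix.toLin' A)
    unfold Module.End.maxGenEigenspace at h2
    rw [h2, inf_top_eq] at h
    rw [h]
    exact iSup_mono fun μ => cPer_inf_le A T μ hT
  · exact iSup_le fun μ => iSup_le fun h => eig_le_cPer A T μ h

theorem finrank_sup_indep {ι V : Type*} [AddCommGroup V] [Module ℂ V] [FiniteDimensional ℂ V]
    (p : ι → Submodule ℂ V) (hp : iSupIndep p) (s : Finset ι) :
    Module.finrank ℂ (⨆ i ∈ s, p i : Submodule ℂ V) = ∑ i ∈ s, Module.finrank ℂ (p i) := by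
  classical
  induction s using Finset.induction_on with
  | empty => simp
  | insert a s ha ih =>
    rw [Finset.iSup_insert, Finset.sum_insert ha, ← ih]
    have hd : Disjoint (p a) (⨆ i ∈ s, p i) := by
      refine (hp a).mono_right ?_
      refine iSup₂_le fun i hi => ?_
      exact le_iSup₂_of_le i (fun h => ha (h ▸ hi)) le_rfl
    have := Submodule.finrank_sup_add_finrank_inf_eq (p a) (⨆ i ∈ s, p i)
    rw [hd.eq_bot, finrank_bot, add_zero] at this
    exact this

/-- Dimension of the complex period space as a sum over a finite set containing the spectrum. -/
theorem finrank_cPer (A : Matrix (Fin d) (Fin d) ℂ) (T : ℂ) (hT : T ≠ 0) (S : Finset ℂ)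
    (hS : ∀ μ, μ ∉ S → Module.End.eigenspace (Matrix.toLin' A) μ = ⊥) :
    Module.finrank ℂ (cPer A T) = ∑ μ ∈ S with Complex.exp (T * μ) = 1,
      Module.finrank ℂ (Module.End.eigenspace (Matrix.toLin' A) μ) := by
  rw [← finrank_sup_indep _ (Module.End.eigenspaces_iSupIndep (Matrix.toLin' A)), cPer_eq A T hT]
  have heq : (⨆ μ, ⨆ (_ : Complex.exp (T * μ) = 1), Module.End.eigenspace (Matrix.toLin' A) μ) =
      ⨆ i ∈ S.filter fun μ => Complex.exp (T * μ) = 1,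
        Module.End.eigenspace (Matrix.toLin' A) i := ?_
  · rw [heq]
  apply le_antisymm
  · refine iSup₂_le fun μ hμ => ?_
    by_cases h : μ ∈ S
    · exact le_iSup₂_of_le μ (Finset.mem_filter.2 ⟨h, hμ⟩) le_rfl
    · rw [hS μ h]; exact bot_le
  · refine iSup₂_le fun μ hμ => ?_
    exact le_iSup₂_of_le μ (Finset.mem_filter.1 hμ).2 le_rfl

open scoped Matrix ComplexOrder in
theorem finrank_eig_conj (A : Matrix (Fin d) (Fin d) ℝ) (μ : ℂ) :
    Module.finrank ℂ (Module.End.eigenspace (Matrix.toLin' (A.map Complex.ofReal)) (star μ)) =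
    Module.finrank ℂ (Module.End.eigenspace (Matrix.toLin' (A.map Complex.ofReal)) μ) := by
  have key : ∀ ν : ℂ, Module.finrank ℂ (Module.End.eigenspace (Matrix.toLin' (A.map Complex.ofReal)) ν) =
      d - (A.map Complex.ofReal - ν • 1).rank := by
    intro ν
    have h1 : Module.End.eigenspace (Matrix.toLin' (A.map Complex.ofReal)) ν =
        LinearMap.ker (A.map Complex.ofReal - ν • 1).mulVecLin := by
      ext w
      rw [mem_eig]; rfl
    have h2 := LinearMap.finrank_range_add_finrank_ker (A.map Complex.ofReal - ν • 1).mulVecLin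
    rw [h1]
    unfold Matrix.rank
    simp only [Module.finrank_fin_fun] at h2
    omega
  rw [key, key]
  have : (A.map Complex.ofReal - (star μ) • 1 : Matrix (Fin d) (Fin d) ℂ) =
      ((A.map Complex.ofReal - μ • 1)ᵀ)ᴴ := by
    ext i j
    by_cases hij : i = j <;> simp [Matrix.one_apply, hij, Ne.symm]
  rw [this, Matrix.rank_conjTranspose, Matrix.rank_transpose]

theorem mem_spectrum_iff (A : Matrix (Fin d) (Fin d) ℂ) (μ : ℂ) :
    μ ∈ spectrum ℂ A ↔ Module.finrank ℂ (Module.End.eigenspace (Matrix.toLin' A) μ) ≠ 0 := by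
  rw [← Matrix.spectrum_toLin', ← Module.End.hasEigenvalue_iff_mem_spectrum,
    Module.End.hasEigenvalue_iff, Ne, Ne, Submodule.finrank_eq_zero]

theorem exp_period {R : ℝ} (hR : 0 < R) {μ : ℂ}
    (h : Complex.exp (((2 * Real.pi / R : ℝ) : ℂ) * μ) = 1) :
    ∃ k : ℤ, μ = (k * R : ℝ) * Complex.I := by
  rw [Complex.exp_eq_one_iff] at h
  obtain ⟨k, hk⟩ := h
  refine ⟨k, ?_⟩
  have hpi : (Real.pi : ℂ) ≠ 0 := by exact_mod_cast Real.pi_ne_zero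
  have hR' : (R : ℂ) ≠ 0 := by exact_mod_cast hR.ne'
  push_cast at hk ⊢
  field_simp at hk
  linear_combination hk

theorem exp_period_self {z : ℂ} (hz : z.re = 0) (hz0 : z ≠ 0) :
    Complex.exp (((2 * Real.pi / ‖z‖ : ℝ) : ℂ) * z) = 1 := by
  have him : z.im ≠ 0 := fun h => hz0 (Complex.ext hz h)
  have hn : ‖z‖ = |z.im| := by
    rw [← Complex.re_add_im z, hz]; simp
  have hzz : z = z.im * Complex.I := by
    apply Complex.ext <;> simp [hz]
  have him' : (z.im : ℂ) ≠ 0 := by exact_mod_cast him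
  rw [Complex.exp_eq_one_iff, hn]
  rcases abs_choice z.im with h | h
  · refine ⟨1, ?_⟩
    rw [h]
    conv_lhs => rw [hzz]
    simp
    field_simp
  · refine ⟨-1, ?_⟩
    rw [h]
    conv_lhs => rw [hzz]
    simp
    field_simp

/-- Combinatorial core. -/
theorem comb (S : Finset ℂ) (G : ℂ → ℤ) (hG : ∀ μ, μ ∉ S → G μ = 0)
    (hev : ∀ μ, G (star μ) = G μ)
    (hsum : ∀ T : ℝ, 0 < T → ∑ μ ∈ S with Complex.exp (T * μ) = 1, G μ = 0)
    (z : ℂ) (hz : z.re = 0) : G z = 0 := by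
  classical
  have h0 : G 0 = 0 := by
    by_contra hne
    have h0S : (0 : ℂ) ∈ S := by
      by_contra h; exact hne (hG 0 h)
    set R : ℝ := 1 + ∑ μ ∈ S, ‖μ‖ with hRdef
    have hle : ∀ μ ∈ S, ‖μ‖ < R := fun μ hμ => by
      have := Finset.single_le_sum (f := fun μ : ℂ => ‖μ‖) (fun i _ => norm_nonneg i) hμ
      linarith
    have hR : 0 < R := (norm_nonneg _).trans_lt (hle 0 h0S)
    have h := hsum (2 * Real.pi / R) (by positivity)
    rw [Finset.sum_eq_single_of_mem 0 (by simp [h0S])] at h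
    · exact hne h
    · intro μ hμ hμ0
      exfalso
      rw [Finset.mem_filter] at hμ
      obtain ⟨k, hk⟩ := exp_period hR hμ.2
      have h1 := hle μ hμ.1
      rw [hk, norm_mul, Complex.norm_I, mul_one, Complex.norm_real, Real.norm_eq_abs, abs_mul,
        abs_of_pos hR] at h1
      have h2 : |(k : ℝ)| < 1 := by
        by_contra hge
        push Not at hge
        nlinarith
      have h3 : |k| < 1 := by exact_mod_cast h2
      have h4 : k = 0 := Int.abs_lt_one_iff.1 h3
      rw [h4] at hk
      exact hμ0 (by simpa using hk)
  by_contra hne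
  have hex : (S.filter fun μ => μ.re = 0 ∧ G μ ≠ 0).Nonempty :=
    ⟨z, Finset.mem_filter.2 ⟨by by_contra h; exact hne (hG z h), hz, hne⟩⟩
  obtain ⟨w, hw, hmax⟩ := Finset.exists_max_image _ (fun μ : ℂ => ‖μ‖) hex
  rw [Finset.mem_filter] at hw
  obtain ⟨hwS, hwre, hwG⟩ := hw
  have hw0 : w ≠ 0 := fun h => hwG (h ▸ h0)
  have hwn : 0 < ‖w‖ := norm_pos_iff.2 hw0
  have hwim : w.im ≠ 0 := fun h => hw0 (Complex.ext hwre h)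
  have hsre : (star w).re = 0 := by simpa using hwre
  have hsS : star w ∈ S := by
    by_contra h; exact hwG ((hev w) ▸ hG _ h)
  have hne' : w ≠ star w := by
    intro h
    have := congrArg Complex.im h
    simp at this
    apply hwim; linarith
  have h := hsum (2 * Real.pi / ‖w‖) (by positivity)
  have hsub : ({w, star w} : Finset ℂ) ⊆
      S.filter fun μ => Complex.exp (((2 * Real.pi / ‖w‖ : ℝ) : ℂ) * μ) = 1 := by
    intro μ hμ
    rw [Finset.mem_insert, Finset.mem_singleton] at hμ
    rw [Finset.mem_filter]
    rcases hμ with rfl | rfl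
    · exact ⟨hwS, exp_period_self hwre hw0⟩
    · refine ⟨hsS, ?_⟩
      have := exp_period_self hsre (star_ne_zero.2 hw0)
      rwa [norm_star] at this
  rw [← Finset.sum_subset hsub, Finset.sum_pair hne', hev] at h
  · omega
  · intro μ hμ hμ2
    rw [Finset.mem_filter] at hμ
    obtain ⟨k, hk⟩ := exp_period hwn hμ.2
    by_contra hGμ
    have hre : μ.re = 0 := by rw [hk]; simp
    have h1 := hmax μ (Finset.mem_filter.2 ⟨hμ.1, hre, hGμ⟩)
    rw [hk, norm_mul, Complex.norm_I, mul_one, Complex.norm_real, Real.norm_eq_abs, abs_mul,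
      abs_of_pos hwn] at h1
    have h2 : |(k : ℝ)| ≤ 1 := by
      by_contra hge
      push Not at hge
      nlinarith
    have h3 : |k| ≤ 1 := by exact_mod_cast h2
    have hn : ‖w‖ = |w.im| := by
      rw [← Complex.re_add_im w, hwre]; simp
    have hsw : star w = (-w.im : ℝ) * Complex.I := by
      apply Complex.ext <;> simp [hwre]
    have hww : w = (w.im : ℝ) * Complex.I := by
      apply Complex.ext <;> simp [hwre]
    apply hμ2
    rw [Finset.mem_insert, Finset.mem_singleton]
    rw [abs_le] at h3
    obtain ⟨h3a, h3b⟩ := h3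
    have hkk : k = -1 ∨ k = 0 ∨ k = 1 := by omega
    rw [hn] at hk
    rcases hkk with rfl | rfl | rfl
    · rcases abs_choice w.im with h | h
      · right; rw [hk, hsw, h]; simp
      · left; rw [hk, h]; conv_rhs => rw [hww]
        simp
    · exact absurd (by rw [hk]; simpa using h0) hGμ
    · rcases abs_choice w.im with h | h
      · left; rw [hk, h]; conv_rhs => rw [hww]
        simp
      · right; rw [hk, hsw, h]; simp


theorem finrank_perSpace (A : Matrix (Fin d) (Fin d) ℝ) (T : ℝ) :
    Module.finrank ℝ (perSpace A T) = Module.finrank ℂ (cPer (A.map Complex.ofReal) T) := by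
  have h1 : (NormedSpace.exp (T • A) - 1).map Complex.ofReal =
      NormedSpace.exp ((T : ℂ) • A.map Complex.ofReal) - 1 := by
    have h2 : (T : ℂ) • A.map Complex.ofReal = (T • A).map Complex.ofReal := by
      ext i j; simp
    rw [h2, ← exp_map_ofReal]
    ext i j
    by_cases hij : i = j <;> simp [Matrix.one_apply, hij]
  unfold cPer
  rw [← h1, finrank_ker_complexify]
  rw [← LinearEquiv.finrank_map_eq (WithLp.linearEquiv 2 ℝ (Fin d → ℝ)) (perSpace A T)]
  have heq : (perSpace A T).map (WithLp.linearEquiv 2 ℝ (Fin d → ℝ)).toLinearMap =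
      LinearMap.ker (Matrix.toLin' (NormedSpace.exp (T • A) - 1)) := by
    ext v
    rw [Submodule.mem_map]
    constructor
    · rintro ⟨x, hx, rfl⟩
      rw [mem_perSpace, linFlow, Matrix.toLpLin_apply] at hx
      have := congrArg WithLp.ofLp hx
      simp only at this
      rw [LinearMap.mem_ker, Matrix.toLin'_apply, Matrix.sub_mulVec, Matrix.one_mulVec, sub_eq_zero]
      exact this
    · intro hv
      rw [LinearMap.mem_ker, Matrix.toLin'_apply, Matrix.sub_mulVec, Matrix.one_mulVec,
        sub_eq_zero] at hv
      refine ⟨WithLp.toLp 2 v, ?_, rfl⟩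
      rw [mem_perSpace, linFlow, Matrix.toLpLin_apply]
      exact congrArg (WithLp.toLp 2) hv
  rw [← heq]

theorem zero_mem_perSpace_image (A : Matrix (Fin d) (Fin d) ℝ) (T : ℝ) :
    linFlow A T 0 = 0 := by
  simp [linFlow]

theorem finrank_perSpace_eq (A B : Matrix (Fin d) (Fin d) ℝ)
    (U : Set (Euc d)) (hU : IsOpen U) (h0 : (0 : Euc d) ∈ U)
    (f : Euc d → Euc d) (hf : ContinuousOn f U) (hinj : Set.InjOn f U)
    (hper : ∀ x ∈ U, minPeriod A x = minPeriod B (f x)) (T : ℝ) (hT : 0 < T) :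
    Module.finrank ℝ (perSpace A T) = Module.finrank ℝ (perSpace B T) := by
  have htr : ∀ x ∈ U, (x ∈ perSpace A T ↔ f x ∈ perSpace B T) := fun x hx => by
    rw [mem_perSpace, mem_perSpace]
    exact period_transfer A B x (f x) (hper x hx) T hT
  apply le_antisymm
  · exact finrank_le_of_inj hU hf hinj _ _ 0 h0 (Submodule.zero_mem _)
      (fun x hx hxV => (htr x hx).1 hxV)
  · refine finrank_le_of_inj (invariance_of_domain hU hf hinj) (inverse_continuousOn hU hf hinj)
      ?_ _ _ (f 0) ⟨0, h0, rfl⟩ ((htr 0 h0).1 (Submodule.zero_mem _)) ?_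
    · rintro _ ⟨x, hx, rfl⟩ _ ⟨y, hy, rfl⟩ hxy
      rw [hinj.leftInvOn_invFunOn hx, hinj.leftInvOn_invFunOn hy] at hxy
      rw [hxy]
    · rintro _ ⟨x, hx, rfl⟩ hxV
      rw [hinj.leftInvOn_invFunOn hx]
      exact (htr x hx).2 hxV

/-- **Theorem 5.2**: if a continuous injection defined near `0` preserves minimal periods
between two linear flows, then their generators have the same purely imaginary
complex eigenvalues. -/
theorem minimal_periods_imaginary_spectrum {d : ℕ} (A B : Matrix (Fin d) (Fin d) ℝ)
    (U : Set (Euc d)) (hU : IsOpen U) (h0 : (0 : Euc d) ∈ U)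
    (f : Euc d → Euc d) (hf : ContinuousOn f U) (hinj : Set.InjOn f U)
    (hper : ∀ x ∈ U, minPeriod A x = minPeriod B (f x)) :
    {z ∈ cSpec A | z.re = 0} = {z ∈ cSpec B | z.re = 0} := by
  classical
  have hfinA : (spectrum ℂ (A.map Complex.ofReal)).Finite := Matrix.finite_spectrum _
  have hfinB : (spectrum ℂ (B.map Complex.ofReal)).Finite := Matrix.finite_spectrum _
  set S : Finset ℂ := hfinA.toFinset ∪ hfinB.toFinset with hS
  set gA : ℂ → ℕ := fun μ =>
    Module.finrank ℂ (Module.End.eigenspace (Matrix.toLin' (A.map Complex.ofReal)) μ) with hgA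
  set gB : ℂ → ℕ := fun μ =>
    Module.finrank ℂ (Module.End.eigenspace (Matrix.toLin' (B.map Complex.ofReal)) μ) with hgB
  have hSA : ∀ μ, μ ∉ S → gA μ = 0 := fun μ hμ => by
    by_contra h
    exact hμ (Finset.mem_union_left _ (hfinA.mem_toFinset.2 ((mem_spectrum_iff _ _).2 h)))
  have hSB : ∀ μ, μ ∉ S → gB μ = 0 := fun μ hμ => by
    by_contra h
    exact hμ (Finset.mem_union_right _ (hfinB.mem_toFinset.2 ((mem_spectrum_iff _ _).2 h)))
  have key : ∀ z : ℂ, z.re = 0 → gA z = gB z := by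
    intro z hz
    have := comb S (fun μ => (gA μ : ℤ) - gB μ) (fun μ hμ => by simp [hSA μ hμ, hSB μ hμ])
      (fun μ => by
        have h1 : gA (star μ) = gA μ := finrank_eig_conj A μ
        have h2 : gB (star μ) = gB μ := finrank_eig_conj B μ
        simp only [h1, h2]) ?_ z hz
    · have h' : (gA z : ℤ) - gB z = 0 := this
      omega
    · intro T hT
      have hT' : (T : ℂ) ≠ 0 := by exact_mod_cast hT.ne'
      have h1 := finrank_perSpace_eq A B U hU h0 f hf hinj hper T hT
      rw [finrank_perSpace, finrank_perSpace,
        finrank_cPer _ _ hT' S (fun μ hμ => Submodule.finrank_eq_zero.1 (hSA μ hμ)),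
        finrank_cPer _ _ hT' S (fun μ hμ => Submodule.finrank_eq_zero.1 (hSB μ hμ))] at h1
      rw [Finset.sum_sub_distrib, sub_eq_zero]
      exact_mod_cast h1
  ext z
  have hAB : z.re = 0 → (z ∈ cSpec A ↔ z ∈ cSpec B) := fun hz => by
    unfold cSpec
    rw [mem_spectrum_iff, mem_spectrum_iff]
    have := key z hz
    simp only [hgA, hgB] at this
    rw [this]
  constructor
  · rintro ⟨h1, h2⟩
    exact ⟨(hAB h2).1 h1, h2⟩
  · rintro ⟨h1, h2⟩
    exact ⟨(hAB h2).2 h1, h2⟩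

end LF
end
end

section
/- Let Φ and Ψ be linear flows on X = ℝ^d and 0 < β < 1. Assume that A^{Φ_C} and α A^{Ψ_C} are similar for some α > 0 (so in particular d_H := d_H^Φ = d_H^Ψ), and that β ≤ min{ α λ_j^{Ψ_H} / λ_j^{Φ_H}, λ_j^{Φ_H} / (α λ_j^{Ψ_H}) } for every j ∈ {1,…,d_H}. Then Φ ≃^{β⁻} Ψ, i.e. there exist h ∈ 𝓗_{β⁻}(X) and α' ∈ ℝ∖{0} with h(Φ_t x) = Ψ_{α' t} h(x) for all t ∈ ℝ and x ∈ X. -/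
noncomputable section
namespace LF

open Filter Topology

variable {d : ℕ}

open Filter Topology

section HBsec
variable {E F G : Type*} [NormedAddCommGroup E] [NormedAddCommGroup F] [NormedAddCommGroup G]

/-- `f` is `γ`-Hölder on every ball. -/
def HB (γ : ℝ) (f : E → F) : Prop :=
  ∀ R : ℝ, ∃ K : ℝ, 0 ≤ K ∧ ∀ x y : E, ‖x‖ ≤ R → ‖y‖ ≤ R → ‖f x - f y‖ ≤ K * ‖x - y‖ ^ γ

lemma HB.continuous {γ : ℝ} (hγ : 0 < γ) {f : E → F} (hf : HB γ f) : Continuous f := by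
  rw [continuous_iff_continuousAt]
  intro x
  obtain ⟨K, hK, h⟩ := hf (‖x‖ + 1)
  rw [ContinuousAt, tendsto_iff_norm_sub_tendsto_zero]
  have h1 : Tendsto (fun y : E => K * ‖y - x‖ ^ γ) (𝓝 x) (𝓝 0) := by
    have : Continuous (fun y : E => K * ‖y - x‖ ^ γ) := by
      refine continuous_const.mul ?_
      exact Continuous.rpow_const (by fun_prop) (fun _ => Or.inr hγ.le)
    have h2 := this.tendsto x
    simpa [Real.zero_rpow hγ.ne'] using h2
  refine squeeze_zero' (Eventually.of_forall fun _ => norm_nonneg _) ?_ h1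
  filter_upwards [Metric.ball_mem_nhds x one_pos] with y hy
  refine h y x ?_ (by linarith)
  rw [Metric.mem_ball, dist_eq_norm] at hy
  have := norm_add_le (y - x) x
  simp only [sub_add_cancel] at this
  linarith

lemma HB.mono {γ γ' : ℝ} (h0 : 0 ≤ γ') (h : γ' ≤ γ) {f : E → F} (hf : HB γ f) : HB γ' f := by
  intro R
  obtain ⟨K, hK, hh⟩ := hf R
  refine ⟨K * (2 * |R|) ^ (γ - γ'), by positivity, fun x y hx hy => (hh x y hx hy).trans ?_⟩
  have hd : ‖x - y‖ ≤ 2 * |R| := by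
    have := norm_sub_le x y
    have := le_abs_self R
    linarith
  have : ‖x - y‖ ^ γ = ‖x - y‖ ^ (γ - γ') * ‖x - y‖ ^ γ' := by
    rw [← Real.rpow_add_of_nonneg (norm_nonneg _) (by linarith) h0]; congr 1; ring
  rw [this, mul_assoc]
  gcongr

lemma HB.bound {γ : ℝ} (h0 : 0 ≤ γ) {f : E → F} (hf : HB γ f) (R : ℝ) :
    ∃ R', ∀ x, ‖x‖ ≤ R → ‖f x‖ ≤ R' := by
  obtain ⟨K, hK, hh⟩ := hf |R|
  refine ⟨‖f 0‖ + K * |R| ^ γ, fun x hx => ?_⟩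
  have hx' : ‖x‖ ≤ |R| := hx.trans (le_abs_self R)
  have h1 := hh x 0 hx' (by simp)
  have h2 : ‖f x‖ ≤ ‖f x - f 0‖ + ‖f 0‖ := by
    have := norm_add_le (f x - f 0) (f 0)
    simpa using this
  have h3 : K * ‖x - 0‖ ^ γ ≤ K * |R| ^ γ := by
    rw [sub_zero]; gcongr
  linarith

lemma HB.comp {γ γ' : ℝ} (h0 : 0 ≤ γ) (h0' : 0 ≤ γ') {f : E → F} {g : F → G}
    (hg : HB γ' g) (hf : HB γ f) : HB (γ * γ') (fun x => g (f x)) := by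
  intro R
  obtain ⟨R', hR'⟩ := hf.bound h0 R
  obtain ⟨K, hK, hh⟩ := hf R
  obtain ⟨K', hK', hh'⟩ := hg R'
  refine ⟨K' * K ^ γ', by positivity, fun x y hx hy => ?_⟩
  calc ‖g (f x) - g (f y)‖ ≤ K' * ‖f x - f y‖ ^ γ' := hh' _ _ (hR' x hx) (hR' y hy)
    _ ≤ K' * (K * ‖x - y‖ ^ γ) ^ γ' := by
        gcongr; exact hh x y hx hy
    _ = _ := by
        rw [Real.mul_rpow hK (by positivity), ← Real.rpow_mul (norm_nonneg _)]; ring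

lemma HB.of_lip {f : E → F} (C : ℝ) (hC : 0 ≤ C) (h : ∀ x y, ‖f x - f y‖ ≤ C * ‖x - y‖) :
    HB 1 f := fun R => ⟨C, hC, fun x y _ _ => by simpa using h x y⟩

lemma HB.add {γ : ℝ} {f g : E → F} (hf : HB γ f) (hg : HB γ g) : HB γ (fun x => f x + g x) := by
  intro R
  obtain ⟨K, hK, hh⟩ := hf R
  obtain ⟨K', hK', hh'⟩ := hg R
  refine ⟨K + K', by positivity, fun x y hx hy => ?_⟩
  have : f x + g x - (f y + g y) = (f x - f y) + (g x - g y) := by abel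
  rw [this, add_mul]
  exact (norm_add_le _ _).trans (add_le_add (hh x y hx hy) (hh' x y hx hy))

lemma HB.zero {γ : ℝ} : HB γ (fun _ : E => (0 : F)) := fun R =>
  ⟨0, le_rfl, fun x y _ _ => by simp⟩

lemma HB.sum {γ : ℝ} {ι : Type*} (s : Finset ι) {f : ι → E → F} (hf : ∀ i ∈ s, HB γ (f i)) :
    HB γ (fun x => ∑ i ∈ s, f i x) := by
  classical
  induction s using Finset.induction_on with
  | empty => simpa using HB.zero
  | insert a s ha ih =>
    simp only [Finset.sum_insert ha]
    exact (hf a (by simp)).add (ih fun i hi => hf i (by simp [hi]))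

lemma HB.pi {γ : ℝ} {ι : Type*} [Fintype ι] {f : E → ι → ℝ} (hf : ∀ i, HB γ (fun x => f x i)) :
    HB γ f := by
  intro R
  choose K hK hh using fun i => hf i R
  refine ⟨∑ i, K i, Finset.sum_nonneg fun i _ => hK i, fun x y hx hy => ?_⟩
  rw [pi_norm_le_iff_of_nonneg (mul_nonneg (Finset.sum_nonneg fun i _ => hK i) (by positivity))]
  intro i
  refine (hh i x y hx hy).trans ?_
  gcongr
  exact Finset.single_le_sum (fun i _ => hK i) (Finset.mem_univ i)

lemma HB.prodMk {γ : ℝ} {f : E → F} {g : E → G} (hf : HB γ f) (hg : HB γ g) :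
    HB γ (fun x => (f x, g x)) := by
  intro R
  obtain ⟨K, hK, hh⟩ := hf R
  obtain ⟨K', hK', hh'⟩ := hg R
  refine ⟨K + K', by positivity, fun x y hx hy => ?_⟩
  rw [Prod.mk_sub_mk, Prod.norm_mk]
  have h1 := hh x y hx hy
  have h2 := hh' x y hx hy
  have h3 : 0 ≤ ‖x - y‖ ^ γ := by positivity
  refine max_le (h1.trans ?_) (h2.trans ?_) <;> gcongr <;> linarith

lemma HB.of_clm [NormedSpace ℝ E] [NormedSpace ℝ F] (f : E →L[ℝ] F) : HB 1 (fun x => f x) :=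
  HB.of_lip ‖f‖ (norm_nonneg _) fun x y => by rw [← map_sub]; exact f.le_opNorm _

lemma HB.of_clm' [NormedSpace ℝ E] [NormedSpace ℝ F] (f : E →L[ℝ] F) {γ : ℝ} (h0 : 0 ≤ γ)
    (h1 : γ ≤ 1) : HB γ (fun x => f x) := (HB.of_clm f).mono h0 h1

lemma HB.clm_comp [NormedSpace ℝ F] [NormedSpace ℝ G] (f : F →L[ℝ] G) {γ : ℝ} (h0 : 0 ≤ γ)
    {g : E → F} (hg : HB γ g) : HB γ (fun x => f (g x)) := by
  have := HB.comp h0 zero_le_one (HB.of_clm f) hg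
  simpa using this

lemma HB.comp_clm [NormedSpace ℝ E] [NormedSpace ℝ F] (f : E →L[ℝ] F) {γ : ℝ} (h0 : 0 ≤ γ)
    {g : F → G} (hg : HB γ g) : HB γ (fun x => g (f x)) := by
  have := HB.comp zero_le_one h0 hg (HB.of_clm f)
  simpa using this

end HBsec

/-! ### power maps -/

/-- signed power -/
def spow (θ : ℝ) (y : ℝ) : ℝ := SignType.sign y * |y| ^ θ

lemma spow_zero {θ : ℝ} : spow θ 0 = 0 := by simp [spow]

lemma spow_neg {θ : ℝ} (y : ℝ) : spow θ (-y) = - spow θ y := by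
  simp [spow, Left.sign_neg]

lemma spow_of_pos {θ y : ℝ} (hy : 0 < y) : spow θ y = y ^ θ := by
  simp [spow, sign_pos hy, abs_of_pos hy]

lemma spow_of_nonneg {θ y : ℝ} (hθ : 0 < θ) (hy : 0 ≤ y) : spow θ y = y ^ θ := by
  rcases hy.eq_or_lt with rfl | hy
  · simp [spow_zero, Real.zero_rpow hθ.ne']
  · exact spow_of_pos hy

lemma spow_spow {θ : ℝ} (hθ : 0 < θ) (y : ℝ) : spow θ⁻¹ (spow θ y) = y := by
  have key : ∀ y : ℝ, 0 < y → spow θ⁻¹ (spow θ y) = y := fun y hy => by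
    rw [spow_of_pos hy, spow_of_pos (by positivity), ← Real.rpow_mul hy.le,
      mul_inv_cancel₀ hθ.ne', Real.rpow_one]
  rcases lt_trichotomy y 0 with h | h | h
  · have := key (-y) (by linarith)
    rw [spow_neg, spow_neg] at this
    linarith
  · subst h; simp [spow_zero]
  · exact key y h

lemma spow_mul_of_pos {θ c : ℝ} (hc : 0 < c) (y : ℝ) : spow θ (c * y) = c ^ θ * spow θ y := by
  have h : SignType.sign (c * y) = SignType.sign y := by
    rw [sign_mul, sign_pos hc, one_mul]
  rw [spow, spow, h, abs_mul, abs_of_pos hc, Real.mul_rpow hc.le (abs_nonneg y)]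
  ring

lemma spow_le_one_aux {θ x y : ℝ} (hθ : 0 < θ) (hθ1 : θ ≤ 1) (hx : 0 ≤ x) (hxy : y ≤ x) :
    |spow θ x - spow θ y| ≤ 2 * |x - y| ^ θ := by
  have hxy' : |x - y| = x - y := abs_of_nonneg (by linarith)
  rw [spow_of_nonneg hθ hx, hxy']
  rcases le_total 0 y with hy | hy
  · rw [spow_of_nonneg hθ hy]
    have h1 : y ^ θ ≤ x ^ θ := by gcongr
    rw [abs_of_nonneg (by linarith)]
    have h2 := Real.rpow_add_le_add_rpow (p := θ) (sub_nonneg.2 hxy) hy hθ.le hθ1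
    rw [sub_add_cancel] at h2
    have : 0 ≤ (x - y) ^ θ := Real.rpow_nonneg (by linarith) _
    linarith
  · have : spow θ y = - (-y) ^ θ := by
      rw [← spow_of_nonneg hθ (by linarith : 0 ≤ -y), spow_neg]; ring
    rw [this]
    have h0 : 0 ≤ x ^ θ := by positivity
    have h0' : 0 ≤ (-y) ^ θ := Real.rpow_nonneg (by linarith) _
    rw [abs_of_nonneg (by linarith)]
    have h1 : x ^ θ ≤ (x - y) ^ θ := by gcongr; linarith
    have h2 : (-y) ^ θ ≤ (x - y) ^ θ := by
      apply Real.rpow_le_rpow <;> linarith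
    linarith

lemma spow_lip_aux {θ x y R : ℝ} (hθ1 : 1 ≤ θ) (hx : 0 ≤ x) (hxy : y ≤ x) (hxR : x ≤ R)
    (hyR : -R ≤ y) :
    |spow θ x - spow θ y| ≤ (2 * (θ * R ^ (θ - 1))) * |x - y| := by
  have hθ : 0 < θ := by linarith
  have hR : 0 ≤ R := hx.trans hxR
  have key : ∀ a b : ℝ, 0 ≤ b → b ≤ a → a ≤ R → a ^ θ - b ^ θ ≤ θ * R ^ (θ - 1) * (a - b) := by
    intro a b hb hab haR
    have hmv := Convex.norm_image_sub_le_of_norm_hasDerivWithin_le (f := fun z : ℝ => z ^ θ)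
      (f' := fun z => θ * z ^ (θ - 1)) (C := θ * R ^ (θ - 1)) (s := Set.Icc 0 R) (x := b) (y := a)
      (fun z hz => (Real.hasDerivAt_rpow_const (Or.inr hθ1)).hasDerivWithinAt)
      (fun z hz => by
        rw [Real.norm_eq_abs, abs_of_nonneg (mul_nonneg hθ.le (Real.rpow_nonneg hz.1 _))]
        gcongr
        · exact hz.1
        · exact hz.2) (convex_Icc 0 R) ⟨hb, by linarith⟩ ⟨by linarith, haR⟩
    rw [Real.norm_eq_abs, Real.norm_eq_abs, abs_of_nonneg (by linarith : 0 ≤ a - b)] at hmv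
    exact (le_abs_self _).trans hmv
  have hM : 0 ≤ θ * R ^ (θ - 1) := by positivity
  have hxy' : |x - y| = x - y := abs_of_nonneg (by linarith)
  rw [spow_of_nonneg hθ hx, hxy']
  rcases le_total 0 y with hy | hy
  · rw [spow_of_nonneg hθ hy]
    have h1 : y ^ θ ≤ x ^ θ := by gcongr
    rw [abs_of_nonneg (by linarith)]
    have := key x y hy hxy hxR
    nlinarith [mul_nonneg hM (sub_nonneg.2 hxy)]
  · have : spow θ y = - (-y) ^ θ := by
      rw [← spow_of_nonneg hθ (by linarith : 0 ≤ -y), spow_neg]; ring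
    rw [this]
    have h0 : 0 ≤ x ^ θ := by positivity
    have h0' : 0 ≤ (-y) ^ θ := Real.rpow_nonneg (by linarith) _
    rw [abs_of_nonneg (by linarith)]
    have h1 := key x 0 le_rfl hx hxR
    have h2 := key (-y) 0 le_rfl (by linarith) (by linarith)
    rw [Real.zero_rpow hθ.ne'] at h1 h2
    nlinarith [mul_nonneg hM hx, mul_nonneg hM (neg_nonneg.2 hy)]

lemma spow_sym_aux {P : ℝ → ℝ → Prop}
    (hs : ∀ x y, P x y → P y x) (hn : ∀ x y, P x y → P (-x) (-y))
    (h : ∀ x y, 0 ≤ x → y ≤ x → |y| ≤ x → P x y) (x y : ℝ) : P x y := by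
  have h2 : ∀ x y : ℝ, |y| ≤ |x| → P x y := by
    intro x y hxy
    rcases le_total 0 x with hx | hx
    · rw [abs_of_nonneg hx] at hxy
      exact h x y hx ((le_abs_self y).trans hxy) hxy
    · rw [abs_of_nonpos hx] at hxy
      have := hn _ _ (h (-x) (-y) (by linarith) (by have := neg_abs_le y; linarith) (by simpa using hxy))
      simpa using this
  rcases le_total |y| |x| with hh | hh
  · exact h2 x y hh
  · exact hs _ _ (h2 y x hh)

lemma spow_HB {θ β : ℝ} (hβ : 0 < β) (hβ1 : β < 1) (hθ : β ≤ θ) : HB β (spow θ) := by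
  have hθ0 : 0 < θ := by linarith
  rcases le_total θ 1 with h1 | h1
  · refine HB.mono hβ.le hθ ?_
    intro R
    refine ⟨2, by norm_num, fun x y _ _ => ?_⟩
    simp only [Real.norm_eq_abs]
    refine spow_sym_aux (P := fun x y => |spow θ x - spow θ y| ≤ 2 * |x - y| ^ θ) ?_ ?_ ?_ x y
    · intro x y h; rw [abs_sub_comm, abs_sub_comm y x]; exact h
    · intro x y h
      rw [spow_neg, spow_neg, ← abs_neg, ← abs_neg (-x - -y)]
      convert h using 3 <;> ring_nf
    · intro x y hx hxy _
      exact spow_le_one_aux hθ0 h1 hx hxy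
  · refine HB.mono (γ := 1) hβ.le hβ1.le ?_
    intro R
    refine ⟨2 * (θ * |R| ^ (θ - 1)), by positivity, fun x y hx hy => ?_⟩
    simp only [Real.norm_eq_abs, Real.rpow_one] at hx hy ⊢
    have hx := hx.trans (le_abs_self R)
    have hy := hy.trans (le_abs_self R)
    revert hx hy
    refine spow_sym_aux (P := fun x y => |x| ≤ |R| → |y| ≤ |R| →
      |spow θ x - spow θ y| ≤ 2 * (θ * |R| ^ (θ - 1)) * |x - y|) ?_ ?_ ?_ x y
    · intro x y h a b; rw [abs_sub_comm, abs_sub_comm y x]; exact h b a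
    · intro x y h a b
      rw [abs_neg] at a b
      rw [spow_neg, spow_neg, ← abs_neg, ← abs_neg (-x - -y)]
      convert h a b using 3 <;> ring_nf
    · intro x y hx hxy _ a b
      exact spow_lip_aux h1 hx hxy ((le_abs_self x).trans a) (by have := neg_abs_le y; linarith)

open Filter Topology

section Ksec
variable {E : Type*} [NormedAddCommGroup E] [NormedSpace ℝ E]

/-- one-parameter group, Lipschitz at time zero -/
structure IsGrp (S : ℝ → E →L[ℝ] E) : Prop where
  zero : ∀ x, S 0 x = x
  add : ∀ s t x, S (s + t) x = S s (S t x)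
  lip : ∃ C, 0 ≤ C ∧ ∀ t, |t| ≤ 1 → ‖S t - 1‖ ≤ C * |t|

/-- subexponential growth -/
def SubExp (S : ℝ → E →L[ℝ] E) : Prop :=
  ∀ ε > (0 : ℝ), ∃ C, 0 < C ∧ ∀ t x, ‖S t x‖ ≤ C * Real.exp (ε * |t|) * ‖x‖

variable {S : ℝ → E →L[ℝ] E}

lemma IsGrp.neg_cancel (hS : IsGrp S) (t : ℝ) (x : E) : S (-t) (S t x) = x := by
  rw [← hS.add, neg_add_cancel, hS.zero]

lemma IsGrp.cancel_neg (hS : IsGrp S) (t : ℝ) (x : E) : S t (S (-t) x) = x := by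
  rw [← hS.add, add_neg_cancel, hS.zero]

lemma IsGrp.ne_zero (hS : IsGrp S) (t : ℝ) {x : E} (hx : x ≠ 0) : S t x ≠ 0 := by
  intro h
  have := hS.neg_cancel t x
  rw [h, map_zero] at this
  exact hx this.symm

lemma IsGrp.diff (hS : IsGrp S) (hs : SubExp S) {ε : ℝ} (hε : 0 < ε) :
    ∃ C, 0 < C ∧ ∀ a b x, ‖S a x - S b x‖ ≤
      C * |a - b| * (Real.exp (ε * |a|) + Real.exp (ε * |b|)) * ‖x‖ := by
  obtain ⟨C, hC, h⟩ := hs ε hε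
  obtain ⟨C', hC', h'⟩ := hS.lip
  refine ⟨C + C * C', by positivity, fun a b x => ?_⟩
  have ea := Real.exp_pos (ε * |a|)
  have eb := Real.exp_pos (ε * |b|)
  rcases le_total |a - b| 1 with h1 | h1
  · have : S a x - S b x = (S (a - b) - 1) (S b x) := by
      rw [sub_apply, ← hS.add]; simp
    rw [this]
    calc _ ≤ ‖S (a - b) - 1‖ * ‖S b x‖ := ContinuousLinearMap.le_opNorm _ _
      _ ≤ (C' * |a - b|) * (C * Real.exp (ε * |b|) * ‖x‖) := by
        gcongr
        · exact h' _ h1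
        · exact h b x
      _ = (C * C') * |a - b| * (0 + Real.exp (ε * |b|)) * ‖x‖ := by ring
      _ ≤ _ := by gcongr; linarith
  · calc _ ≤ ‖S a x‖ + ‖S b x‖ := norm_sub_le _ _
      _ ≤ C * Real.exp (ε * |a|) * ‖x‖ + C * Real.exp (ε * |b|) * ‖x‖ := add_le_add (h a x) (h b x)
      _ = C * 1 * (Real.exp (ε * |a|) + Real.exp (ε * |b|)) * ‖x‖ := by ring
      _ ≤ _ := by
        have : 0 ≤ C * C' := by positivity
        gcongr
        linarith

lemma exp_sigma_bound {ε K η R r s : ℝ} (hε : 0 < ε) (hη : ε * K = η)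
    (hR : 1 ≤ R) (hr : 0 < r) (hrR : r ≤ R) (hK : 0 ≤ K) (hs : |s| ≤ K + K * |Real.log r|) :
    Real.exp (ε * |s|) ≤ Real.exp (η + 2 * η * Real.log R) * r ^ (-η) := by
  have hlR : 0 ≤ Real.log R := Real.log_nonneg hR
  have hlr : Real.log r ≤ Real.log R := Real.log_le_log hr hrR
  have h1 : |Real.log r| ≤ 2 * Real.log R - Real.log r := by
    rw [abs_le]; constructor <;> linarith
  rw [Real.rpow_def_of_pos hr, ← Real.exp_add]
  apply Real.exp_le_exp.2
  calc ε * |s| ≤ ε * (K + K * (2 * Real.log R - Real.log r)) := by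
        gcongr
        refine hs.trans ?_
        gcongr
    _ = _ := by rw [← hη]; ring

lemma holder_of_sigma (hS : IsGrp S) (hs : SubExp S) (σ : E → ℝ) (K : ℝ) (hK : 0 < K)
    (hσ : ∀ x, x ≠ 0 → |σ x| ≤ K + K * |Real.log ‖x‖|)
    (hlip : ∀ ε > (0 : ℝ), ∃ C, 0 < C ∧ ∀ x y, x ≠ 0 → y ≠ 0 →
      |σ x - σ y| * min ‖x‖ ‖y‖ ≤ C * Real.exp (ε * |σ y|) * ‖x - y‖)
    {γ : ℝ} (hγ : 0 < γ) (hγ1 : γ < 1) : HB γ (fun x => S (σ x) x) := by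
  intro R₀
  set R := max R₀ 1 with hRdef
  have hR : 1 ≤ R := le_max_right _ _
  set η := (1 - γ) / 2 with hηd
  have hη : 0 < η := by rw [hηd]; linarith
  set ε := η / K with hεd
  have hε : 0 < ε := by positivity
  have hεK : ε * K = η := by rw [hεd]; field_simp
  obtain ⟨C1, hC1, h1⟩ := hs ε hε
  obtain ⟨C3, hC3, h3⟩ := hS.diff hs hε
  obtain ⟨C4, hC4, h4⟩ := hlip ε hε
  set C0 := Real.exp (η + 2 * η * Real.log R) with hC0d
  have hC0 : 0 < C0 := Real.exp_pos _
  have he : ∀ x : E, x ≠ 0 → ‖x‖ ≤ R → Real.exp (ε * |σ x|) ≤ C0 * ‖x‖ ^ (-η) := fun x hx hxR =>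
    exp_sigma_bound hε hεK hR (norm_pos_iff.2 hx) hxR hK.le (hσ x hx)
  set C2 := C1 * C0 * R ^ η with hC2d
  have hRη : 0 < R ^ η := Real.rpow_pos_of_pos (by linarith) _
  have hC2 : 0 < C2 := by positivity
  have hb : ∀ x : E, ‖x‖ ≤ R → ‖S (σ x) x‖ ≤ C2 * ‖x‖ ^ γ := by
    intro x hxR
    by_cases hx : x = 0
    · subst hx; rw [map_zero, norm_zero]; positivity
    have hx0 := norm_pos_iff.2 hx
    calc _ ≤ C1 * Real.exp (ε * |σ x|) * ‖x‖ := h1 _ _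
      _ ≤ C1 * (C0 * ‖x‖ ^ (-η)) * ‖x‖ := by gcongr; exact he x hx hxR
      _ = C1 * C0 * ‖x‖ ^ η * ‖x‖ ^ γ := by
        have : ‖x‖ ^ (-η) * ‖x‖ = ‖x‖ ^ η * ‖x‖ ^ γ := by
          rw [← Real.rpow_add hx0]
          nth_rewrite 2 [← Real.rpow_one ‖x‖]
          rw [← Real.rpow_add hx0]
          congr 1; rw [hηd]; ring
        linear_combination (C1 * C0) * this
      _ ≤ _ := by rw [hC2d]; gcongr
  set M := max (3 * C2) ((C1 + 2 * C3 * C4) * C0 ^ 2) with hMd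
  have hM : 0 ≤ M := le_trans (by positivity) (le_max_left _ _)
  have main : ∀ x y : E, ‖x‖ ≤ R → ‖y‖ ≤ ‖x‖ →
      ‖S (σ x) x - S (σ y) y‖ ≤ M * ‖x - y‖ ^ γ := by
    intro x y hxR hyx
    by_cases hxy : x = y
    · subst hxy; simp; positivity
    have hD : 0 < ‖x - y‖ := norm_pos_iff.2 (sub_ne_zero.2 hxy)
    rcases le_or_gt ‖y‖ ‖x - y‖ with hc | hc
    · have hx2 : ‖x‖ ≤ 2 * ‖x - y‖ := by
        have := norm_add_le (x - y) y
        rw [sub_add_cancel] at this; linarith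
      calc _ ≤ ‖S (σ x) x‖ + ‖S (σ y) y‖ := norm_sub_le _ _
        _ ≤ C2 * ‖x‖ ^ γ + C2 * ‖y‖ ^ γ := add_le_add (hb x hxR) (hb y (hyx.trans hxR))
        _ ≤ C2 * (2 * ‖x - y‖) ^ γ + C2 * ‖x - y‖ ^ γ := by gcongr
        _ ≤ C2 * (2 * ‖x - y‖ ^ γ) + C2 * ‖x - y‖ ^ γ := by
          gcongr
          rw [Real.mul_rpow (by norm_num) hD.le]
          gcongr
          calc (2 : ℝ) ^ γ ≤ 2 ^ (1 : ℝ) := Real.rpow_le_rpow_of_exponent_le (by norm_num) hγ1.le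
            _ = 2 := Real.rpow_one 2
        _ = 3 * C2 * ‖x - y‖ ^ γ := by ring
        _ ≤ _ := by gcongr; exact le_max_left _ _
    · have hy0 : 0 < ‖y‖ := hD.trans hc
      have hx0 : 0 < ‖x‖ := hy0.trans_le hyx
      have hyn := norm_pos_iff.1 hy0
      have hxn := norm_pos_iff.1 hx0
      set Q := C0 * ‖x - y‖ ^ (-η) with hQd
      have hQx : Real.exp (ε * |σ x|) ≤ Q := (he x hxn hxR).trans (by
        rw [hQd]; gcongr ?_ * ?_
        exact Real.rpow_le_rpow_of_nonpos hD (by linarith) (by linarith))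
      have hQy : Real.exp (ε * |σ y|) ≤ Q := (he y hyn (hyx.trans hxR)).trans (by
        rw [hQd]; gcongr ?_ * ?_
        exact Real.rpow_le_rpow_of_nonpos hD (by linarith) (by linarith))
      have hQ1 : 1 ≤ Q := le_trans (Real.one_le_exp (by positivity)) hQx
      have e1 : S (σ x) x - S (σ y) y = S (σ x) (x - y) + (S (σ x) y - S (σ y) y) := by
        rw [map_sub]; abel
      have h4' := h4 x y hxn hyn
      rw [min_eq_right hyx] at h4'
      have b2 : ‖S (σ x) y - S (σ y) y‖ ≤ C3 * (Q + Q) * (C4 * Q * ‖x - y‖) :=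
        calc _ ≤ C3 * |σ x - σ y| * (Real.exp (ε * |σ x|) + Real.exp (ε * |σ y|)) * ‖y‖ := h3 _ _ _
          _ ≤ C3 * |σ x - σ y| * (Q + Q) * ‖y‖ := by gcongr
          _ = C3 * (Q + Q) * (|σ x - σ y| * ‖y‖) := by ring
          _ ≤ C3 * (Q + Q) * (C4 * Real.exp (ε * |σ y|) * ‖x - y‖) := by gcongr
          _ ≤ _ := by gcongr
      have b1 : ‖S (σ x) (x - y)‖ ≤ C1 * Q ^ 2 * ‖x - y‖ :=
        calc _ ≤ C1 * Real.exp (ε * |σ x|) * ‖x - y‖ := h1 _ _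
          _ ≤ C1 * Q * ‖x - y‖ := by gcongr
          _ ≤ _ := by gcongr; nlinarith
      have hQ2 : Q ^ 2 * ‖x - y‖ = C0 ^ 2 * ‖x - y‖ ^ γ := by
        have : (‖x - y‖ ^ (-η)) ^ 2 * ‖x - y‖ = ‖x - y‖ ^ γ := by
          rw [← Real.rpow_natCast, ← Real.rpow_mul hD.le]
          nth_rewrite 2 [← Real.rpow_one ‖x - y‖]
          rw [← Real.rpow_add hD]
          congr 1; rw [hηd]; push_cast; ring
        rw [hQd, mul_pow, mul_assoc, this]
      rw [e1]
      calc _ ≤ C1 * Q ^ 2 * ‖x - y‖ + C3 * (Q + Q) * (C4 * Q * ‖x - y‖) :=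
            (norm_add_le _ _).trans (add_le_add b1 b2)
        _ = (C1 + 2 * C3 * C4) * (Q ^ 2 * ‖x - y‖) := by ring
        _ = (C1 + 2 * C3 * C4) * C0 ^ 2 * ‖x - y‖ ^ γ := by rw [hQ2]; ring
        _ ≤ _ := by gcongr; exact le_max_right _ _
  refine ⟨M, hM, fun x y hx hy => ?_⟩
  have hx := hx.trans (le_max_left R₀ 1)
  have hy := hy.trans (le_max_left R₀ 1)
  rcases le_total ‖y‖ ‖x‖ with h | h
  · exact main x y hx h
  · have := main y x hy h
    rw [norm_sub_rev, norm_sub_rev y x] at this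
    exact this

/-- adapted norm -/
def nu (S : ℝ → E →L[ℝ] E) (x : E) : ℝ := ⨆ t : ℝ, Real.exp (-(1 / 2 * |t|)) * ‖S t x‖

lemma nu_facts (hS : IsGrp S) (hs : SubExp S) :
    ∃ C, 1 ≤ C ∧ (∀ x, ‖x‖ ≤ nu S x) ∧ (∀ x, nu S x ≤ C * ‖x‖) ∧
      (∀ x y, |nu S x - nu S y| ≤ C * ‖x - y‖) ∧
      (∀ s x, nu S (S s x) ≤ Real.exp (1 / 2 * |s|) * nu S x) := by
  obtain ⟨C, hC, h⟩ := hs (1 / 2) (by norm_num)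
  have hb : ∀ x t, Real.exp (-(1 / 2 * |t|)) * ‖S t x‖ ≤ C * ‖x‖ := by
    intro x t
    calc _ ≤ Real.exp (-(1 / 2 * |t|)) * (C * Real.exp (1 / 2 * |t|) * ‖x‖) := by
          gcongr; exact h t x
      _ = (Real.exp (-(1 / 2 * |t|)) * Real.exp (1 / 2 * |t|)) * (C * ‖x‖) := by ring
      _ = _ := by rw [← Real.exp_add]; simp
  have hbdd : ∀ x, BddAbove (Set.range fun t : ℝ => Real.exp (-(1 / 2 * |t|)) * ‖S t x‖) := by
    intro x
    refine ⟨C * ‖x‖, ?_⟩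
    rintro _ ⟨t, rfl⟩
    exact hb x t
  have hge : ∀ x t, Real.exp (-(1 / 2 * |t|)) * ‖S t x‖ ≤ nu S x := fun x t =>
    le_ciSup (hbdd x) t
  have hle : ∀ x, nu S x ≤ C * ‖x‖ := fun x => ciSup_le (hb x)
  have hge0 : ∀ x, ‖x‖ ≤ nu S x := fun x => by simpa [hS.zero] using hge x 0
  have hadd : ∀ x y, nu S x - nu S y ≤ C * ‖x - y‖ := by
    intro x y
    have : nu S x ≤ nu S y + nu S (x - y) := by
      refine ciSup_le fun t => ?_
      have e : S t x = S t y + S t (x - y) := by rw [← map_add]; simp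
      calc _ ≤ Real.exp (-(1 / 2 * |t|)) * (‖S t y‖ + ‖S t (x - y)‖) := by
            gcongr; rw [e]; exact norm_add_le _ _
        _ ≤ _ := by rw [mul_add]; exact add_le_add (hge y t) (hge _ t)
    have := hle (x - y)
    linarith
  refine ⟨max C 1, le_max_right _ _, hge0, fun x => (hle x).trans ?_, fun x y => ?_, fun s x => ?_⟩
  · gcongr; exact le_max_left _ _
  · have h1 : C * ‖x - y‖ ≤ max C 1 * ‖x - y‖ := by gcongr; exact le_max_left _ _
    rw [abs_le]
    have h2 := hadd x y
    have h3 := hadd y x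
    rw [norm_sub_rev] at h3
    constructor <;> linarith
  · refine ciSup_le fun t => ?_
    rw [← hS.add]
    have h1 := hge x (t + s)
    have h2 : Real.exp (-(1 / 2 * |t|)) ≤ Real.exp (1 / 2 * |s|) * Real.exp (-(1 / 2 * |t + s|)) := by
      rw [← Real.exp_add]
      apply Real.exp_le_exp.2
      have := abs_add_le t s
      linarith
    calc _ ≤ Real.exp (1 / 2 * |s|) * Real.exp (-(1 / 2 * |t + s|)) * ‖S (t + s) x‖ := by gcongr
      _ ≤ _ := by rw [mul_assoc]; gcongr

lemma nu_smul (c : ℝ) (hc : 0 ≤ c) (x : E) : nu S (c • x) = c * nu S x := by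
  rw [nu, nu, Real.mul_iSup_of_nonneg hc]
  congr 1; ext t
  rw [map_smul, norm_smul, Real.norm_eq_abs, abs_of_nonneg hc]; ring

lemma log_lip {a b : ℝ} (ha : 0 < a) (hb : 0 < b) :
    |Real.log a - Real.log b| * min a b ≤ |a - b| := by
  have key : ∀ a b : ℝ, 0 < a → 0 < b → b ≤ a → |Real.log a - Real.log b| * min a b ≤ |a - b| := by
    intro a b ha hb h
    rw [min_eq_right h, abs_of_nonneg (by linarith [Real.log_le_log hb h]),
      abs_of_nonneg (by linarith), ← Real.log_div ha.ne' hb.ne']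
    have := Real.log_le_sub_one_of_pos (div_pos ha hb)
    calc _ ≤ (a / b - 1) * b := by gcongr
      _ = a - b := by field_simp
  rcases le_total b a with h | h
  · exact key a b ha hb h
  · have := key b a hb ha h
    rw [abs_sub_comm, min_comm, abs_sub_comm a b]; exact this

theorem conj_exists (hS : IsGrp S) (hs : SubExp S) :
    ∃ f g : E → E, (∀ x, g (f x) = x) ∧ (∀ x, f (g x) = x) ∧
      (∀ t x, f (Real.exp t • S t x) = Real.exp t • f x) ∧ f 0 = 0 ∧ g 0 = 0 ∧
      (∀ γ : ℝ, 0 < γ → γ < 1 → HB γ f) ∧ (∀ γ : ℝ, 0 < γ → γ < 1 → HB γ g) := by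
  obtain ⟨C, hC, hge, hle, hlip, hflow⟩ := nu_facts hS hs
  have hC0 : 0 < C := by linarith
  have hpos : ∀ x : E, x ≠ 0 → 0 < nu S x := fun x hx => (norm_pos_iff.2 hx).trans_le (hge x)
  have hle' : ∀ s x, x ≠ 0 → Real.log (nu S (S s x)) - Real.log (nu S x) ≤ 1 / 2 * |s| := by
    intro s x hx
    have := Real.log_le_log (hpos _ (hS.ne_zero s hx)) (hflow s x)
    rw [Real.log_mul (Real.exp_pos _).ne' (hpos x hx).ne', Real.log_exp] at this
    linarith
  have hlog : ∀ s x, x ≠ 0 → |Real.log (nu S (S s x)) - Real.log (nu S x)| ≤ 1 / 2 * |s| := by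
    intro s x hx
    rw [abs_le]
    have h1 := hle' s x hx
    have h2 := hle' (-s) (S s x) (hS.ne_zero s hx)
    rw [hS.neg_cancel, abs_neg] at h2
    constructor <;> linarith
  have hlogx : ∀ x : E, x ≠ 0 → |Real.log (nu S x)| ≤ Real.log C + |Real.log ‖x‖| := by
    intro x hx
    have hx0 := norm_pos_iff.2 hx
    have h1 := Real.log_le_log hx0 (hge x)
    have h2 := Real.log_le_log (hpos x hx) (hle x)
    rw [Real.log_mul hC0.ne' hx0.ne'] at h2
    have h3 := le_abs_self (Real.log ‖x‖)
    have h4 := neg_abs_le (Real.log ‖x‖)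
    have h5 := Real.log_nonneg hC
    rw [abs_le]; constructor <;> linarith
  -- contraction
  have hcontr : ∀ x : E, x ≠ 0 →
      ContractingWith (1 / 2) (fun s : ℝ => Real.log (nu S (S (-s) x))) := by
    intro x hx
    refine ⟨by rw [← NNReal.coe_lt_coe]; norm_num, LipschitzWith.of_dist_le_mul fun s s' => ?_⟩
    rw [Real.dist_eq, Real.dist_eq]
    have := hlog (s' - s) (S (-s') x) (hS.ne_zero _ hx)
    rw [← hS.add, show s' - s + -s' = -s by ring, abs_sub_comm s' s] at this
    simpa using this
  have hex : ∀ x : E, ∃ s : ℝ, x ≠ 0 → Real.log (nu S (S (-s) x)) = s := by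
    intro x
    by_cases hx : x = 0
    · exact ⟨0, fun h => absurd hx h⟩
    · exact ⟨(hcontr x hx).fixedPoint, fun _ => (hcontr x hx).fixedPoint_isFixedPt⟩
  choose s hsx using hex
  have huniq : ∀ x : E, x ≠ 0 → ∀ u, Real.log (nu S (S (-u) x)) = u → u = s x := by
    intro x hx u hu
    exact (hcontr x hx).fixedPoint_unique' hu (hsx x hx)
  have hnu : ∀ x : E, x ≠ 0 → nu S (S (-s x) x) = Real.exp (s x) := by
    intro x hx
    conv_rhs => rw [← hsx x hx]
    rw [Real.exp_log (hpos _ (hS.ne_zero _ hx))]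
  have hgf : ∀ x, S (Real.log (nu S (S (-s x) x))) (S (-s x) x) = x := by
    intro x
    by_cases hx : x = 0
    · subst hx; simp
    rw [hsx x hx, hS.cancel_neg]
  have hfg : ∀ x, S (-s (S (Real.log (nu S x)) x)) (S (Real.log (nu S x)) x) = x := by
    intro x
    by_cases hx : x = 0
    · subst hx; simp
    rw [← huniq (S (Real.log (nu S x)) x) (hS.ne_zero _ hx) (Real.log (nu S x))
      (by rw [hS.neg_cancel]), hS.neg_cancel]
  have hlogC := Real.log_nonneg hC
  refine ⟨fun x => S (-s x) x, fun x => S (Real.log (nu S x)) x, hgf, hfg, ?_, by simp, by simp, ?_, ?_⟩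
  · intro t x
    by_cases hx : x = 0
    · subst hx; simp
    have : s x + t = s (Real.exp t • S t x) := by
      apply huniq
      · exact smul_ne_zero (Real.exp_pos _).ne' (hS.ne_zero _ hx)
      · rw [map_smul, ← hS.add, nu_smul _ (Real.exp_pos _).le, show -(s x + t) + t = - s x by ring,
          hnu x hx, ← Real.exp_add, Real.log_exp]; ring
    simp only
    rw [← this, map_smul, ← hS.add]
    congr 3; ring
  · intro γ hγ hγ1
    refine holder_of_sigma hS hs (fun x => - s x) (2 * Real.log C + 2) (by linarith) ?_ ?_ hγ hγ1
    · intro x hx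
      have h1 := hlog (-s x) x hx
      rw [hsx x hx, abs_neg] at h1
      have h2 := hlogx x hx
      have h3 : |s x| ≤ |s x - Real.log (nu S x)| + |Real.log (nu S x)| := by
        have := abs_add_le (s x - Real.log (nu S x)) (Real.log (nu S x))
        simpa using this
      rw [abs_neg]
      have h4 := abs_nonneg (Real.log ‖x‖)
      nlinarith
    · intro ε hε
      obtain ⟨D, hD, hD'⟩ := hs (ε / 2) (by positivity)
      refine ⟨2 * (D * (C * D)), by positivity, fun x y hx hy => ?_⟩
      have hx' := hS.ne_zero (-s y) hx
      have hy' := hS.ne_zero (-s y) hy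
      have h1 : |s x - s y| ≤ 2 * |Real.log (nu S (S (-s y) x)) - Real.log (nu S (S (-s y) y))| := by
        have a1 := hlog (s y - s x) (S (-s y) x) hx'
        rw [← hS.add, show s y - s x + -s y = - s x by ring, hsx x hx] at a1
        rw [hsx y hy]
        have a2 := abs_add_le (s x - Real.log (nu S (S (-s y) x))) (Real.log (nu S (S (-s y) x)) - s y)
        rw [sub_add_sub_cancel] at a2
        rw [abs_sub_comm (s y) (s x)] at a1
        linarith
      set e := Real.exp (ε / 2 * |s y|) with he
      have he0 : 0 < e := Real.exp_pos _
      have h2 : ∀ z, ‖z‖ ≤ D * e * nu S (S (-s y) z) := by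
        intro z
        have := hD' (s y) (S (-s y) z)
        rw [hS.cancel_neg] at this
        refine this.trans ?_
        gcongr
        exact hge _
      have h3 : min ‖x‖ ‖y‖ ≤ D * e * min (nu S (S (-s y) x)) (nu S (S (-s y) y)) := by
        rw [mul_min_of_nonneg _ _ (by positivity)]
        exact min_le_min (h2 x) (h2 y)
      have h4 := log_lip (hpos _ hx') (hpos _ hy')
      have h5 := hlip (S (-s y) x) (S (-s y) y)
      rw [← map_sub] at h5
      have h6 := hD' (-s y) (x - y)
      rw [abs_neg, ← he] at h6
      have h7 : 0 ≤ min ‖x‖ ‖y‖ := by positivity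
      have hee : Real.exp (ε * |-s y|) = e * e := by
        rw [he, ← Real.exp_add, abs_neg]; congr 1; ring
      rw [show - s x - - s y = - (s x - s y) by ring, abs_neg, hee]
      set Λ := |Real.log (nu S (S (-s y) x)) - Real.log (nu S (S (-s y) y))|
      calc |s x - s y| * min ‖x‖ ‖y‖ ≤ (2 * Λ) *
            (D * e * min (nu S (S (-s y) x)) (nu S (S (-s y) y))) := by gcongr
        _ = 2 * (D * e) * (Λ * min (nu S (S (-s y) x)) (nu S (S (-s y) y))) := by ring
        _ ≤ 2 * (D * e) * (C * (D * e * ‖x - y‖)) := by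
          refine mul_le_mul_of_nonneg_left (h4.trans (h5.trans ?_)) (by positivity)
          gcongr
        _ = _ := by ring
  · intro γ hγ hγ1
    refine holder_of_sigma hS hs (fun x => Real.log (nu S x)) (Real.log C + 1) (by linarith) ?_ ?_ hγ hγ1
    · intro x hx
      have h2 := hlogx x hx
      have h4 := abs_nonneg (Real.log ‖x‖)
      nlinarith
    · intro ε hε
      refine ⟨C, hC0, fun x y hx hy => ?_⟩
      calc _ ≤ |Real.log (nu S x) - Real.log (nu S y)| * min (nu S x) (nu S y) := by
            gcongr
            · exact hge x
            · exact hge y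
        _ ≤ |nu S x - nu S y| := log_lip (hpos x hx) (hpos y hy)
        _ ≤ C * 1 * ‖x - y‖ := by rw [mul_one]; exact hlip x y
        _ ≤ _ := by gcongr; exact Real.one_le_exp (by positivity)

end Ksec

open Filter Topology

section Lsec
variable {X : Type*} [NormedAddCommGroup X] [NormedSpace ℝ X]

/-- one-parameter group with exponential bound -/
structure IsFlow (S : ℝ → X →L[ℝ] X) : Prop extends IsGrp S where
  bdd : ∃ c, 0 ≤ c ∧ ∀ t x, ‖S t x‖ ≤ Real.exp (c * |t|) * ‖x‖

lemma IsFlow.rev {S : ℝ → X →L[ℝ] X} (hS : IsFlow S) : IsFlow (fun t => S (-t)) where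
  zero x := by simp [hS.zero]
  add s t x := by rw [neg_add, hS.add]
  lip := by
    obtain ⟨C, hC, h⟩ := hS.lip
    exact ⟨C, hC, fun t ht => by simpa using h (-t) (by simpa using ht)⟩
  bdd := by
    obtain ⟨C, hC, h⟩ := hS.bdd
    exact ⟨C, hC, fun t x => by simpa using h (-t) x⟩

/-- vectors growing with exact rate `l` -/
def Esp (S : ℝ → X →L[ℝ] X) (l : ℝ) : Submodule ℝ X where
  carrier := {x | ∀ ε > (0 : ℝ), ∃ C, ∀ t, ‖S t x‖ ≤ C * Real.exp (l * t + ε * |t|)}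
  add_mem' := by
    intro x y hx hy ε hε
    obtain ⟨C, hC⟩ := hx ε hε
    obtain ⟨D, hD⟩ := hy ε hε
    refine ⟨C + D, fun t => ?_⟩
    rw [map_add, add_mul]
    exact (norm_add_le _ _).trans (add_le_add (hC t) (hD t))
  zero_mem' := fun ε hε => ⟨0, fun t => by simp⟩
  smul_mem' := by
    intro c x hx ε hε
    obtain ⟨C, hC⟩ := hx ε hε
    refine ⟨‖c‖ * C, fun t => ?_⟩
    rw [map_smul, norm_smul, mul_assoc]
    gcongr
    exact hC t

/-- vectors growing at most with rate `s` -/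
def Lsp (S : ℝ → X →L[ℝ] X) (s : ℝ) : Submodule ℝ X where
  carrier := {x | ∀ ε > (0 : ℝ), ∃ C, ∀ᶠ t in atTop, ‖S t x‖ ≤ C * Real.exp ((s + ε) * t)}
  add_mem' := by
    intro x y hx hy ε hε
    obtain ⟨C, hC⟩ := hx ε hε
    obtain ⟨D, hD⟩ := hy ε hε
    refine ⟨C + D, ?_⟩
    filter_upwards [hC, hD] with t h1 h2
    rw [map_add, add_mul]
    exact (norm_add_le _ _).trans (add_le_add h1 h2)
  zero_mem' := fun ε hε => ⟨0, by simp⟩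
  smul_mem' := by
    intro c x hx ε hε
    obtain ⟨C, hC⟩ := hx ε hε
    refine ⟨‖c‖ * C, ?_⟩
    filter_upwards [hC] with t h1
    rw [map_smul, norm_smul, mul_assoc]
    gcongr

lemma mem_Esp {S : ℝ → X →L[ℝ] X} {l : ℝ} {x : X} : x ∈ Esp S l ↔
    ∀ ε > (0 : ℝ), ∃ C, ∀ t, ‖S t x‖ ≤ C * Real.exp (l * t + ε * |t|) := Iff.rfl

lemma mem_Lsp {S : ℝ → X →L[ℝ] X} {s : ℝ} {x : X} : x ∈ Lsp S s ↔
    ∀ ε > (0 : ℝ), ∃ C, ∀ᶠ t in atTop, ‖S t x‖ ≤ C * Real.exp ((s + ε) * t) := Iff.rfl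

variable {S : ℝ → X →L[ℝ] X}

lemma Esp_rev (l : ℝ) : Esp (fun t => S (-t)) l = Esp S (-l) := by
  ext x
  simp only [mem_Esp]
  refine forall₂_congr fun ε hε => exists_congr fun C => ?_
  constructor
  · intro h t
    have := h (-t)
    simpa using this
  · intro h t
    have := h (-t)
    simpa using this

lemma Esp_le_Lsp {l s : ℝ} (h : l ≤ s) : Esp S l ≤ Lsp S s := by
  intro x hx ε hε
  obtain ⟨C, hC⟩ := hx ε hε
  refine ⟨C, ?_⟩
  filter_upwards [eventually_ge_atTop (0 : ℝ)] with t ht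
  have hC0 : 0 ≤ C := by
    have := (norm_nonneg _).trans (hC 0)
    simpa using this
  refine (hC t).trans ?_
  gcongr
  rw [abs_of_nonneg ht, add_mul]
  gcongr

lemma Lsp_mono {s s' : ℝ} (h : s ≤ s') : Lsp S s ≤ Lsp S s' := by
  intro x hx ε hε
  obtain ⟨C, hC⟩ := hx (s' - s + ε) (by linarith)
  refine ⟨C, ?_⟩
  filter_upwards [hC] with t ht
  convert ht using 4; ring

lemma Esp_inv (hS : IsFlow S) {l : ℝ} {x : X} (hx : x ∈ Esp S l) (u : ℝ) : S u x ∈ Esp S l := by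
  intro ε hε
  obtain ⟨C, hC⟩ := hx ε hε
  have hC0 : 0 ≤ C := by
    have := (norm_nonneg _).trans (hC 0)
    simpa using this
  refine ⟨C * Real.exp (l * u + ε * |u|), fun t => ?_⟩
  rw [← hS.add, mul_assoc, ← Real.exp_add]
  refine (hC _).trans (mul_le_mul_of_nonneg_left (Real.exp_le_exp.2 ?_) hC0)
  have := abs_add_le t u
  nlinarith

lemma Esp_unif [FiniteDimensional ℝ X] (l : ℝ) {ε : ℝ} (hε : 0 < ε) :
    ∃ C, 0 < C ∧ ∀ t, ∀ x ∈ Esp S l, ‖S t x‖ ≤ C * Real.exp (l * t + ε * |t|) * ‖x‖ := by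
  have : CompleteSpace (Esp S l) := FiniteDimensional.complete ℝ _
  obtain ⟨C, hC⟩ := banach_steinhaus
    (g := fun t : ℝ => Real.exp (-(l * t + ε * |t|)) • (S t).comp (Esp S l).subtypeL) (by
      intro x
      obtain ⟨C, hC⟩ := x.2 ε hε
      refine ⟨C, fun t => ?_⟩
      have : (Real.exp (-(l * t + ε * |t|)) • (S t).comp (Esp S l).subtypeL) x
        = Real.exp (-(l * t + ε * |t|)) • S t x := rfl
      rw [this, norm_smul, Real.norm_eq_abs, abs_of_pos (Real.exp_pos _), Real.exp_neg,
        inv_mul_le_iff₀ (Real.exp_pos _), mul_comm]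
      exact hC t)
  refine ⟨max C 1, by positivity, fun t x hx => ?_⟩
  have h1 := ContinuousLinearMap.le_of_opNorm_le _ (hC t) (⟨x, hx⟩ : Esp S l)
  have : (Real.exp (-(l * t + ε * |t|)) • (S t).comp (Esp S l).subtypeL) ⟨x, hx⟩
        = Real.exp (-(l * t + ε * |t|)) • S t x := rfl
  rw [this, norm_smul, Real.norm_eq_abs, abs_of_pos (Real.exp_pos _), Real.exp_neg,
        inv_mul_le_iff₀ (Real.exp_pos _)] at h1
  refine h1.trans ?_
  have h2 : ‖(⟨x, hx⟩ : Esp S l)‖ = ‖x‖ := rfl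
  rw [h2, mul_comm (max C 1), mul_assoc]
  gcongr
  exact le_max_left _ _

lemma Esp_inter_Lsp [FiniteDimensional ℝ X] (hS : IsFlow S) {m s : ℝ} (h : s < m) {x : X}
    (hx : x ∈ Esp S m) (hx' : x ∈ Lsp S s) : x = 0 := by
  set ε := (m - s) / 3 with hεd
  have hε : 0 < ε := by rw [hεd]; linarith
  obtain ⟨C, hC, hCC⟩ := Esp_unif (S := S) m hε
  obtain ⟨D, hD⟩ := hx' ε hε
  have h1 : ∀ᶠ t in atTop, ‖x‖ ≤ C * D * Real.exp (-(ε * t)) := by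
    filter_upwards [hD, eventually_ge_atTop (0 : ℝ)] with t ht ht0
    have := hCC (-t) (S t x) (Esp_inv hS hx t)
    rw [hS.neg_cancel, abs_neg, abs_of_nonneg ht0] at this
    calc _ ≤ _ := this
      _ ≤ C * Real.exp (m * -t + ε * t) * (D * Real.exp ((s + ε) * t)) := by gcongr
      _ = C * D * (Real.exp (m * -t + ε * t) * Real.exp ((s + ε) * t)) := by ring
      _ = _ := by rw [← Real.exp_add]; congr 2; rw [hεd]; ring
  have h2 : Tendsto (fun t : ℝ => C * D * Real.exp (-(ε * t))) atTop (𝓝 (C * D * 0)) := by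
    refine Tendsto.const_mul _ ?_
    exact Real.tendsto_exp_neg_atTop_nhds_zero.comp (tendsto_id.const_mul_atTop hε)
  rw [mul_zero] at h2
  have := ge_of_tendsto h2 h1
  exact norm_le_zero_iff.1 this

lemma Esp_zero_stable [FiniteDimensional ℝ X] (hS : IsFlow S) {x : X}
    (hx : x ∈ Esp S 0) (hx' : Tendsto (fun t => S t x) atTop (𝓝 0)) : x = 0 := by
  let W : Submodule ℝ X := Esp S 0 ⊓
    { carrier := {x | Tendsto (fun t => S t x) atTop (𝓝 0)}
      add_mem' := by
        intro a b ha hb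
        simpa using Tendsto.add ha hb
      zero_mem' := by simp
      smul_mem' := by
        intro c a ha
        simpa using Tendsto.const_smul ha c }
  have hW : ∀ y : W, Tendsto (fun t => S t y) atTop (𝓝 0) := fun y => y.2.2
  have hWE : ∀ y ∈ W, y ∈ Esp S 0 := fun y hy => hy.1
  have hWinv : ∀ u, ∀ y ∈ W, S u y ∈ W := by
    intro u y hy
    refine ⟨Esp_inv hS hy.1 u, ?_⟩
    have h1 : Tendsto (fun t => S (t + u) y) atTop (𝓝 0) :=
      (hW ⟨y, hy⟩).comp (tendsto_atTop_add_const_right _ u tendsto_id)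
    simpa [hS.add] using h1
  have hxW : x ∈ W := ⟨hx, hx'⟩
  clear_value W
  let b := Module.finBasis ℝ W
  obtain ⟨C, hC, hCC⟩ := b.exists_opNorm_le (F := X)
  have hev : ∀ᶠ t in atTop, ∀ i, ‖S t (b i)‖ ≤ 1 / (2 * C) := by
    rw [eventually_all]
    intro i
    have := (hW (b i)).norm
    rw [norm_zero] at this
    exact this.eventually_le_const (by positivity)
  obtain ⟨T, hT, hT0⟩ := (hev.and (eventually_gt_atTop (0 : ℝ))).exists
  have hn : ‖(S T).comp W.subtypeL‖ ≤ 1 / 2 := by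
    refine (hCC (M := 1 / (2 * C)) (by positivity) hT).trans (le_of_eq ?_)
    field_simp
  have hhalf : ∀ y ∈ W, ‖S T y‖ ≤ 1 / 2 * ‖y‖ := fun y hy =>
    ContinuousLinearMap.le_of_opNorm_le _ hn (⟨y, hy⟩ : W)
  have hpow : ∀ n : ℕ, ‖S (n * T) x‖ ≤ (1 / 2) ^ n * ‖x‖ := by
    intro n
    induction n with
    | zero => simp [hS.zero]
    | succ n ih =>
      have e : ((n + 1 : ℕ) : ℝ) * T = T + n * T := by push_cast; ring
      rw [e, hS.add]
      refine (hhalf _ (hWinv _ _ hxW)).trans ?_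
      rw [pow_succ]
      nlinarith
  have hl2 : 0 < Real.log 2 := Real.log_pos (by norm_num)
  obtain ⟨D, hD, hDD⟩ := Esp_unif (S := S) 0 (ε := Real.log 2 / (2 * T)) (by positivity)
  have hq : ∀ n : ℕ, ‖x‖ ≤ D * ‖x‖ * (Real.exp (Real.log 2 / 2) * (1 / 2)) ^ n := by
    intro n
    have h1 := hDD (-(n * T)) (S (n * T) x) (Esp_inv hS hx _)
    rw [hS.neg_cancel, abs_neg, abs_of_nonneg (by positivity : 0 ≤ n * T)] at h1
    have e : 0 * -(n * T) + Real.log 2 / (2 * T) * (n * T) = n * (Real.log 2 / 2) := by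
      field_simp; ring
    rw [e, Real.exp_nat_mul] at h1
    calc _ ≤ _ := h1
      _ ≤ D * Real.exp (Real.log 2 / 2) ^ n * ((1 / 2) ^ n * ‖x‖) := by
        gcongr; exact hpow n
      _ = _ := by rw [mul_pow]; ring
  have hq1 : Real.exp (Real.log 2 / 2) * (1 / 2) < 1 := by
    have : Real.exp (Real.log 2 / 2) < Real.exp (Real.log 2) := Real.exp_lt_exp.2 (by linarith)
    rw [Real.exp_log (by norm_num)] at this
    linarith
  have hlim := (tendsto_pow_atTop_nhds_zero_of_lt_one (by positivity) hq1).const_mul (D * ‖x‖)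
  rw [mul_zero] at hlim
  exact norm_le_zero_iff.1 (ge_of_tendsto' hlim hq)

lemma Esp_stable {l : ℝ} (hl : l < 0) {x : X} (hx : x ∈ Esp S l) :
    Tendsto (fun t => S t x) atTop (𝓝 0) := by
  obtain ⟨C, hC⟩ := hx (-l / 2) (by linarith)
  have h2 : Tendsto (fun t : ℝ => C * Real.exp (-(-l / 2 * t))) atTop (𝓝 (C * 0)) := by
    refine Tendsto.const_mul _ ?_
    exact Real.tendsto_exp_neg_atTop_nhds_zero.comp
      (tendsto_id.const_mul_atTop (by linarith : 0 < -l / 2))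
  rw [mul_zero] at h2
  refine squeeze_zero_norm' ?_ h2
  filter_upwards [eventually_ge_atTop (0 : ℝ)] with t ht
  have := hC t
  rw [abs_of_nonneg ht] at this
  convert this using 3; ring

lemma stable_Lsp {x : X} (hx : Tendsto (fun t => S t x) atTop (𝓝 0)) : x ∈ Lsp S 0 := by
  intro ε hε
  refine ⟨1, ?_⟩
  have := hx.norm
  rw [norm_zero] at this
  filter_upwards [this.eventually_le_const one_pos, eventually_ge_atTop (0 : ℝ)] with t h1 h2
  rw [one_mul]
  exact h1.trans (Real.one_le_exp (by positivity))

/-! ### Lyapunov exponents -/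

lemma lyap_le_iff (hS : IsFlow S) {x : X} (hx : x ≠ 0) (s : ℝ) :
    limsup (fun t : ℝ => Real.log ‖S t x‖ / t) atTop ≤ s ↔ x ∈ Lsp S s := by
  obtain ⟨c, hc, hb⟩ := hS.bdd
  have hx0 := norm_pos_iff.2 hx
  have hpos : ∀ t, 0 < ‖S t x‖ := fun t => norm_pos_iff.2 (hS.ne_zero t hx)
  have hup : ∀ t : ℝ, 1 ≤ t → Real.log ‖S t x‖ / t ≤ c + |Real.log ‖x‖| := by
    intro t ht
    have h1 := Real.log_le_log (hpos t) (hb t x)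
    rw [Real.log_mul (Real.exp_pos _).ne' hx0.ne', Real.log_exp, abs_of_nonneg (by linarith)] at h1
    rw [div_le_iff₀ (by linarith)]
    have := le_abs_self (Real.log ‖x‖)
    nlinarith [abs_nonneg (Real.log ‖x‖)]
  have hlo : ∀ t : ℝ, 1 ≤ t → -(c + |Real.log ‖x‖|) ≤ Real.log ‖S t x‖ / t := by
    intro t ht
    have h0 := hb (-t) (S t x)
    rw [hS.neg_cancel] at h0
    have h1 := Real.log_le_log hx0 h0
    rw [Real.log_mul (Real.exp_pos _).ne' (hpos t).ne', Real.log_exp, abs_neg,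
      abs_of_nonneg (by linarith)] at h1
    rw [le_div_iff₀ (by linarith)]
    have := neg_abs_le (Real.log ‖x‖)
    nlinarith [abs_nonneg (Real.log ‖x‖)]
  have hbd : IsBoundedUnder (· ≤ ·) atTop (fun t : ℝ => Real.log ‖S t x‖ / t) :=
    isBoundedUnder_of_eventually_le (a := c + |Real.log ‖x‖|)
      ((eventually_ge_atTop 1).mono hup)
  have hbd' : IsBoundedUnder (· ≥ ·) atTop (fun t : ℝ => Real.log ‖S t x‖ / t) :=
    isBoundedUnder_of_eventually_ge (a := -(c + |Real.log ‖x‖|))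
      ((eventually_ge_atTop 1).mono hlo)
  constructor
  · intro h ε hε
    refine ⟨1, ?_⟩
    have := eventually_lt_of_limsup_lt (lt_of_le_of_lt h (by linarith : s < s + ε)) hbd
    filter_upwards [this, eventually_gt_atTop (0 : ℝ)] with t h1 h2
    rw [div_lt_iff₀ h2, Real.log_lt_iff_lt_exp (hpos t)] at h1
    rw [one_mul]; exact h1.le
  · intro h
    refine le_of_forall_pos_le_add fun ε hε => ?_
    obtain ⟨C, hC⟩ := h (ε / 2) (by positivity)
    refine limsup_le_of_le hbd'.isCoboundedUnder_flip ?_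
    have hlim : Tendsto (fun t : ℝ => Real.log C / t) atTop (𝓝 0) :=
      tendsto_const_nhds.div_atTop tendsto_id
    filter_upwards [hC, eventually_gt_atTop (0 : ℝ),
      hlim.eventually_le_const (by positivity : 0 < ε / 2)] with t h1 h2 h3
    have hC0 : 0 < C := by
      have := (hpos t).trans_le h1
      exact (pos_iff_pos_of_mul_pos this).2 (Real.exp_pos _)
    have h4 := Real.log_le_log (hpos t) h1
    rw [Real.log_mul hC0.ne' (Real.exp_pos _).ne', Real.log_exp] at h4
    rw [div_le_iff₀ h2] at h3 ⊢
    nlinarith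

/-! ### adapted basis -/

variable [FiniteDimensional ℝ X] {ι : Type*} [Fintype ι] [DecidableEq ι]

lemma coord_Lsp (hS : IsFlow S) (b : Module.Basis ι ℝ X) (w : ι → ℝ) (hb : ∀ i, b i ∈ Esp S (w i))
    {s : ℝ} {x : X} (hx : x ∈ Lsp S s) (i : ι) (hi : s < w i) : b.repr x i = 0 := by
  by_contra hne
  obtain ⟨i₀, hi₀, hmax⟩ := Finset.exists_max_image
    (Finset.univ.filter fun i => s < w i ∧ b.repr x i ≠ 0) w ⟨i, by simp [hi, hne]⟩
  simp only [Finset.mem_filter, Finset.mem_univ, true_and] at hi₀ hmax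
  obtain ⟨hs0, hne0⟩ := hi₀
  set m := w i₀ with hm
  set F : Finset ℝ := insert s ((Finset.univ.filter fun j => w j < m).image w) with hF
  have hFne : F.Nonempty := ⟨s, by simp [hF]⟩
  set s' := F.max' hFne with hs'
  have hs'm : s' < m := by
    have := F.max'_mem hFne
    rw [← hs', hF, Finset.mem_insert, Finset.mem_image] at this
    rcases this with h | ⟨j, hj, hj'⟩
    · rw [h]; exact hs0
    · rw [← hj']; simpa using hj
  have hss' : s ≤ s' := F.le_max' s (by simp [hF])
  have hjs' : ∀ j, w j < m → w j ≤ s' := fun j hj =>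
    F.le_max' (w j) (by simp only [hF, Finset.mem_insert, Finset.mem_image]; right; exact ⟨j, by simp [hj], rfl⟩)
  set y := ∑ j ∈ Finset.univ.filter (fun j => w j = m), b.repr x j • b j with hy
  have hyE : y ∈ Esp S m := Submodule.sum_mem _ fun j hj => by
    have hj : w j = m := by simpa using hj
    exact Submodule.smul_mem _ _ (hj ▸ hb j)
  have hsplit : x = y + ∑ j ∈ Finset.univ.filter (fun j => ¬ w j = m), b.repr x j • b j := by
    rw [hy, Finset.sum_filter_add_sum_filter_not]
    exact (b.sum_repr x).symm
  have hyL : y ∈ Lsp S s' := by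
    rw [eq_sub_of_add_eq hsplit.symm]
    refine Submodule.sub_mem _ (Lsp_mono hss' hx) (Submodule.sum_mem _ fun j hj => ?_)
    have hj : w j ≠ m := by simpa using hj
    rcases lt_or_gt_of_ne hj with h | h
    · exact Submodule.smul_mem _ _ (Esp_le_Lsp (hjs' j h) (hb j))
    · have : b.repr x j = 0 := by
        by_contra hne'
        have := hmax j ⟨hs0.trans h, hne'⟩
        linarith
      rw [this, zero_smul]; exact Submodule.zero_mem _
  have hy0 := Esp_inter_Lsp hS hs'm hyE hyL
  rw [hy] at hy0
  have := linearIndependent_iff'.1 b.linearIndependent _ _ hy0 i₀ (by simp [hm])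
  exact hne0 this

lemma coord_Esp (hS : IsFlow S) (b : Module.Basis ι ℝ X) (w : ι → ℝ) (hb : ∀ i, b i ∈ Esp S (w i))
    {l : ℝ} {x : X} (hx : x ∈ Esp S l) (i : ι) (hi : w i ≠ l) : b.repr x i = 0 := by
  rcases lt_or_gt_of_ne hi with h | h
  · refine coord_Lsp hS.rev b (fun i => - w i) (fun i => ?_) (s := -l) ?_ i (by linarith)
    · rw [Esp_rev, neg_neg]; exact hb i
    · apply Esp_le_Lsp le_rfl
      rw [Esp_rev, neg_neg]; exact hx
  · exact coord_Lsp hS b w hb (Esp_le_Lsp le_rfl hx) i h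

lemma coord_stable (hS : IsFlow S) (b : Module.Basis ι ℝ X) (w : ι → ℝ)
    (hb : ∀ i, b i ∈ Esp S (w i)) {x : X} (hx : Tendsto (fun t => S t x) atTop (𝓝 0))
    (i : ι) (hi : 0 ≤ w i) : b.repr x i = 0 := by
  have hpos := coord_Lsp hS b w hb (stable_Lsp hx)
  rcases hi.lt_or_eq with h | h
  · exact hpos i h
  set y := ∑ j ∈ Finset.univ.filter (fun j => w j = 0), b.repr x j • b j with hy
  have hyE : y ∈ Esp S 0 := Submodule.sum_mem _ fun j hj => by
    have hj : w j = 0 := by simpa using hj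
    exact Submodule.smul_mem _ _ (hj ▸ hb j)
  have hsplit : x = y + ∑ j ∈ Finset.univ.filter (fun j => ¬ w j = 0), b.repr x j • b j := by
    rw [hy, Finset.sum_filter_add_sum_filter_not]
    exact (b.sum_repr x).symm
  have hyL : Tendsto (fun t => S t y) atTop (𝓝 0) := by
    rw [eq_sub_of_add_eq hsplit.symm]
    simp only [map_sub, map_sum, map_smul]
    rw [show (0 : X) = 0 - ∑ j ∈ Finset.univ.filter (fun j => ¬ w j = 0), (0 : X) by simp]
    refine hx.sub (tendsto_finsetSum _ fun j hj => ?_)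
    have hj : w j ≠ 0 := by simpa using hj
    rcases lt_or_gt_of_ne hj with h | h
    · simpa using (Esp_stable h (hb j)).const_smul (b.repr x j)
    · simp [hpos j h]
  have hy0 := Esp_zero_stable hS hyE hyL
  rw [hy] at hy0
  exact linearIndependent_iff'.1 b.linearIndependent _ _ hy0 i (by simp [h])

lemma coord_unstable (hS : IsFlow S) (b : Module.Basis ι ℝ X) (w : ι → ℝ)
    (hb : ∀ i, b i ∈ Esp S (w i)) {x : X} (hx : Tendsto (fun t => S t x) atBot (𝓝 0))
    (i : ι) (hi : w i ≤ 0) : b.repr x i = 0 := by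
  refine coord_stable hS.rev b (fun i => - w i) (fun i => ?_) ?_ i (by linarith)
  · rw [Esp_rev, neg_neg]; exact hb i
  · exact hx.comp tendsto_neg_atTop_atBot

/-- projection to weight `l` -/
def pr (b : Module.Basis ι ℝ X) (w : ι → ℝ) (l : ℝ) : X →L[ℝ] X :=
  LinearMap.toContinuousLinearMap
    (∑ i ∈ Finset.univ.filter (fun i => w i = l), (b.coord i).smulRight (b i))

lemma pr_apply (b : Module.Basis ι ℝ X) (w : ι → ℝ) (l : ℝ) (x : X) :
    pr b w l x = ∑ i ∈ Finset.univ.filter (fun i => w i = l), b.repr x i • b i := by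
  simp [pr]

lemma pr_mem (b : Module.Basis ι ℝ X) (w : ι → ℝ) (hb : ∀ i, b i ∈ Esp S (w i)) (l : ℝ) (x : X) :
    pr b w l x ∈ Esp S l := by
  rw [pr_apply]
  refine Submodule.sum_mem _ fun j hj => ?_
  have hj : w j = l := by simpa using hj
  exact Submodule.smul_mem _ _ (hj ▸ hb j)

lemma pr_self (hS : IsFlow S) (b : Module.Basis ι ℝ X) (w : ι → ℝ) (hb : ∀ i, b i ∈ Esp S (w i))
    {l : ℝ} {x : X} (hx : x ∈ Esp S l) : pr b w l x = x := by
  rw [pr_apply]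
  conv_rhs => rw [← b.sum_repr x]
  refine Finset.sum_subset (Finset.filter_subset _ _) fun i _ hi => ?_
  rw [coord_Esp hS b w hb hx i (by simpa using hi), zero_smul]

lemma pr_other (hS : IsFlow S) (b : Module.Basis ι ℝ X) (w : ι → ℝ) (hb : ∀ i, b i ∈ Esp S (w i))
    {l m : ℝ} (hlm : l ≠ m) {x : X} (hx : x ∈ Esp S m) : pr b w l x = 0 := by
  rw [pr_apply]
  refine Finset.sum_eq_zero fun i hi => ?_
  have hi : w i = l := by simpa using hi
  rw [coord_Esp hS b w hb hx i (by rw [hi]; exact hlm), zero_smul]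

lemma pr_comm (hS : IsFlow S) (b : Module.Basis ι ℝ X) (w : ι → ℝ) (hb : ∀ i, b i ∈ Esp S (w i))
    (l t : ℝ) (x : X) : pr b w l (S t x) = S t (pr b w l x) := by
  have : ((pr b w l).comp (S t)).toLinearMap = ((S t).comp (pr b w l)).toLinearMap := by
    refine b.ext fun i => ?_
    change pr b w l (S t (b i)) = S t (pr b w l (b i))
    by_cases h : w i = l
    · subst h
      rw [pr_self hS b w hb (hb i), pr_self hS b w hb (Esp_inv hS (hb i) t)]
    · rw [pr_other hS b w hb (Ne.symm h) (hb i),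
        pr_other hS b w hb (Ne.symm h) (Esp_inv hS (hb i) t), map_zero]
  exact LinearMap.congr_fun this x

lemma pr_repr (b : Module.Basis ι ℝ X) (w : ι → ℝ) (l : ℝ) (x : X) (i : ι) :
    b.repr (pr b w l x) i = if w i = l then b.repr x i else 0 := by
  rw [pr_apply]
  simp only [map_sum, Finsupp.finsetSum_apply, map_smul, Module.Basis.repr_self, Finsupp.smul_apply,
    Finsupp.single_apply, smul_eq_mul, mul_ite, mul_one, mul_zero]
  simp [Finset.sum_ite_eq']

lemma IsFlow.lip' (hS : IsFlow S) (T : ℝ) :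
    ∃ C, 0 ≤ C ∧ ∀ t x, |t| ≤ T → ‖S t x - x‖ ≤ C * |t| * ‖x‖ := by
  obtain ⟨C, hC, h⟩ := hS.lip
  obtain ⟨c, hc, hb⟩ := hS.bdd
  refine ⟨C + (Real.exp (c * |T|) + 1), by positivity, fun t x ht => ?_⟩
  rcases le_total |t| 1 with h1 | h1
  · have h2 := ContinuousLinearMap.le_of_opNorm_le _ (h t h1) x
    have : (S t - 1) x = S t x - x := by simp
    rw [this] at h2
    refine h2.trans ?_
    gcongr
    have := Real.exp_pos (c * |T|)
    linarith
  · calc _ ≤ ‖S t x‖ + ‖x‖ := norm_sub_le _ _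
      _ ≤ Real.exp (c * |T|) * ‖x‖ + ‖x‖ := by
        gcongr
        exact (hb t x).trans (mul_le_mul_of_nonneg_right (Real.exp_le_exp.2
          (mul_le_mul_of_nonneg_left (ht.trans (le_abs_self T)) hc)) (norm_nonneg _))
      _ = (0 + (Real.exp (c * |T|) + 1)) * 1 * ‖x‖ := by ring
      _ ≤ _ := by gcongr

theorem weight_conj (hS : IsFlow S) (b : Module.Basis ι ℝ X) (w : ι → ℝ)
    (hb : ∀ i, b i ∈ Esp S (w i)) (l : ℝ) (hl : l ≠ 0) :
    ∃ f g : X → X, (∀ x, f x ∈ Esp S l) ∧ (∀ x, g x ∈ Esp S l) ∧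
      (∀ x ∈ Esp S l, g (f x) = x) ∧ (∀ x ∈ Esp S l, f (g x) = x) ∧
      (∀ x, f (pr b w l x) = f x) ∧
      (∀ t x, f (S t x) = Real.exp (l * t) • f x) ∧ f 0 = 0 ∧ g 0 = 0 ∧
      (∀ γ : ℝ, 0 < γ → γ < 1 → HB γ f) ∧ (∀ γ : ℝ, 0 < γ → γ < 1 → HB γ g) := by
  let E := Esp S l
  let S' : ℝ → E →L[ℝ] E := fun t =>
    Real.exp (-t) • ((S (t / l)).comp E.subtypeL).codRestrict E (fun x => Esp_inv hS x.2 _)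
  have hS'c : ∀ t (x : E), ((S' t x : E) : X) = Real.exp (-t) • S (t / l) x := fun t x => rfl
  have hG : IsGrp S' := by
    refine ⟨fun x => ?_, fun s t x => ?_, ?_⟩
    · apply Subtype.ext; rw [hS'c]; simp [hS.zero]
    · apply Subtype.ext; rw [hS'c, hS'c, hS'c, map_smul, smul_smul, ← Real.exp_add, add_div, hS.add]
      congr 2; ring
    · obtain ⟨C, hC, h⟩ := hS.lip' (1 / |l|)
      refine ⟨Real.exp 1 * (C / |l|) + 2, by positivity, fun t ht => ?_⟩
      refine ContinuousLinearMap.opNorm_le_bound _ (by positivity) fun x => ?_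
      have e : (((S' t - 1) x : E) : X) = Real.exp (-t) • (S (t / l) x - x) + (Real.exp (-t) - 1) • (x : X) := by
        rw [sub_apply, AddSubgroupClass.coe_sub, hS'c, smul_sub, sub_smul]
        simp
      rw [Submodule.coe_norm, e]
      have h1 := h (t / l) x (by rw [abs_div]; gcongr)
      have h2 : |Real.exp (-t) - 1| ≤ 2 * |t| := by
        have := Real.abs_exp_sub_one_le (x := -t) (by simpa using ht)
        simpa using this
      have h3 : Real.exp (-t) ≤ Real.exp 1 := Real.exp_le_exp.2 (by have := neg_abs_le t; linarith)
      calc _ ≤ ‖Real.exp (-t) • (S (t / l) x - x)‖ + ‖(Real.exp (-t) - 1) • (x : X)‖ := norm_add_le _ _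
        _ ≤ Real.exp 1 * (C * |t / l| * ‖(x : X)‖) + 2 * |t| * ‖(x : X)‖ := by
          rw [norm_smul, norm_smul, Real.norm_eq_abs, Real.norm_eq_abs, abs_of_pos (Real.exp_pos _)]
          gcongr
        _ = (Real.exp 1 * (C / |l|) + 2) * |t| * ‖x‖ := by
          rw [abs_div, Submodule.coe_norm]; ring
  have hSub : SubExp S' := by
    intro ε hε
    obtain ⟨C, hC, h⟩ := Esp_unif (S := S) l (ε := ε * |l|) (by positivity)
    refine ⟨C, hC, fun t x => ?_⟩
    rw [Submodule.coe_norm, hS'c, norm_smul, Real.norm_eq_abs, abs_of_pos (Real.exp_pos _)]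
    calc _ ≤ Real.exp (-t) * (C * Real.exp (l * (t / l) + ε * |l| * |t / l|) * ‖(x : X)‖) := by
          gcongr; exact h _ _ x.2
      _ = C * (Real.exp (-t) * Real.exp (l * (t / l) + ε * |l| * |t / l|)) * ‖(x : X)‖ := by ring
      _ = _ := by
        rw [← Real.exp_add, Submodule.coe_norm]
        congr 3
        rw [abs_div]
        have : |l| ≠ 0 := abs_ne_zero.2 hl
        field_simp
        ring
  obtain ⟨f, g, hgf, hfg, hconj, hf0, hg0, hfH, hgH⟩ := conj_exists hG hSub
  let P : X →L[ℝ] E := (pr b w l).codRestrict E (fun x => pr_mem b w hb l x)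
  have hPc : ∀ x, ((P x : E) : X) = pr b w l x := fun x => rfl
  have hPE : ∀ x : E, P x = x := fun x => Subtype.ext (pr_self hS b w hb x.2)
  have hPE' : ∀ x (hx : x ∈ Esp S l), P x = ⟨x, hx⟩ := fun x hx => hPE ⟨x, hx⟩
  refine ⟨fun x => f (P x), fun x => g (P x), fun x => (f (P x)).2, fun x => (g (P x)).2, ?_, ?_, ?_, ?_,
    by simp [hf0], by simp [hg0], ?_, ?_⟩
  · intro x hx
    simp only [hPE]
    rw [hgf, hPE' x hx]
  · intro x hx
    simp only [hPE]
    rw [hfg, hPE' x hx]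
  · intro x
    simp only
    rw [← hPc, hPE]
  · intro t x
    have : P (S t x) = Real.exp (l * t) • S' (l * t) (P x) := by
      apply Subtype.ext
      rw [hPc, pr_comm hS b w hb, Submodule.coe_smul, hS'c, smul_smul, ← Real.exp_add,
        mul_div_cancel_left₀ _ hl, hPc]
      simp
    simp only
    rw [this, hconj]
    rfl
  · intro γ h0 h1
    exact HB.clm_comp E.subtypeL h0.le (HB.comp_clm P h0.le (hfH γ h0 h1))
  · intro γ h0 h1
    exact HB.clm_comp E.subtypeL h0.le (HB.comp_clm P h0.le (hgH γ h0 h1))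

end Lsec

open Filter Topology

section Flsec
variable {X : Type*} [NormedAddCommGroup X] [NormedSpace ℝ X] [CompleteSpace X]

/-- the flow of a bounded operator -/
def Fl (a : X →L[ℝ] X) (t : ℝ) : X →L[ℝ] X := NormedSpace.exp (t • a)

lemma Fl_hasSum (a : X →L[ℝ] X) (t : ℝ) (x : X) :
    HasSum (fun n : ℕ => (((n.factorial : ℝ))⁻¹ * t ^ n) • (a ^ n) x) (Fl a t x) := by
  have h := NormedSpace.exp_series_hasSum_exp' (𝕂 := ℝ) (t • a)
  have h2 := h.mapL (ContinuousLinearMap.apply ℝ X x)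
  have e : ∀ n : ℕ, (ContinuousLinearMap.apply ℝ X x) (((n.factorial : ℝ))⁻¹ • (t • a) ^ n)
      = (((n.factorial : ℝ))⁻¹ * t ^ n) • (a ^ n) x := by
    intro n
    rw [smul_pow, smul_smul]; rfl
  simp only [e] at h2
  exact h2

lemma norm_pow_apply_le (a : X →L[ℝ] X) (n : ℕ) (x : X) : ‖(a ^ n) x‖ ≤ ‖a‖ ^ n * ‖x‖ := by
  induction n with
  | zero => simp
  | succ n ih =>
    rw [pow_succ', pow_succ', mul_apply_eq_comp, mul_assoc]
    exact (a.le_opNorm _).trans (by gcongr)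

lemma Fl_isFlow (a : X →L[ℝ] X) : IsFlow (Fl a) where
  zero x := by simp [Fl]
  add s t x := by
    let _ : NormedAlgebra ℚ (X →L[ℝ] X) := NormedAlgebra.restrictScalars ℚ ℝ _
    rw [Fl, add_smul, NormedSpace.exp_add_of_commute]
    · rfl
    · exact ((Commute.refl a).smul_left s).smul_right t
  lip := by
    have hs : HasSum (fun n : ℕ => ‖a‖ ^ (n + 1) / ((n + 1).factorial : ℝ)) (Real.exp ‖a‖ - 1) := by
      have := NormedSpace.expSeries_div_hasSum_exp (𝔸 := ℝ) ‖a‖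
      rw [← Real.exp_eq_exp_ℝ] at this
      have h2 := (hasSum_nat_add_iff' 1).2 this
      simpa using h2
    refine ⟨Real.exp ‖a‖ - 1, by linarith [Real.add_one_le_exp ‖a‖, norm_nonneg a], fun t ht => ?_⟩
    refine ContinuousLinearMap.opNorm_le_bound _ (mul_nonneg (by linarith [Real.add_one_le_exp ‖a‖, norm_nonneg a]) (abs_nonneg _)) fun x => ?_
    have h1 := (hasSum_nat_add_iff' 1).2 (Fl_hasSum a t x)
    have e : Fl a t x - ∑ i ∈ Finset.range 1, (((i.factorial : ℝ))⁻¹ * t ^ i) • (a ^ i) x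
        = (Fl a t - 1) x := by simp
    rw [e] at h1
    refine h1.norm_le_of_bounded ((hs.mul_right |t|).mul_right ‖x‖) fun n => ?_
    rw [norm_smul, norm_mul, norm_inv, norm_pow, Real.norm_eq_abs, Real.norm_eq_abs, Nat.abs_cast]
    have h2 : |t| ^ (n + 1) ≤ |t| := by
      simpa using pow_le_pow_of_le_one (abs_nonneg t) ht (by omega : 1 ≤ n + 1)
    calc _ ≤ ((n + 1).factorial : ℝ)⁻¹ * |t| * (‖a‖ ^ (n + 1) * ‖x‖) := by
          gcongr; exact norm_pow_apply_le a _ x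
      _ = _ := by ring
  bdd := by
    refine ⟨‖a‖, norm_nonneg _, fun t x => ?_⟩
    have hs := NormedSpace.expSeries_div_hasSum_exp (𝔸 := ℝ) (‖a‖ * |t|)
    rw [← Real.exp_eq_exp_ℝ] at hs
    refine (Fl_hasSum a t x).norm_le_of_bounded (hs.mul_right ‖x‖) fun n => ?_
    rw [norm_smul, norm_mul, norm_inv, norm_pow, Real.norm_eq_abs, Real.norm_eq_abs, Nat.abs_cast]
    calc _ ≤ (n.factorial : ℝ)⁻¹ * |t| ^ n * (‖a‖ ^ n * ‖x‖) := by
          gcongr; exact norm_pow_apply_le a _ x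
      _ = _ := by rw [mul_pow]; ring

variable {Y : Type*} [NormedAddCommGroup Y] [NormedSpace ℝ Y] [CompleteSpace Y]

lemma Fl_intertwine (a : X →L[ℝ] X) (b : Y →L[ℝ] Y) (f : X →L[ℝ] Y) (h : ∀ x, f (a x) = b (f x))
    (t : ℝ) (x : X) : f (Fl a t x) = Fl b t (f x) := by
  have hn : ∀ n : ℕ, f ((a ^ n) x) = (b ^ n) (f x) := by
    intro n
    induction n with
    | zero => simp
    | succ n ih => rw [pow_succ', pow_succ', mul_apply_eq_comp, h, ih]; rfl
  have h1 := (Fl_hasSum a t x).mapL f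
  have h2 := Fl_hasSum b t (f x)
  refine h1.unique ?_
  convert h2 using 2 with n
  rw [map_smul, hn]

lemma Fl_smul (a : X →L[ℝ] X) (c t : ℝ) : Fl (c • a) t = Fl a (c * t) := by
  simp [Fl, smul_smul, mul_comm]

end Flsec

section cplx
variable {X V : Type*} [NormedAddCommGroup X] [NormedSpace ℝ X] [CompleteSpace X]
  [NormedAddCommGroup V] [NormedSpace ℂ V] [CompleteSpace V]

lemma cexp_intertwine (a : X →L[ℝ] X) (m : V →L[ℂ] V) (f : V →L[ℝ] X) (h : ∀ v, f (m v) = a (f v))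
    (t : ℝ) (v : V) : f (NormedSpace.exp ((t : ℂ) • m) v) = Fl a t (f v) := by
  have hn : ∀ n : ℕ, f ((m ^ n) v) = (a ^ n) (f v) := by
    intro n
    induction n with
    | zero => simp
    | succ n ih => rw [pow_succ', pow_succ', mul_apply_eq_comp, h, ih]; rfl
  have h1 := ((NormedSpace.exp_series_hasSum_exp' (𝕂 := ℂ) ((t : ℂ) • m)).mapL
    (ContinuousLinearMap.apply ℂ V v)).mapL f
  have h2 := Fl_hasSum a t (f v)
  refine h1.unique ?_
  convert h2 using 2 with n
  have : (ContinuousLinearMap.apply ℂ V v) (((n.factorial : ℂ))⁻¹ • ((t : ℂ) • m) ^ n)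
    = ((n.factorial : ℝ)⁻¹ * t ^ n) • (m ^ n) v := by
    rw [← Complex.coe_smul, smul_pow, smul_smul]
    rw [Complex.ofReal_mul, Complex.ofReal_inv, Complex.ofReal_pow, Complex.ofReal_natCast]
    rfl
  rw [this, map_smul, hn]

lemma cexp_growth (m : V →L[ℂ] V) (μ : ℂ) (k : ℕ) (v : V) (hv : ((m - μ • 1) ^ k) v = 0) (ε : ℝ) (hε : 0 < ε) :
    ∃ C, ∀ t : ℝ, ‖NormedSpace.exp ((t : ℂ) • m) v‖ ≤ C * Real.exp (μ.re * t + ε * |t|) := by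
  set N := m - μ • (1 : V →L[ℂ] V) with hN
  refine ⟨∑ i ∈ Finset.range k, (ε ^ i)⁻¹ * ‖(N ^ i) v‖, fun t => ?_⟩
  have e1 : NormedSpace.exp ((t : ℂ) • m) v = Complex.exp (t * μ) • NormedSpace.exp ((t : ℂ) • N) v := by
    let _ : NormedAlgebra ℚ (V →L[ℂ] V) := NormedAlgebra.restrictScalars ℚ ℂ _
    have : (t : ℂ) • m = algebraMap ℂ (V →L[ℂ] V) (t * μ) + (t : ℂ) • N := by
      rw [hN, smul_sub, Algebra.algebraMap_eq_smul_one, smul_smul]; abel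
    rw [this, NormedSpace.exp_add_of_commute (Algebra.commutes _ _),
      ← NormedSpace.algebraMap_exp_comm, ← Complex.exp_eq_exp_ℂ]
    rw [Algebra.algebraMap_eq_smul_one]
    simp
  have e2 : NormedSpace.exp ((t : ℂ) • N) v
      = ∑ i ∈ Finset.range k, ((i.factorial : ℂ)⁻¹ * t ^ i) • (N ^ i) v := by
    have h1 := (NormedSpace.exp_series_hasSum_exp' (𝕂 := ℂ) ((t : ℂ) • N)).mapL
      (ContinuousLinearMap.apply ℂ V v)
    refine h1.unique ?_
    have : ∀ n : ℕ, (ContinuousLinearMap.apply ℂ V v) (((n.factorial : ℂ))⁻¹ • ((t : ℂ) • N) ^ n)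
      = ((n.factorial : ℂ)⁻¹ * t ^ n) • (N ^ n) v := by
      intro n
      rw [smul_pow, smul_smul]
      rfl
    simp only [this]
    refine hasSum_sum_of_ne_finset_zero fun n hn => ?_
    have hn : k ≤ n := by simpa using hn
    obtain ⟨j, rfl⟩ := Nat.exists_eq_add_of_le hn
    rw [add_comm k j, pow_add, pow_add, mul_apply_eq_comp, hv, map_zero, smul_zero]
  have e3 : ‖Complex.exp (t * μ)‖ = Real.exp (μ.re * t) := by
    rw [Complex.norm_exp]; congr 1; simp [mul_comm]
  rw [e1, norm_smul, e3, e2, Real.exp_add, mul_left_comm]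
  refine mul_le_mul_of_nonneg_left ?_ (Real.exp_pos _).le
  rw [Finset.sum_mul]
  refine (norm_sum_le _ _).trans (Finset.sum_le_sum fun i _ => ?_)
  have h3 := Real.pow_div_factorial_le_exp (ε * |t|) (by positivity) i
  have h4 : ‖((i.factorial : ℂ)⁻¹ * (t : ℂ) ^ i)‖ = (ε ^ i)⁻¹ * ((ε * |t|) ^ i / i.factorial) := by
    rw [norm_mul, norm_inv, norm_pow, Complex.norm_natCast, Complex.norm_real, Real.norm_eq_abs, mul_pow]
    field_simp
  rw [norm_smul, h4, mul_right_comm]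
  gcongr
end cplx

open Filter Topology

section span
variable {d : ℕ}

/-- operator of a matrix -/
def opA (A : Matrix (Fin d) (Fin d) ℝ) : Euc d →L[ℝ] Euc d := Matrix.toEuclideanCLM (𝕜 := ℝ) A

/-- the flow of a matrix -/
def SA (A : Matrix (Fin d) (Fin d) ℝ) : ℝ → Euc d →L[ℝ] Euc d := Fl (opA A)

lemma opA_apply (A : Matrix (Fin d) (Fin d) ℝ) (x : Euc d) : opA A x = Matrix.toEuclideanLin A x := rfl

lemma linFlow_eq (A : Matrix (Fin d) (Fin d) ℝ) (t : ℝ) (x : Euc d) : linFlow A t x = SA A t x := by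
  have key : Matrix.toEuclideanCLM (𝕜 := ℝ) (NormedSpace.exp (t • A)) =
      NormedSpace.exp (t • Matrix.toEuclideanCLM (𝕜 := ℝ) A) := by
    rw [NormedSpace.exp_eq_tsum ℝ, NormedSpace.exp_eq_tsum ℝ]
    let e : Matrix (Fin d) (Fin d) ℝ ≃L[ℝ] (Euc d →L[ℝ] Euc d) :=
      LinearEquiv.toContinuousLinearEquiv (Matrix.toEuclideanCLM (n := Fin d) (𝕜 := ℝ)).toAlgEquiv.toLinearEquiv
    have he : ∀ M, Matrix.toEuclideanCLM (𝕜 := ℝ) M = e M := fun M => rfl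
    simp only [he]
    rw [e.map_tsum]
    congr 1
    ext n : 1
    rw [map_smul]
    congr 1
    rw [← he, map_pow, map_smul, ← he]
  have := congrArg (fun L : Euc d →L[ℝ] Euc d => L x) key
  exact this

lemma SA_flow (A : Matrix (Fin d) (Fin d) ℝ) : IsFlow (SA A) := Fl_isFlow _

/-- real part -/
def reL (d : ℕ) : EuclideanSpace ℂ (Fin d) →L[ℝ] Euc d :=
  LinearMap.toContinuousLinearMap
    { toFun := fun v => WithLp.toLp 2 (fun i => (v i).re)
      map_add' := fun v w => by ext i; simp
      map_smul' := fun c v => by ext i; simp }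

lemma reL_apply (v : EuclideanSpace ℂ (Fin d)) (i : Fin d) : reL d v i = (v i).re := rfl

lemma span_Esp (A : Matrix (Fin d) (Fin d) ℝ) : ⨆ l, Esp (SA A) l = ⊤ := by
  let m := Matrix.toEuclideanCLM (𝕜 := ℂ) (A.map Complex.ofReal)
  have hm : ∀ v, reL d (m v) = opA A (reL d v) := by
    intro v
    ext i
    rw [reL_apply, opA_apply]
    change ((A.map Complex.ofReal).mulVec (WithLp.ofLp v) i).re = A.mulVec (WithLp.ofLp (reL d v)) i
    simp only [Matrix.mulVec, dotProduct, Matrix.map_apply, Complex.re_sum, Complex.re_ofReal_mul]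
    rfl
  have key : ∀ v : EuclideanSpace ℂ (Fin d), reL d v ∈ ⨆ l, Esp (SA A) l := by
    intro v
    have hv : v ∈ ⨆ μ, Module.End.maxGenEigenspace (m.toLinearMap : Module.End ℂ _) μ := by
      rw [Module.End.iSup_maxGenEigenspace_eq_top]; trivial
    refine Submodule.iSup_induction _ (motive := fun v => reL d v ∈ ⨆ l, Esp (SA A) l) hv ?_ ?_ ?_
    · intro μ x hx
      rw [Module.End.mem_maxGenEigenspace] at hx
      obtain ⟨k, hk⟩ := hx
      refine Submodule.mem_iSup_of_mem μ.re ?_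
      intro ε hε
      have hk' : ((m - μ • 1) ^ k) x = 0 := by
        rw [← hk]
        have : ((m - μ • (1 : EuclideanSpace ℂ (Fin d) →L[ℂ] _)) ^ k).toLinearMap
          = ((m.toLinearMap : Module.End ℂ _) - μ • (1 : Module.End ℂ _)) ^ k := by
          rw [ContinuousLinearMap.toLinearMap_pow]; rfl
        rw [← this]; rfl
      obtain ⟨C, hC⟩ := cexp_growth m μ k x hk' ε hε
      refine ⟨‖reL d‖ * C, fun t => ?_⟩
      have := cexp_intertwine (opA A) m (reL d) hm t x
      rw [SA, ← this, mul_assoc]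
      refine ((reL d).le_opNorm _).trans ?_
      gcongr
      exact hC t
    · simp
    · intro x y hx hy
      rw [map_add]; exact Submodule.add_mem _ hx hy
  rw [eq_top_iff]
  intro x _
  have := key (WithLp.toLp 2 fun i => (x i : ℂ))
  convert this
  ext i
  simp [reL_apply]

lemma adapted_basis (A : Matrix (Fin d) (Fin d) ℝ) :
    ∃ (ι : Type) (_ : Fintype ι) (_ : DecidableEq ι) (b : Module.Basis ι ℝ (Euc d)) (w : ι → ℝ),
      ∀ i, b i ∈ Esp (SA A) (w i) := by
  classical
  let s : Set (Euc d) := ⋃ l, (Esp (SA A) l : Set (Euc d))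
  have hs : ⊤ ≤ Submodule.span ℝ s := by
    rw [Submodule.span_iUnion]
    simp only [Submodule.span_eq]
    rw [span_Esp]
  let b := Module.Basis.ofSpan hs
  have hb := Module.Basis.ofSpan_subset hs
  have hw : ∀ i, ∃ l, b i ∈ Esp (SA A) l := fun i => Set.mem_iUnion.1 (hb ⟨i, rfl⟩)
  choose w hw using hw
  exact ⟨_, FiniteDimensional.fintypeBasisIndex b, Classical.decEq _, b, w, hw⟩
end span

open Filter Topology

section spaces
variable {d : ℕ} (A : Matrix (Fin d) (Fin d) ℝ)

lemma mem_stableSet (x : Euc d) : x ∈ stableSet A ↔ Tendsto (fun t => SA A t x) atTop (𝓝 0) := by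
  simp only [stableSet, Set.mem_ofPred_eq, linFlow_eq]

lemma mem_unstableSet (x : Euc d) : x ∈ unstableSet A ↔ Tendsto (fun t => SA A t x) atBot (𝓝 0) := by
  simp only [unstableSet, Set.mem_ofPred_eq, linFlow_eq]

lemma centralSet_eq : centralSet A = (Esp (SA A) 0 : Set (Euc d)) := by
  ext x
  simp only [centralSet, Set.mem_ofPred_eq, linFlow_eq, SetLike.mem_coe, mem_Esp]
  constructor
  · intro h ε hε
    have h1 := h ε hε
    rw [tendsto_sup] at h1
    obtain ⟨c, hc, hb⟩ := (SA_flow A).bdd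
    have hn : ∀ t : ℝ, ‖Real.exp (-(ε * |t|)) • SA A t x‖ ≤ 1 →
        ‖SA A t x‖ ≤ 1 * Real.exp (0 * t + ε * |t|) := by
      intro t ht
      rw [norm_smul, Real.norm_eq_abs, abs_of_pos (Real.exp_pos _), Real.exp_neg,
        inv_mul_le_iff₀ (Real.exp_pos _)] at ht
      simpa using ht
    have e1 := h1.1.norm
    have e2 := h1.2.norm
    rw [norm_zero] at e1 e2
    obtain ⟨T1, hT1⟩ := eventually_atBot.1 (e1.eventually_le_const one_pos)
    obtain ⟨T2, hT2⟩ := eventually_atTop.1 (e2.eventually_le_const one_pos)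
    set T := max |T1| |T2| with hT
    refine ⟨1 + Real.exp (c * T) * ‖x‖, fun t => ?_⟩
    have hp : 0 ≤ Real.exp (c * T) * ‖x‖ := by positivity
    have hp1 : 1 ≤ Real.exp (0 * t + ε * |t|) := Real.one_le_exp (by rw [zero_mul, zero_add]; positivity)
    by_cases h3 : t ≤ T1
    · refine (hn t (hT1 t h3)).trans ?_
      gcongr; linarith
    by_cases h4 : T2 ≤ t
    · refine (hn t (hT2 t h4)).trans ?_
      gcongr; linarith
    have h5 : |t| ≤ T := by
      push Not at h3 h4
      rw [abs_le]
      have a1 := neg_abs_le T1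
      have a2 := le_abs_self T2
      have a3 := le_max_left |T1| |T2|
      have a4 := le_max_right |T1| |T2|
      constructor <;> linarith
    calc _ ≤ _ := hb t x
      _ ≤ Real.exp (c * T) * ‖x‖ := by
        exact mul_le_mul_of_nonneg_right (Real.exp_le_exp.2
          (mul_le_mul_of_nonneg_left h5 hc)) (norm_nonneg _)
      _ ≤ _ := by nlinarith
  · intro h ε hε
    obtain ⟨C, hC⟩ := h (ε / 2) (by positivity)
    have habs : Tendsto (fun t : ℝ => |t|) (atBot ⊔ atTop) atTop :=
      tendsto_sup.2 ⟨tendsto_abs_atBot_atTop, tendsto_abs_atTop_atTop⟩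
    have h2 : Tendsto (fun t : ℝ => C * Real.exp (-(ε / 2 * |t|))) (atBot ⊔ atTop) (𝓝 (C * 0)) := by
      refine Tendsto.const_mul _ ?_
      exact Real.tendsto_exp_neg_atTop_nhds_zero.comp
        (habs.const_mul_atTop (by positivity : 0 < ε / 2))
    rw [mul_zero] at h2
    refine squeeze_zero_norm (fun t => ?_) h2
    rw [norm_smul, Real.norm_eq_abs, abs_of_pos (Real.exp_pos _)]
    calc _ ≤ Real.exp (-(ε * |t|)) * (C * Real.exp (0 * t + ε / 2 * |t|)) := by
          gcongr; exact hC t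
      _ = C * (Real.exp (-(ε * |t|)) * Real.exp (0 * t + ε / 2 * |t|)) := by ring
      _ = _ := by rw [← Real.exp_add]; congr 2; ring

lemma XC_eq : XC A = Esp (SA A) 0 := by
  rw [XC, centralSet_eq, Submodule.span_eq]

variable {A} {ι : Type} [Fintype ι] [DecidableEq ι] (b : Module.Basis ι ℝ (Euc d)) (w : ι → ℝ)

lemma mem_spanP (P : ι → Prop) (x : Euc d) :
    x ∈ Submodule.span ℝ (b '' {i | P i}) ↔ ∀ i, ¬ P i → b.repr x i = 0 := by
  rw [b.mem_span_image]
  constructor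
  · intro h i hi
    by_contra hne
    exact hi (h (by simpa using hne))
  · intro h i hi
    by_contra hne
    have : b.repr x i ≠ 0 := by simpa using hi
    exact this (h i hne)

lemma finrank_spanP (P : ι → Prop) [DecidablePred P] :
    Module.finrank ℝ (Submodule.span ℝ (b '' {i | P i})) = Fintype.card {i // P i} := by
  have h : b '' {i | P i} = Set.range (fun i : {i // P i} => b i) := by
    ext x; simp
  rw [h]
  exact finrank_span_eq_card (b.linearIndependent.comp _ Subtype.val_injective)

lemma XC_span (hb : ∀ i, b i ∈ Esp (SA A) (w i)) : XC A = Submodule.span ℝ (b '' {i | w i = 0}) := by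
  rw [XC_eq]
  apply le_antisymm
  · intro x hx
    rw [mem_spanP]
    exact fun i hi => coord_Esp (SA_flow A) b w hb hx i hi
  · rw [Submodule.span_le]
    rintro _ ⟨i, hi, rfl⟩
    have hi : w i = 0 := hi
    exact hi ▸ hb i

lemma XH_span (hb : ∀ i, b i ∈ Esp (SA A) (w i)) : XH A = Submodule.span ℝ (b '' {i | w i ≠ 0}) := by
  apply le_antisymm
  · refine sup_le ?_ ?_
    · rw [XS, Submodule.span_le]
      intro x hx
      rw [mem_stableSet] at hx
      rw [SetLike.mem_coe, mem_spanP]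
      intro i hi
      exact coord_stable (SA_flow A) b w hb hx i (not_ne_iff.1 hi).ge
    · rw [XU, Submodule.span_le]
      intro x hx
      rw [mem_unstableSet] at hx
      rw [SetLike.mem_coe, mem_spanP]
      intro i hi
      exact coord_unstable (SA_flow A) b w hb hx i (not_ne_iff.1 hi).le
  · rw [Submodule.span_le]
    rintro _ ⟨i, hi, rfl⟩
    rcases lt_or_gt_of_ne hi with h | h
    · refine (le_sup_left : XS A ≤ XH A) (Submodule.subset_span ?_)
      rw [mem_stableSet]
      exact Esp_stable h (hb i)
    · refine (le_sup_right : XU A ≤ XH A) (Submodule.subset_span ?_)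
      rw [mem_unstableSet]
      have h1 : b i ∈ Esp (fun t => SA A (-t)) (-w i) := by rw [Esp_rev, neg_neg]; exact hb i
      have h2 := (Esp_stable (by linarith) h1).comp tendsto_neg_atBot_atTop
      simpa [Function.comp_def] using h2

lemma dimHyp_eq (hb : ∀ i, b i ∈ Esp (SA A) (w i)) : dimHyp A = Fintype.card {i // w i ≠ 0} := by
  rw [dimHyp, XH_span b w hb, finrank_spanP]

lemma dim_add' (hb : ∀ i, b i ∈ Esp (SA A) (w i)) : dimHyp A + Module.finrank ℝ (XC A) = d := by
  rw [dimHyp_eq b w hb, XC_span b w hb, finrank_spanP, add_comm]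
  have h1 : Fintype.card {i // w i ≠ 0} = _ := Fintype.card_subtype_compl (fun i => w i = 0)
  have h2 := Module.finrank_eq_card_basis b
  have h3 := Fintype.card_subtype_le (fun i => w i = 0)
  rw [finrank_euclideanSpace_fin] at h2
  omega

lemma dim_add : dimHyp A + Module.finrank ℝ (XC A) = d := by
  obtain ⟨ι, _, _, b, w, hb⟩ := adapted_basis A
  exact dim_add' b w hb

lemma ellIn_eq (hb : ∀ i, b i ∈ Esp (SA A) (w i)) (s : ℝ) : ellIn A (XH A) s = Fintype.card {i // w i ≠ 0 ∧ w i ≤ s} := by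
  have h : Submodule.span ℝ (lyapSetIn A (XH A) s) =
      Submodule.span ℝ (b '' {i | w i ≠ 0 ∧ w i ≤ s}) := by
    have h1 : lyapSetIn A (XH A) s = (XH A ⊓ Lsp (SA A) s : Submodule ℝ (Euc d)) := by
      ext x
      simp only [lyapSetIn, Set.mem_ofPred_eq, SetLike.mem_coe, Submodule.mem_inf]
      refine and_congr_right fun _ => ?_
      by_cases hx : x = 0
      · simp [hx]
      · simp only [hx, false_or, lyap, linFlow_eq]
        exact lyap_le_iff (SA_flow A) hx s
    rw [h1, Submodule.span_eq]
    apply le_antisymm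
    · rintro x ⟨hx1, hx2⟩
      rw [SetLike.mem_coe, XH_span b w hb, mem_spanP] at hx1
      rw [mem_spanP]
      intro i hi
      by_cases h0 : w i = 0
      · exact hx1 i (by simpa using h0)
      · exact coord_Lsp (SA_flow A) b w hb hx2 i (not_le.1 fun h => hi ⟨h0, h⟩)
    · rw [Submodule.span_le]
      rintro _ ⟨i, hi, rfl⟩
      refine ⟨?_, Esp_le_Lsp hi.2 (hb i)⟩
      rw [XH_span b w hb]
      exact Submodule.subset_span ⟨i, hi.1, rfl⟩
  rw [ellIn, h, finrank_spanP]

lemma lyapExpH_eq (hb : ∀ i, b i ∈ Esp (SA A) (w i)) {n : ℕ} (e : Fin n ≃ {i // w i ≠ 0}) (he : Monotone fun k => w (e k)) (j : Fin n) :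
    lyapExpH A j = w (e j) := by
  rw [lyapExpH, lyapExpIn]
  have hcard : ∀ s, ellIn A (XH A) s = (Finset.univ.filter fun k : Fin n => w (e k) ≤ s).card := by
    intro s
    rw [ellIn_eq b w hb, ← Fintype.card_subtype]
    refine Fintype.card_congr ?_
    refine (Equiv.subtypeSubtypeEquivSubtypeInter (fun i => w i ≠ 0) (fun i => w i ≤ s)).symm.trans ?_
    exact (e.subtypeEquiv fun k => Iff.rfl).symm
  have : {s : ℝ | (j : ℕ) + 1 ≤ ellIn A (XH A) s} = Set.Ici (w (e j)) := by
    ext s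
    rw [Set.mem_ofPred_eq, hcard, Set.mem_Ici]
    constructor
    · intro h
      by_contra hlt
      push Not at hlt
      have : (Finset.univ.filter fun k : Fin n => w (e k) ≤ s) ⊆ Finset.Iio j := by
        intro k hk
        have hk : w (e k) ≤ s := by simpa using hk
        rw [Finset.mem_Iio]
        by_contra hkj
        have := he (not_lt.1 hkj)
        simp only at this
        linarith
      have := Finset.card_le_card this
      rw [Fin.card_Iio] at this
      omega
    · intro h
      have : Finset.Iic j ⊆ (Finset.univ.filter fun k : Fin n => w (e k) ≤ s) := by
        intro k hk
        rw [Finset.mem_Iic] at hk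
        simp only [Finset.mem_filter, Finset.mem_univ, true_and]
        exact (he hk).trans h
      have := Finset.card_le_card this
      rwa [Fin.card_Iic] at this
  rw [this, csInf_Ici]

lemma exists_sorted {n : ℕ} (hn : n = Fintype.card {i // w i ≠ 0}) :
    ∃ e : Fin n ≃ {i // w i ≠ 0}, Monotone fun k => w (e k) := by
  subst hn
  let e0 := (Fintype.equivFin {i // w i ≠ 0}).symm
  refine ⟨(Tuple.sort fun k => w (e0 k)).trans e0, ?_⟩
  exact Tuple.monotone_sort fun k => w (e0 k)

end spaces

open Filter Topology

lemma HB_fst {V P W : Type*} [NormedAddCommGroup V] [NormedSpace ℝ V] [NormedAddCommGroup W]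
    [NormedSpace ℝ W] [NormedAddCommGroup P] [NormedSpace ℝ P] (Q : V →L[ℝ] W) {γ : ℝ}
    (h0 : 0 ≤ γ) (h1 : γ ≤ 1) : HB γ (fun p : V × P => Q p.1) :=
  HB.clm_comp Q h0 (HB.of_clm' (ContinuousLinearMap.fst ℝ V P) h0 h1)

lemma HB_snd {V P W Z : Type*} [NormedAddCommGroup V] [NormedSpace ℝ V] [NormedAddCommGroup W]
    [NormedSpace ℝ W] [NormedAddCommGroup P] [NormedSpace ℝ P] [NormedAddCommGroup Z]
    (Q : P →L[ℝ] W) {γ : ℝ} (h0 : 0 ≤ γ) {g : W → Z} (hg : HB γ g) :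
    HB γ (fun p : V × P => g (Q p.2)) :=
  HB.comp_clm (Q.comp (ContinuousLinearMap.snd ℝ V P)) h0 hg

section normal
variable {d : ℕ} (A : Matrix (Fin d) (Fin d) ℝ)

set_option maxHeartbeats 800000 in
theorem normal_form (n : ℕ) (hn : n = dimHyp A) :
    ∃ (f : Euc d → XC A × (Fin n → ℝ)) (g : XC A × (Fin n → ℝ) → Euc d),
      (∀ x, g (f x) = x) ∧ (∀ p, f (g p) = p) ∧ f 0 = 0 ∧ g 0 = 0 ∧
      (∀ γ : ℝ, 0 < γ → γ < 1 → HB γ f) ∧ (∀ γ : ℝ, 0 < γ → γ < 1 → HB γ g) ∧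
      (∀ t x, ((f (SA A t x)).1 : Euc d) = SA A t (f x).1) ∧
      (∀ t x (j : Fin n), (f (SA A t x)).2 j = Real.exp (lyapExpH A j * t) * (f x).2 j) := by
  obtain ⟨ι, _, _, b, w, hb⟩ := adapted_basis A
  rw [dimHyp_eq b w hb] at hn
  obtain ⟨e, he⟩ := exists_sorted w hn
  have hS := SA_flow A
  have hlyap := lyapExpH_eq b w hb e he
  have hC : ∀ x, x ∈ XC A ↔ x ∈ Esp (SA A) 0 := fun x => by rw [XC_eq]
  have hwc : ∀ l, ∃ F G : Euc d → Euc d, l ≠ 0 → (∀ x, F x ∈ Esp (SA A) l) ∧ (∀ x, G x ∈ Esp (SA A) l) ∧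
      (∀ x ∈ Esp (SA A) l, G (F x) = x) ∧ (∀ x ∈ Esp (SA A) l, F (G x) = x) ∧
      (∀ x, F (pr b w l x) = F x) ∧
      (∀ t x, F (SA A t x) = Real.exp (l * t) • F x) ∧ F 0 = 0 ∧ G 0 = 0 ∧
      (∀ γ : ℝ, 0 < γ → γ < 1 → HB γ F) ∧ (∀ γ : ℝ, 0 < γ → γ < 1 → HB γ G) := by
    intro l
    by_cases hl : l = 0
    · exact ⟨id, id, fun h => absurd hl h⟩
    · obtain ⟨F, G, h⟩ := weight_conj hS b w hb l hl
      exact ⟨F, G, fun _ => h⟩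
  choose F G hFG using hwc
  have hne : ∀ j, w (e j) ≠ 0 := fun j => (e j).2
  let W : Finset ℝ := Finset.univ.image fun j => w (e j)
  have hW : ∀ l ∈ W, l ≠ 0 := by
    intro l hl
    obtain ⟨j, -, rfl⟩ := Finset.mem_image.1 hl
    exact hne j
  have hjW : ∀ j, w (e j) ∈ W := fun j => Finset.mem_image_of_mem _ (Finset.mem_univ j)
  let Y : ℝ → (Fin n → ℝ) →L[ℝ] Euc d := fun l =>
    ∑ j, if w (e j) = l then (ContinuousLinearMap.proj (R := ℝ) (φ := fun _ : Fin n => ℝ) j).smulRight (b (e j)) else 0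
  have hY : ∀ l c, Y l c = ∑ j, if w (e j) = l then c j • b (e j) else 0 := by
    intro l c
    simp only [Y, ContinuousLinearMap.sum_apply]
    refine Finset.sum_congr rfl fun j _ => ?_
    split_ifs <;> rfl
  have hYmem : ∀ l c, Y l c ∈ Esp (SA A) l := by
    intro l c
    rw [hY]
    refine Submodule.sum_mem _ fun j _ => ?_
    split_ifs with h
    · exact Submodule.smul_mem _ _ (h ▸ hb _)
    · exact Submodule.zero_mem _
  have hYrepr : ∀ c j, b.repr (Y (w (e j)) c) (e j) = c j := by
    intro c j
    rw [hY]
    simp only [map_sum, Finsupp.finsetSum_apply]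
    rw [Finset.sum_eq_single j]
    · simp
    · intro k _ hk
      split_ifs
      · have : ((e k : {i // w i ≠ 0}) : ι) ≠ e j := fun h => hk (e.injective (Subtype.ext h))
        simp [this]
      · simp
    · simp
  have hYF : ∀ l, l ≠ 0 → ∀ y ∈ Esp (SA A) l, Y l (fun j => b.repr y (e j)) = y := by
    intro l hl y hy
    rw [hY]
    have h1 : ∀ j, (if w (e j) = l then b.repr y (e j) • b (e j) else 0) = b.repr y (e j) • b (e j) := by
      intro j
      split_ifs with h
      · rfl
      · rw [coord_Esp hS b w hb hy _ h, zero_smul]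
    simp only [h1]
    rw [Equiv.sum_comp e (fun i : {i // w i ≠ 0} => b.repr y i • b i)]
    conv_rhs => rw [← b.sum_repr y]
    rw [← Finset.sum_subtype (Finset.univ.filter fun i => w i ≠ 0) (by simp)
      (fun i => b.repr y i • b i)]
    refine Finset.sum_subset (Finset.filter_subset _ _) fun i _ hi => ?_
    have hwi : w i = 0 := by simpa using hi
    rw [coord_Esp hS b w hb hy i (by rw [hwi]; exact hl.symm), zero_smul]
  let f : Euc d → XC A × (Fin n → ℝ) := fun x =>
    (((pr b w 0).codRestrict (XC A) fun x => (hC _).2 (pr_mem b w hb 0 x)) x,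
      fun j => b.repr (F (w (e j)) x) (e j))
  let g : XC A × (Fin n → ℝ) → Euc d := fun p => (p.1 : Euc d) + ∑ l ∈ W, G l (Y l p.2)
  have hf1 : ∀ x, ((f x).1 : Euc d) = pr b w 0 x := fun x => rfl
  have hf2 : ∀ x j, (f x).2 j = b.repr (F (w (e j)) x) (e j) := fun x j => rfl
  refine ⟨f, g, ?_, ?_, ?_, ?_, ?_, ?_, ?_, ?_⟩
  · intro x
    have h1 : ∀ l ∈ W, G l (Y l (f x).2) = pr b w l x := by
      intro l hl
      obtain ⟨hF, hG, hGF, hFG', hFpr, -⟩ := hFG l (hW l hl)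
      have : Y l (f x).2 = F l x := by
        refine Eq.trans ?_ (hYF l (hW l hl) (F l x) (hF x))
        rw [hY, hY]
        refine Finset.sum_congr rfl fun j _ => ?_
        split_ifs with h
        · rw [hf2, h]
        · rfl
      rw [this, ← hFpr, hGF _ (pr_mem b w hb l x)]
    change ((f x).1 : Euc d) + ∑ l ∈ W, G l (Y l (f x).2) = x
    rw [Finset.sum_congr rfl h1, hf1]
    apply b.repr.injective
    ext i
    simp only [map_add, map_sum, Finsupp.add_apply, Finsupp.finsetSum_apply, pr_repr]
    rw [Finset.sum_ite_eq]
    by_cases hi : w i = 0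
    · have : w i ∉ W := fun h => hW _ h hi
      rw [if_pos hi, if_neg this, add_zero]
    · have : w i ∈ W := by
        have := hjW (e.symm ⟨i, hi⟩)
        simpa using this
      rw [if_neg hi, if_pos this, zero_add]
  · rintro ⟨z, c⟩
    have hz := (hC _).1 z.2
    have hG : ∀ l ∈ W, G l (Y l c) ∈ Esp (SA A) l := fun l hl => (hFG l (hW l hl)).2.1 _
    have hg : g (z, c) = (z : Euc d) + ∑ l ∈ W, G l (Y l c) := rfl
    refine Prod.ext (Subtype.ext ?_) (funext fun j => ?_)
    · rw [hf1, hg, map_add, map_sum, pr_self hS b w hb hz, Finset.sum_eq_zero, add_zero]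
      intro l hl
      exact pr_other hS b w hb (hW l hl).symm (hG l hl)
    · obtain ⟨-, hG', hGF, hFG', hFpr, -⟩ := hFG (w (e j)) (hne j)
      have : pr b w (w (e j)) (g (z, c)) = G (w (e j)) (Y (w (e j)) c) := by
        rw [hg, map_add, map_sum, pr_other hS b w hb (hne j) hz, zero_add,
          Finset.sum_eq_single (w (e j))]
        · exact pr_self hS b w hb (hG' _)
        · intro l hl hlj
          exact pr_other hS b w hb hlj.symm (hG l hl)
        · intro h; exact absurd (hjW j) h
      rw [hf2, ← hFpr, this, hFG' _ (hYmem _ _), hYrepr]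
  · refine Prod.ext (Subtype.ext ?_) (funext fun j => ?_)
    · rw [hf1]; simp
    · obtain ⟨-, -, -, -, -, -, hF0, -⟩ := hFG (w (e j)) (hne j)
      rw [hf2, hF0]; simp
  · change (((0 : XC A × (Fin n → ℝ)).1 : XC A) : Euc d) + ∑ l ∈ W, G l (Y l (0 : XC A × (Fin n → ℝ)).2) = 0
    rw [Finset.sum_eq_zero]
    · simp
    · intro l hl
      obtain ⟨-, -, -, -, -, -, -, hG0, -⟩ := hFG l (hW l hl)
      simp [hG0]
  · intro γ h0 h1
    refine HB.prodMk (HB.of_clm' _ h0.le h1.le) (HB.pi fun j => ?_)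
    obtain ⟨-, -, -, -, -, -, -, -, hF, -⟩ := hFG (w (e j)) (hne j)
    exact HB.clm_comp (LinearMap.toContinuousLinearMap (b.coord (e j))) h0.le (hF γ h0 h1)
  · intro γ h0 h1
    refine HB.add ?_ (HB.sum W fun l hl => ?_)
    · exact HB_fst (XC A).subtypeL h0.le h1.le
    · obtain ⟨-, -, -, -, -, -, -, -, -, hG⟩ := hFG l (hW l hl)
      exact HB_snd (Y l) h0.le (hG γ h0 h1)
  · intro t x
    rw [hf1, hf1, pr_comm hS b w hb]
  · intro t x j
    obtain ⟨-, -, -, -, -, hFe, -⟩ := hFG (w (e j)) (hne j)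
    rw [hf2, hf2, hFe, hlyap, map_smul]
    rfl

lemma Q_conj {A B : Matrix (Fin d) (Fin d) ℝ} {α : ℝ}
    (hA : ∀ x ∈ XC A, Matrix.toEuclideanLin A x ∈ XC A)
    (hB : ∀ x ∈ XC B, Matrix.toEuclideanLin B x ∈ XC B)
    (Q : XC A ≃ₗ[ℝ] XC B)
    (hQ : ∀ x : XC A, Q ((Matrix.toEuclideanLin A).restrict hA x)
      = α • (Matrix.toEuclideanLin B).restrict hB (Q x))
    (t : ℝ) (z z' : XC A) (hz : (z' : Euc d) = SA A t z) : (Q z' : Euc d) = SA B (α * t) (Q z) := by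
  let a : XC A →L[ℝ] XC A := LinearMap.toContinuousLinearMap ((Matrix.toEuclideanLin A).restrict hA)
  have h1 := Fl_intertwine a (opA A) (XC A).subtypeL (fun x => rfl) t z
  have hz' : z' = Fl a t z := Subtype.ext (hz.trans h1.symm)
  have h2 := Fl_intertwine a (α • opA B)
    ((XC B).subtypeL.comp (LinearMap.toContinuousLinearMap Q.toLinearMap)) (fun x => by
      change ((Q ((Matrix.toEuclideanLin A).restrict hA x) : XC B) : Euc d) = _
      rw [hQ]; rfl) t z
  rw [hz', SA, ← Fl_smul]
  exact h2

lemma HB.holderNearZero {γ : ℝ} {f : Euc d → Euc d} (hf : HB γ f) : HolderNearZero γ f := by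
  obtain ⟨K, -, h⟩ := hf 1
  refine ⟨1, one_pos, K, fun x hx y hy => ?_⟩
  rw [dist_eq_norm, dist_eq_norm]
  exact h x y (mem_ball_zero_iff.1 hx).le (mem_ball_zero_iff.1 hy).le

/-- the middle map between normal forms -/
lemma mid_HB {V W : Type*} [NormedAddCommGroup V] [NormedSpace ℝ V] [NormedAddCommGroup W] [NormedSpace ℝ W]
    (Q : V →L[ℝ] W) {n : ℕ} (θ : Fin n → ℝ) {β : ℝ} (hβ : 0 < β) (hβ1 : β < 1) (hθ : ∀ j, β ≤ θ j) :
    HB β (fun p : V × (Fin n → ℝ) => (Q p.1, fun j => spow (θ j) (p.2 j))) := by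
  refine HB.prodMk ?_ (HB.pi fun j => ?_)
  · exact HB_fst Q hβ.le hβ1.le
  · exact HB_snd (ContinuousLinearMap.proj (R := ℝ) (φ := fun _ : Fin n => ℝ) j) hβ.le
      (spow_HB hβ hβ1 (hθ j))

lemma triple_HB {E F G H : Type*} [NormedAddCommGroup E] [NormedAddCommGroup F] [NormedAddCommGroup G]
    [NormedAddCommGroup H] {f : E → F} {m : F → G} {g : G → H} {β : ℝ} (hβ : 0 < β)
    (hf : ∀ γ : ℝ, 0 < γ → γ < 1 → HB γ f) (hg : ∀ γ : ℝ, 0 < γ → γ < 1 → HB γ g)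
    (hm : HB β m) (γ : ℝ) (h0 : 0 < γ) (h1 : γ < β) : HB γ (fun x => g (m (f x))) := by
  set s := Real.sqrt (γ / β) with hs
  have hq : γ / β < 1 := by rw [div_lt_one hβ]; exact h1
  have hs0 : 0 < s := Real.sqrt_pos.2 (by positivity)
  have hs1 : s < 1 := by rw [hs, Real.sqrt_lt' one_pos]; simpa using hq
  have hss : s * s = γ / β := Real.mul_self_sqrt (by positivity)
  have h := HB.comp (by positivity) hs0.le (hg s hs0 hs1) (HB.comp hs0.le hβ.le hm (hf s hs0 hs1))
  have e : s * β * s = γ := by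
    rw [mul_right_comm, hss]; field_simp
  rwa [e] at h

end normal

/-- **Lemma 6.2**: if `A^{Φ_C}` and `α A^{Ψ_C}` are similar for some `α > 0` and
`β ≤ min {α λ_j^{Ψ_H}/λ_j^{Φ_H}, λ_j^{Φ_H}/(α λ_j^{Ψ_H})}` for every `j ≤ d_H`,
then `Φ ≃^{β⁻} Ψ`. -/
theorem central_similar_hyperbolic_bound_simEquiv {d : ℕ}
    (A B : Matrix (Fin d) (Fin d) ℝ) (β : ℝ) (hβ0 : 0 < β) (hβ1 : β < 1)
    (α : ℝ) (hα : 0 < α) (hsim : IsCentralSimilar A B α)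
    (hβj : ∀ j : ℕ, j < dimHyp A →
      β ≤ min (α * lyapExpH B j / lyapExpH A j) (lyapExpH A j / (α * lyapExpH B j))) :
    SimEquivWith (MemHBelow β) A B := by
  obtain ⟨hA, hB, Q, hQ⟩ := hsim
  have hdim : dimHyp A = dimHyp B := by
    have h1 := dim_add (A := A)
    have h2 := dim_add (A := B)
    have h3 := Q.finrank_eq
    omega
  obtain ⟨fA, gA, hgfA, hfgA, hfA0, hgA0, hfAH, hgAH, hfA1, hfA2⟩ := normal_form A _ rfl
  obtain ⟨fB, gB, hgfB, hfgB, hfB0, hgB0, hfBH, hgBH, hfB1, hfB2⟩ := normal_form B _ hdim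
  let θ : Fin (dimHyp A) → ℝ := fun j => α * lyapExpH B j / lyapExpH A j
  have hθ : ∀ j, β ≤ θ j := fun j => (hβj j j.2).trans (min_le_left _ _)
  have hθ0 : ∀ j, 0 < θ j := fun j => hβ0.trans_le (hθ j)
  have hθi : ∀ j, β ≤ (θ j)⁻¹ := fun j => by
    refine (hβj j j.2).trans ((min_le_right _ _).trans (le_of_eq ?_))
    simp only [θ, inv_div]
  have hθl : ∀ j : Fin (dimHyp A), lyapExpH A j * θ j = α * lyapExpH B j := fun j => by
    have : lyapExpH A j ≠ 0 := by
      intro h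
      have := hθ0 j
      simp [θ, h] at this
    simp only [θ]
    field_simp
  let Qc : XC A →L[ℝ] XC B := LinearMap.toContinuousLinearMap Q.toLinearMap
  let Qi : XC B →L[ℝ] XC A := LinearMap.toContinuousLinearMap Q.symm.toLinearMap
  let m : XC A × (Fin (dimHyp A) → ℝ) → XC B × (Fin (dimHyp A) → ℝ) :=
    fun p => (Qc p.1, fun j => spow (θ j) (p.2 j))
  let k : XC B × (Fin (dimHyp A) → ℝ) → XC A × (Fin (dimHyp A) → ℝ) :=
    fun p => (Qi p.1, fun j => spow (θ j)⁻¹ (p.2 j))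
  have hkm : ∀ p, k (m p) = p := fun p => by
    refine Prod.ext (Q.symm_apply_apply _) (funext fun j => spow_spow (hθ0 j) _)
  have hmk : ∀ p, m (k p) = p := fun p => by
    refine Prod.ext (Q.apply_symm_apply _) (funext fun j => ?_)
    have := spow_spow (inv_pos.2 (hθ0 j)) (p.2 j)
    rw [inv_inv] at this
    exact this
  have hm : HB β m := mid_HB Qc θ hβ0 hβ1 hθ
  have hk : HB β k := mid_HB Qi (fun j => (θ j)⁻¹) hβ0 hβ1 hθi
  have H1 := triple_HB hβ0 hfAH hgBH hm
  have H2 := triple_HB hβ0 hfBH hgAH hk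
  let h : Euc d ≃ₜ Euc d :=
    { toFun := fun x => gB (m (fA x))
      invFun := fun x => gA (k (fB x))
      left_inv := fun x => by simp only [hfgB, hkm, hgfA]
      right_inv := fun x => by simp only [hfgA, hmk, hgfB]
      continuous_toFun := (H1 (β / 2) (by positivity) (by linarith)).continuous (by positivity)
      continuous_invFun := (H2 (β / 2) (by positivity) (by linarith)).continuous (by positivity) }
  have hm0 : m 0 = 0 := by
    refine Prod.ext (map_zero Qc) (funext fun j => spow_zero)
  refine ⟨h, α, hα.ne', fun γ h0 h1 => ⟨?_, (H1 γ h0 h1).holderNearZero, (H2 γ h0 h1).holderNearZero⟩, ?_⟩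
  · change gB (m (fA 0)) = 0
    rw [hfA0, hm0, hgB0]
  · intro t x
    change gB (m (fA (linFlow A t x))) = linFlow B (α * t) (gB (m (fA x)))
    rw [linFlow_eq, linFlow_eq, ← hgfB (SA B (α * t) (gB (m (fA x))))]
    congr 1
    refine Prod.ext (Subtype.ext ?_) (funext fun j => ?_)
    · rw [hfB1, hfgB]
      exact Q_conj hA hB Q hQ t _ _ (hfA1 t x)
    · rw [hfB2, hfgB]
      change spow (θ j) ((fA (SA A t x)).2 j) = Real.exp (lyapExpH B j * (α * t)) * spow (θ j) ((fA x).2 j)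
      rw [hfA2, spow_mul_of_pos (Real.exp_pos _), ← Real.exp_mul]
      congr 2
      rw [mul_right_comm, hθl]; ring

end LF
end
end
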